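/- There exist a constant c_n ∈ (0,1] depending only on n and a universal constant C > 0 (depending only on n, λ, Λ and φ) with the following property. Let u ∈ C(Q₂) be a non-negative viscosity supersolution of P⁻_{λ,Λ}(D²u) − u_t ≤ φ(|Du|) and a viscosity subsolution of P⁺_{λ,Λ}(D²u) − u_t ≥ −φ(|Du|) in Q₂ ⊂ ℝⁿ×ℝ. If u(x₀,t₀) > 0 and 0 < ρ ≤ α₀ := u(x₀,t₀)/(C(φ(u(x₀,t₀)) + u(x₀,t₀))) is such that Q_{2ρ}(x₀,t₀) ∪ A⁺_ρ(x₀,t₀) ⊂ Q₂, then u(x₀,t₀) ≤ C · inf_{(x,t) ∈ A⁺_ρ(x₀,t₀)} u(x,t). -/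

import Mathlib

open Set Filter

/-- Pucci minimal operator `P⁻_{λ,Λ}`. -/
noncomputable def pucciMinus {n : ℕ} (lam Lam : ℝ) (M : Matrix (Fin n) (Fin n) ℝ) : ℝ :=
  letI := Classical.propDecidable M.IsHermitian
  if h : M.IsHermitian then
    lam * ∑ i, max (h.eigenvalues i) 0 + Lam * ∑ i, min (h.eigenvalues i) 0
  else 0

/-- Pucci maximal operator `P⁺_{λ,Λ}`. -/
noncomputable def pucciPlus {n : ℕ} (lam Lam : ℝ) (M : Matrix (Fin n) (Fin n) ℝ) : ℝ :=
  letI := Classical.propDecidable M.IsHermitian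
  if h : M.IsHermitian then
    Lam * ∑ i, max (h.eigenvalues i) 0 + lam * ∑ i, min (h.eigenvalues i) 0
  else 0

/-- Hessian matrix of `u : ℝⁿ → ℝ`. -/
noncomputable def hessian {n : ℕ} (u : EuclideanSpace ℝ (Fin n) → ℝ)
    (x : EuclideanSpace ℝ (Fin n)) : Matrix (Fin n) (Fin n) ℝ :=
  Matrix.of fun i j =>
    fderiv ℝ (fun y => fderiv ℝ u y (EuclideanSpace.single i 1)) x (EuclideanSpace.single j 1)

/-- Parabolic cube `Q_ρ(x₀,t₀)`. -/
def pcube {n : ℕ} (x₀ : EuclideanSpace ℝ (Fin n)) (t₀ ρ : ℝ) :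
    Set (EuclideanSpace ℝ (Fin n) × ℝ) :=
  {p | (∀ i, |p.1 i - x₀ i| < ρ) ∧ p.2 ∈ Set.Ioc (t₀ - ρ ^ 2) t₀}

/-- Spatial Hessian of `ψ(x,t)` in the `x` variable. -/
noncomputable def spatialHessian {n : ℕ} (ψ : EuclideanSpace ℝ (Fin n) × ℝ → ℝ)
    (p : EuclideanSpace ℝ (Fin n) × ℝ) : Matrix (Fin n) (Fin n) ℝ :=
  hessian (fun y => ψ (y, p.2)) p.1

/-- Spatial gradient of `ψ(x,t)` in the `x` variable. -/
noncomputable def spatialGrad {n : ℕ} (ψ : EuclideanSpace ℝ (Fin n) × ℝ → ℝ)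
    (p : EuclideanSpace ℝ (Fin n) × ℝ) : EuclideanSpace ℝ (Fin n) :=
  gradient (fun y => ψ (y, p.2)) p.1

/-- Time derivative `ψ_t`. -/
noncomputable def timeDeriv {n : ℕ} (ψ : EuclideanSpace ℝ (Fin n) × ℝ → ℝ)
    (p : EuclideanSpace ℝ (Fin n) × ℝ) : ℝ :=
  deriv (fun s => ψ (p.1, s)) p.2

/-- Viscosity supersolution of `P⁻_{λ,Λ}(D²u) − u_t ≤ φ(|Du|)` in `Q`. -/
def IsViscositySupersol {n : ℕ} (lam Lam : ℝ) (φ : ℝ → ℝ)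
    (Q : Set (EuclideanSpace ℝ (Fin n) × ℝ)) (u : EuclideanSpace ℝ (Fin n) × ℝ → ℝ) : Prop :=
  ∀ p ∈ Q, ∀ ψ : EuclideanSpace ℝ (Fin n) × ℝ → ℝ, ContDiffOn ℝ 2 ψ Q →
    (∀ q ∈ Q, ψ q ≤ u q) → ψ p = u p →
    pucciMinus lam Lam (spatialHessian ψ p) - timeDeriv ψ p ≤ φ ‖spatialGrad ψ p‖

/-- Viscosity subsolution of `P⁺_{λ,Λ}(D²u) − u_t ≥ −φ(|Du|)` in `Q`. -/
def IsViscositySubsol {n : ℕ} (lam Lam : ℝ) (φ : ℝ → ℝ)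
    (Q : Set (EuclideanSpace ℝ (Fin n) × ℝ)) (u : EuclideanSpace ℝ (Fin n) × ℝ → ℝ) : Prop :=
  ∀ p ∈ Q, ∀ ψ : EuclideanSpace ℝ (Fin n) × ℝ → ℝ, ContDiffOn ℝ 2 ψ Q →
    (∀ q ∈ Q, u q ≤ ψ q) → ψ p = u p →
    -φ ‖spatialGrad ψ p‖ ≤ pucciPlus lam Lam (spatialHessian ψ p) - timeDeriv ψ p

/-- The structural conditions (P1)–(P3) on the nonlinearity `φ(t) = η(t)·t`. -/
structure PhiEta (φ η : ℝ → ℝ) (Λ₀ : ℝ) : Prop where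
  phi_eq : ∀ t > 0, φ t = η t * t
  phi_zero : φ 0 = 0
  phi_mono : MonotoneOn φ (Set.Ici 0)
  phi_lip : LocallyLipschitzOn (Set.Ioi 0) φ
  phi_ge : ∀ t ≥ 0, t ≤ φ t
  eta_ge_one : ∀ t > 0, 1 ≤ η t
  eta_anti : AntitoneOn η (Set.Ioo 0 1)
  eta_mono : MonotoneOn η (Set.Ici 1)
  cond_P2 : Filter.Tendsto (fun t => t * deriv η t / η t * Real.log (η t))
      Filter.atTop (nhds 0)
  lam0_ge_one : 1 ≤ Λ₀
  cond_P3 : ∀ s > 0, ∀ t > 0, η (s * t) ≤ Λ₀ * η s * η t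

/-- The region `A⁺_ρ(x₀,t₀)` (with dimensional constant `c = c_n`). -/
def aPlus {n : ℕ} (c : ℝ) (x₀ : EuclideanSpace ℝ (Fin n)) (t₀ ρ : ℝ) :
    Set (EuclideanSpace ℝ (Fin n) × ℝ) :=
  {p | (∀ i, |p.1 i - x₀ i| < ρ * c / 2) ∧
    p.2 - t₀ ∈ Set.Ioc (ρ ^ 2 - (ρ * c) ^ 2 / 2) (ρ ^ 2 - (ρ * c) ^ 2 / 4)}

/-- Euclidean `n`-space. -/
abbrev Sp (n : ℕ) := EuclideanSpace ℝ (Fin n)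

/-- A standard basis vector. -/
noncomputable abbrev bv {n : ℕ} (i : Fin n) : Sp n := EuclideanSpace.single i (1 : ℝ)

/-- The trace of a bilinear form in the standard basis. -/
noncomputable def btrace {n : ℕ} (B : Sp n →L[ℝ] Sp n →L[ℝ] ℝ) : ℝ := ∑ i, B (bv i) (bv i)

lemma hermitian_eigenvalue_eq {n : ℕ} {M : Matrix (Fin n) (Fin n) ℝ} (hM : M.IsHermitian)
    (i : Fin n) : ∃ v : Sp n, ‖v‖ = 1 ∧ hM.eigenvalues i = v.ofLp ⬝ᵥ M.mulVec v.ofLp := by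
  refine ⟨hM.eigenvectorBasis i, hM.eigenvectorBasis.orthonormal.1 i, ?_⟩
  have := hM.eigenvalues_eq i
  simpa using this

lemma pucciMinus_ge {n : ℕ} {M : Matrix (Fin n) (Fin n) ℝ} (hM : M.IsHermitian) {lam Lam α : ℝ}
    (hle : lam ≤ Lam) (hα : 0 ≤ α)
    (h : ∀ v : Sp n, -α * ‖v‖ ^ 2 ≤ v.ofLp ⬝ᵥ M.mulVec v.ofLp) :
    lam * M.trace - (Lam - lam) * n * α ≤ pucciMinus lam Lam M := by
  have he : ∀ i, -α ≤ hM.eigenvalues i := by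
    intro i
    obtain ⟨v, hv, hv'⟩ := hermitian_eigenvalue_eq hM i
    have := h v
    rw [hv, ← hv'] at this
    linarith
  have ht : M.trace = ∑ i, hM.eigenvalues i := by
    simpa using hM.trace_eq_sum_eigenvalues
  unfold pucciMinus
  rw [dif_pos hM, ht, Finset.mul_sum, Finset.mul_sum, Finset.mul_sum, ← Finset.sum_add_distrib]
  have h1 : (Lam - lam) * n * α = ∑ _i : Fin n, (Lam - lam) * α := by
    simp; ring
  rw [h1, ← Finset.sum_sub_distrib]
  refine Finset.sum_le_sum fun i _ => ?_
  have h2 : max (hM.eigenvalues i) 0 + min (hM.eigenvalues i) 0 = hM.eigenvalues i := by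
    rw [max_add_min]; simp
  have h3 : -α ≤ min (hM.eigenvalues i) 0 := le_min (he i) (by linarith)
  have h4 : lam * max (hM.eigenvalues i) 0 + lam * min (hM.eigenvalues i) 0 =
      lam * hM.eigenvalues i := by rw [← mul_add, h2]
  nlinarith [mul_nonneg (sub_nonneg.2 hle) (by linarith : 0 ≤ min (hM.eigenvalues i) 0 + α)]

lemma pucciPlus_le {n : ℕ} {M : Matrix (Fin n) (Fin n) ℝ} (hM : M.IsHermitian) {lam Lam α : ℝ}
    (hle : lam ≤ Lam) (hα : 0 ≤ α)
    (h : ∀ v : Sp n, v.ofLp ⬝ᵥ M.mulVec v.ofLp ≤ α * ‖v‖ ^ 2) :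
    pucciPlus lam Lam M ≤ lam * M.trace + (Lam - lam) * n * α := by
  have he : ∀ i, hM.eigenvalues i ≤ α := by
    intro i
    obtain ⟨v, hv, hv'⟩ := hermitian_eigenvalue_eq hM i
    have := h v
    rw [hv, ← hv'] at this
    linarith
  have ht : M.trace = ∑ i, hM.eigenvalues i := by
    simpa using hM.trace_eq_sum_eigenvalues
  unfold pucciPlus
  rw [dif_pos hM, ht, Finset.mul_sum, Finset.mul_sum, Finset.mul_sum, ← Finset.sum_add_distrib]
  have h1 : (Lam - lam) * n * α = ∑ _i : Fin n, (Lam - lam) * α := by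
    simp; ring
  rw [h1, ← Finset.sum_add_distrib]
  refine Finset.sum_le_sum fun i _ => ?_
  have h2 : max (hM.eigenvalues i) 0 + min (hM.eigenvalues i) 0 = hM.eigenvalues i := by
    rw [max_add_min]; simp
  have h3 : max (hM.eigenvalues i) 0 ≤ α := max_le (he i) hα
  have h4 : lam * max (hM.eigenvalues i) 0 + lam * min (hM.eigenvalues i) 0 =
      lam * hM.eigenvalues i := by rw [← mul_add, h2]
  nlinarith [mul_nonneg (sub_nonneg.2 hle) (by linarith : 0 ≤ α - max (hM.eigenvalues i) 0)]

/-- The inner product as a continuous bilinear form. -/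
noncomputable def ip {n : ℕ} : Sp n →L[ℝ] Sp n →L[ℝ] ℝ := innerSL ℝ

lemma ip_apply {n : ℕ} (v w : Sp n) : ip v w = inner ℝ v w := rfl

lemma norm_ip {n : ℕ} (v : Sp n) : ‖ip v‖ = ‖v‖ := innerSL_apply_norm ℝ v

/-- A `C²` function on space-time together with its spatial gradient, spatial Hessian and time
derivative. -/
structure TestData {n : ℕ} (ψ : Sp n × ℝ → ℝ) (g : Sp n × ℝ → Sp n →L[ℝ] ℝ)
    (B : Sp n × ℝ → Sp n →L[ℝ] Sp n →L[ℝ] ℝ) (b : Sp n × ℝ → ℝ) : Prop where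
  smooth : ContDiff ℝ 2 ψ
  grad : ∀ z, HasFDerivAt (fun y => ψ (y, z.2)) (g z) z.1
  hess : ∀ z, HasFDerivAt (fun y => g (y, z.2)) (B z) z.1
  symm : ∀ z v w, B z v w = B z w v
  time : ∀ z, HasDerivAt (fun s => ψ (z.1, s)) (b z) z.2

lemma bilin_eq_dotProduct {n : ℕ} (B : Sp n →L[ℝ] Sp n →L[ℝ] ℝ) (v : Sp n) :
    B v v = v.ofLp ⬝ᵥ (Matrix.of fun i j => B (bv j) (bv i)).mulVec v.ofLp := by
  have hv : v = ∑ i, v i • (bv i : Sp n) := by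
    ext j
    simp [Finset.sum_apply, Pi.single_apply]
  conv_lhs => rw [hv]
  simp only [map_sum, map_smul, sum_apply, smul_apply,
    smul_eq_mul, dotProduct, Matrix.mulVec, Matrix.of_apply, Finset.mul_sum]
  refine Finset.sum_congr rfl fun i _ => Finset.sum_congr rfl fun j _ => by ring

namespace TestData

variable {n : ℕ} {ψ : Sp n × ℝ → ℝ} {g : Sp n × ℝ → Sp n →L[ℝ] ℝ}
  {B : Sp n × ℝ → Sp n →L[ℝ] Sp n →L[ℝ] ℝ} {b : Sp n × ℝ → ℝ}

lemma spatialHessian_eq (h : TestData ψ g B b) {ψ' : Sp n × ℝ → ℝ} {z : Sp n × ℝ}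
    (he : ψ' =ᶠ[nhds z] ψ) :
    spatialHessian ψ' z = Matrix.of fun i j => B z (bv j) (bv i) := by
  have hc : Tendsto (fun y : Sp n => (y, z.2)) (nhds z.1) (nhds z) := by
    have : Continuous (fun y : Sp n => (y, z.2)) := by fun_prop
    exact this.tendsto' _ _ rfl
  have h1 : ∀ᶠ y in nhds z.1, (fun y => ψ' (y, z.2)) =ᶠ[nhds y] fun y => ψ (y, z.2) :=
    (hc.eventually he).eventually_nhds
  ext i j
  simp only [spatialHessian, hessian, Matrix.of_apply]
  have h2 : (fun y => fderiv ℝ (fun y => ψ' (y, z.2)) y (EuclideanSpace.single i 1))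
      =ᶠ[nhds z.1] fun y => g (y, z.2) (bv i) := by
    filter_upwards [h1] with y hy
    rw [hy.fderiv_eq, (h.grad (y, z.2)).fderiv]
  rw [h2.fderiv_eq]
  have h3 : HasFDerivAt (fun y => g (y, z.2) (bv i)) ((B z).flip (bv i)) z.1 := by
    have := (h.hess z).clm_apply (hasFDerivAt_const (bv i) z.1)
    simpa using this
  rw [h3.fderiv]
  rfl

lemma norm_spatialGrad_eq (h : TestData ψ g B b) {ψ' : Sp n × ℝ → ℝ} {z : Sp n × ℝ}
    (he : ψ' =ᶠ[nhds z] ψ) : ‖spatialGrad ψ' z‖ = ‖g z‖ := by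
  have hc : Tendsto (fun y : Sp n => (y, z.2)) (nhds z.1) (nhds z) := by
    have : Continuous (fun y : Sp n => (y, z.2)) := by fun_prop
    exact this.tendsto' _ _ rfl
  have h1 : (fun y => ψ' (y, z.2)) =ᶠ[nhds z.1] fun y => ψ (y, z.2) := hc.eventually he
  simp only [spatialGrad, gradient]
  rw [h1.fderiv_eq, (h.grad z).fderiv]
  simp

lemma timeDeriv_eq (h : TestData ψ g B b) {ψ' : Sp n × ℝ → ℝ} {z : Sp n × ℝ}
    (he : ψ' =ᶠ[nhds z] ψ) : timeDeriv ψ' z = b z := by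
  have hc : Tendsto (fun s : ℝ => (z.1, s)) (nhds z.2) (nhds z) := by
    have : Continuous (fun s : ℝ => (z.1, s)) := by fun_prop
    exact this.tendsto' _ _ rfl
  have h1 : (fun s => ψ' (z.1, s)) =ᶠ[nhds z.2] fun s => ψ (z.1, s) := hc.eventually he
  simp only [timeDeriv]
  rw [h1.deriv_eq, (h.time z).deriv]

lemma isHermitian (h : TestData ψ g B b) (z : Sp n × ℝ) :
    (Matrix.of fun i j => B z (bv j) (bv i)).IsHermitian := by
  ext i j
  simp [h.symm z (bv i) (bv j)]

lemma add {ψ₂ g₂ B₂ b₂} (h : TestData ψ g B b) (h₂ : TestData (n := n) ψ₂ g₂ B₂ b₂) :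
    TestData (fun z => ψ z + ψ₂ z) (fun z => g z + g₂ z) (fun z => B z + B₂ z)
      (fun z => b z + b₂ z) where
  smooth := h.smooth.add h₂.smooth
  grad z := (h.grad z).add (h₂.grad z)
  hess z := (h.hess z).add (h₂.hess z)
  symm z v w := by simp [h.symm z v w, h₂.symm z v w]
  time z := (h.time z).add (h₂.time z)

lemma const_mul (h : TestData ψ g B b) (c : ℝ) :
    TestData (fun z => c * ψ z) (fun z => c • g z) (fun z => c • B z) (fun z => c * b z) where
  smooth := contDiff_const.mul h.smooth
  grad z := (h.grad z).const_mul c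
  hess z := (h.hess z).const_smul c
  symm z v w := by simp [h.symm z v w]
  time z := (h.time z).const_mul c

lemma add_time (h : TestData ψ g B b) {f f' : ℝ → ℝ} (hf : ContDiff ℝ 2 f)
    (hf' : ∀ t, HasDerivAt f (f' t) t) :
    TestData (fun z => ψ z + f z.2) g B (fun z => b z + f' z.2) where
  smooth := h.smooth.add (hf.comp contDiff_snd)
  grad z := (h.grad z).add_const (f z.2)
  hess z := h.hess z
  symm z v w := h.symm z v w
  time z := (h.time z).add (hf' z.2)

lemma const_sub (h : TestData ψ g B b) (L : ℝ) :
    TestData (fun z => L - ψ z) (fun z => -g z) (fun z => -B z) (fun z => -b z) where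
  smooth := contDiff_const.sub h.smooth
  grad z := (h.grad z).const_sub L
  hess z := (h.hess z).neg
  symm z v w := by simp [h.symm z v w]
  time z := (h.time z).const_sub L

/-- The squared distance to a point, as test data. -/
lemma normSq (c : Sp n) :
    TestData (fun z => ‖z.1 - c‖ ^ 2) (fun z => (2 : ℝ) • ip (z.1 - c))
      (fun _ => (2 : ℝ) • ip) (fun _ => 0) where
  smooth := (contDiff_fst.sub contDiff_const).norm_sq ℝ
  grad z := by
    have := ((hasStrictFDerivAt_norm_sq (z.1 - c)).hasFDerivAt).comp z.1
      ((hasFDerivAt_id z.1).sub_const c)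
    have h2 : (2 : ℝ) • ip (z.1 - c) =
        (2 • innerSL ℝ (z.1 - c)).comp (ContinuousLinearMap.id ℝ (Sp n)) := by
      ext v
      change (2 : ℝ) * inner ℝ (z.1 - c) v = (2 : ℕ) • inner ℝ (z.1 - c) v
      simp
    rw [h2]
    exact this
  hess z := by
    have := ((ip : Sp n →L[ℝ] Sp n →L[ℝ] ℝ).hasFDerivAt (x := z.1 - c)).comp z.1
      ((hasFDerivAt_id z.1).sub_const c)
    exact this.const_smul (2 : ℝ)
  symm z v w := by
    change (2 : ℝ) * inner ℝ v w = (2 : ℝ) * inner ℝ w v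
    rw [real_inner_comm]
  time z := hasDerivAt_const z.2 (‖z.1 - c‖ ^ 2)

end TestData

lemma hasDerivAt_posPart_pow (k : ℕ) (s : ℝ) :
    HasDerivAt (fun s : ℝ => max s 0 ^ (k + 2)) ((k + 2) * max s 0 ^ (k + 1)) s := by
  rcases lt_trichotomy s 0 with hs | hs | hs
  · have : (fun s : ℝ => max s 0 ^ (k + 2)) =ᶠ[nhds s] fun _ => 0 := by
      filter_upwards [gt_mem_nhds hs] with x hx
      rw [max_eq_right hx.le]; simp
    rw [max_eq_right hs.le]
    simpa using (hasDerivAt_const s (0 : ℝ)).congr_of_eventuallyEq this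
  · subst hs
    rw [hasDerivAt_iff_isLittleO]
    simp only [sub_zero, max_self, smul_eq_mul]
    have h1 : (fun x : ℝ => max x 0 ^ (k + 2)) =O[nhds 0] fun x : ℝ => x ^ (k + 2) := by
      refine Asymptotics.isBigO_of_le _ fun x => ?_
      rw [norm_pow, norm_pow]
      refine pow_le_pow_left₀ (norm_nonneg _) ?_ _
      rw [Real.norm_eq_abs, Real.norm_eq_abs, abs_of_nonneg (le_max_right _ _)]
      exact max_le (le_abs_self _) (abs_nonneg _)
    have h2 : (fun x : ℝ => x ^ (k + 2)) =o[nhds 0] fun x : ℝ => x := by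
      simpa using Asymptotics.isLittleO_pow_id (𝕜 := ℝ) (n := k + 2) (by omega)
    simpa using h1.trans_isLittleO h2
  · have : (fun s : ℝ => max s 0 ^ (k + 2)) =ᶠ[nhds s] fun s => s ^ (k + 2) := by
      filter_upwards [lt_mem_nhds hs] with x hx
      rw [max_eq_left hx.le]
    rw [max_eq_left hs.le]
    have h := (hasDerivAt_pow (k + 2) s).congr_of_eventuallyEq this
    have e : ((k : ℝ) + 2) * s ^ (k + 1) = ((k + 2 : ℕ) : ℝ) * s ^ (k + 2 - 1) := by
      push_cast; rfl
    rw [e]; exact h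

lemma contDiff_posPart_cube : ContDiff ℝ 2 (fun s : ℝ => max s 0 ^ 3) := by
  have h1 : deriv (fun s : ℝ => max s 0 ^ 3) = fun s => 3 * max s 0 ^ 2 := by
    ext s
    rw [(hasDerivAt_posPart_pow 1 s).deriv]; norm_num
  have h2 : deriv (fun s : ℝ => 3 * max s 0 ^ 2) = fun s => 6 * max s 0 := by
    ext s
    rw [((hasDerivAt_posPart_pow 0 s).const_mul 3).deriv]; norm_num; ring
  have d1 : Differentiable ℝ (fun s : ℝ => max s 0 ^ 3) := fun s =>
    (hasDerivAt_posPart_pow 1 s).differentiableAt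
  have d2 : Differentiable ℝ (fun s : ℝ => 3 * max s 0 ^ 2) := fun s =>
    ((hasDerivAt_posPart_pow 0 s).const_mul 3).differentiableAt
  rw [show (2 : WithTop ℕ∞) = 1 + 1 by norm_num, contDiff_succ_iff_deriv]
  refine ⟨d1, by simp, ?_⟩
  rw [h1, contDiff_one_iff_deriv]
  refine ⟨d2, ?_⟩
  rw [h2]
  fun_prop

/-- Comparison of `u` from above with strict smooth subsolutions on compact pieces of `D`: the
inequality `P⁻(D²u) - u_t ≤ κ` is only tested where the gradient is at most `G`. -/
def SuperC {n : ℕ} (lam Lam G κ : ℝ) (D : Set (Sp n × ℝ)) (u : Sp n × ℝ → ℝ) : Prop :=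
  ∀ ψ g B b, TestData ψ g B b → ∀ (K O : Set (Sp n × ℝ)) (T : ℝ), IsCompact K → IsOpen O →
    O ⊆ K → (∀ z ∈ K, z.2 ≤ T → z ∈ D) →
    (∀ z ∈ O, z.2 ≤ T → ‖g z‖ ≤ G ∧ ∃ α ≥ 0, (∀ v, -α * ‖v‖ ^ 2 ≤ B z v v) ∧
      κ < lam * btrace (B z) - (Lam - lam) * n * α - b z) →
    (∀ z ∈ K, z ∉ O → z.2 ≤ T → ψ z ≤ u z) → ∀ z ∈ K, z.2 ≤ T → ψ z ≤ u z

/-- The pointwise condition satisfied by test functions touching from below in the interior. -/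
def TouchC {n : ℕ} (lam Lam G κ : ℝ) (D : Set (Sp n × ℝ)) (u : Sp n × ℝ → ℝ) : Prop :=
  ∀ ψ g B b, TestData ψ g B b → ∀ z ∈ interior D, ψ z = u z → (∀ᶠ w in nhds z, ψ w ≤ u w) →
    ‖g z‖ ≤ G → ∀ α ≥ 0, (∀ v, -α * ‖v‖ ^ 2 ≤ B z v v) →
    lam * btrace (B z) - (Lam - lam) * n * α - b z ≤ κ

lemma TouchC.superC {n : ℕ} {lam Lam G κ : ℝ} {D : Set (Sp n × ℝ)} {u : Sp n × ℝ → ℝ}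
    (H : TouchC lam Lam G κ D u) (hu : ContinuousOn u D) : SuperC lam Lam G κ D u := by
  intro ψ g B b hψ K O T hK hO hOK hKD hstrict hbd
  by_contra hcon
  push Not at hcon
  obtain ⟨z₀, hz₀K, hz₀T, hz₀⟩ := hcon
  have hz₀O : z₀ ∈ O := by
    by_contra h
    exact absurd (hbd z₀ hz₀K h hz₀T) (not_le.2 hz₀)
  have hψc : Continuous ψ := hψ.smooth.continuous
  -- move strictly below the final time
  obtain ⟨z₁, hz₁O, hz₁T, hz₁⟩ : ∃ z ∈ O, z.2 < T ∧ u z < ψ z := by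
    have hc : ContinuousWithinAt (fun z => ψ z - u z) (O ∩ {z | z.2 ≤ T}) z₀ :=
      (hψc.continuousWithinAt).sub
        ((hu z₀ (hKD z₀ hz₀K hz₀T)).mono fun z hz => hKD z (hOK hz.1) hz.2)
    have h1 : ∀ᶠ z in nhdsWithin z₀ (O ∩ {z | z.2 ≤ T}), 0 < ψ z - u z :=
      hc.eventually (lt_mem_nhds (by linarith))
    have h2 : Tendsto (fun e : ℝ => ((z₀.1, z₀.2 - e) : Sp n × ℝ)) (nhdsWithin 0 (Ioi 0))
        (nhdsWithin z₀ (O ∩ {z | z.2 ≤ T})) := by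
      have hc2 : Tendsto (fun e : ℝ => ((z₀.1, z₀.2 - e) : Sp n × ℝ)) (nhds 0) (nhds z₀) := by
        have : Continuous (fun e : ℝ => ((z₀.1, z₀.2 - e) : Sp n × ℝ)) := by fun_prop
        exact this.tendsto' _ _ (by simp)
      refine tendsto_nhdsWithin_iff.2 ⟨hc2.mono_left nhdsWithin_le_nhds, ?_⟩
      filter_upwards [nhdsWithin_le_nhds (hc2.eventually (hO.mem_nhds hz₀O)),
        self_mem_nhdsWithin] with e he he'
      refine ⟨he, ?_⟩
      simp only [mem_Ioi, mem_ofPred_eq] at he' ⊢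
      linarith
    have h3 := (h2.eventually h1).and ((h2.eventually self_mem_nhdsWithin).and
      (self_mem_nhdsWithin (s := Ioi (0 : ℝ))))
    obtain ⟨e, he1, he2, he3⟩ := h3.exists
    refine ⟨_, he2.1, ?_, by linarith⟩
    have he3' : 0 < e := he3
    change z₀.2 - e < T
    linarith
  set s := z₁.2 with hs
  set K' := K ∩ {z : Sp n × ℝ | z.2 ≤ T} with hK'
  have hK'c : IsCompact K' := hK.inter_right (isClosed_le continuous_snd continuous_const)
  have huK' : ContinuousOn u K' := hu.mono fun z hz => hKD z hz.1 hz.2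
  obtain ⟨m, hm⟩ := hK'c.bddBelow_image (f := fun z => u z - ψ z) (huK'.sub hψc.continuousOn)
  have hm' : ∀ z ∈ K', m ≤ u z - ψ z := fun z hz => hm (mem_image_of_mem _ hz)
  have hsT : 0 < T - s := by linarith
  set A : ℝ := (|m| + 1) / (T - s) ^ 3 with hA
  have hA0 : 0 ≤ A := by positivity
  have htime : ∀ t : ℝ, HasDerivAt (fun t : ℝ => max (t - s) 0 ^ 3) (3 * max (t - s) 0 ^ 2) t := by
    intro t
    have := (hasDerivAt_posPart_pow 1 (t - s)).comp t ((hasDerivAt_id t).sub_const s)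
    norm_num at this
    exact this
  have hcube : ContDiff ℝ 2 (fun t : ℝ => max (t - s) 0 ^ 3) :=
    contDiff_posPart_cube.comp (contDiff_id.sub contDiff_const)
  have hψ' := hψ.add_time (contDiff_const.mul hcube (f := fun _ => -A))
    (fun t => (htime t).const_mul (-A))
  set ψ' : Sp n × ℝ → ℝ := fun z => ψ z + -A * max (z.2 - s) 0 ^ 3 with hψ'def
  have hz₁K' : z₁ ∈ K' := ⟨hOK hz₁O, hz₁T.le⟩
  obtain ⟨z, hzK', hzmin⟩ := hK'c.exists_isMinOn ⟨z₁, hz₁K'⟩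
    (huK'.sub hψ'.smooth.continuous.continuousOn)
  have hmin : ∀ w ∈ K', u z - ψ' z ≤ u w - ψ' w := fun w hw => hzmin hw
  have hneg : u z - ψ' z < 0 := by
    refine (hmin z₁ hz₁K').trans_lt ?_
    simp only [hψ'def, ← hs]
    simp; linarith
  have hle : ∀ w, ψ' w ≤ ψ w := fun w => by
    have : 0 ≤ max (w.2 - s) 0 ^ 3 := by positivity
    simp only [hψ'def]
    nlinarith
  have hzO : z ∈ O := by
    by_contra h
    have := hbd z hzK'.1 h hzK'.2
    linarith [hle z]
  have hzT : z.2 < T := by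
    refine lt_of_le_of_ne hzK'.2 fun h => ?_
    have h1 := hm' z hzK'
    have h2 : ψ' z = ψ z - (|m| + 1) := by
      simp only [hψ'def, h, hA, max_eq_left hsT.le]
      field_simp
      ring
    rw [h2] at hneg
    linarith [neg_abs_le m]
  have hnb : ∀ᶠ w in nhds z, w ∈ O ∧ w.2 < T :=
    by
    filter_upwards [hO.mem_nhds hzO,
      continuous_snd.continuousAt.eventually (gt_mem_nhds hzT)] with w h1 h2 using ⟨h1, h2⟩
  have hint : z ∈ interior D := by
    rw [mem_interior_iff_mem_nhds]
    filter_upwards [hnb] with w hw using hKD w (hOK hw.1) hw.2.le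
  obtain ⟨hg, α, hα, hB, hκ⟩ := hstrict z hzO hzK'.2
  have hψ'' := hψ'.add_time (f := fun _ => u z - ψ' z) (f' := fun _ => 0)
    contDiff_const (fun t => hasDerivAt_const t _)
  have key := H _ _ _ _ hψ'' z hint (by simp) ?_ hg α hα hB
  · have h3 : 0 ≤ max (z.2 - s) 0 ^ 2 := by positivity
    simp only [add_zero] at key
    nlinarith
  · filter_upwards [hnb] with w hw
    have := hmin w ⟨hOK hw.1, hw.2.le⟩
    simp only [hψ'def] at this ⊢
    linarith

lemma SuperC.mono {n : ℕ} {lam Lam G κ G' κ' : ℝ} {D D' : Set (Sp n × ℝ)} {u : Sp n × ℝ → ℝ}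
    (h : SuperC lam Lam G κ D u) (hG : G' ≤ G) (hκ : κ ≤ κ') (hD : D' ⊆ D) :
    SuperC lam Lam G' κ' D' u := by
  intro ψ g B b hψ K O T hK hO hOK hKD hstrict hbd
  refine h ψ g B b hψ K O T hK hO hOK (fun z hz hT => hD (hKD z hz hT)) (fun z hz hT => ?_) hbd
  obtain ⟨h1, α, hα, h2, h3⟩ := hstrict z hz hT
  exact ⟨h1.trans hG, α, hα, h2, hκ.trans_lt h3⟩

/-- A smooth cut-off which equals one near `z` and vanishes outside a neighbourhood. -/
lemma exists_cutoff {n : ℕ} {z : Sp n × ℝ} {N : Set (Sp n × ℝ)} (hN : N ∈ nhds z) :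
    ∃ χ : Sp n × ℝ → ℝ, ContDiff ℝ 2 χ ∧ χ =ᶠ[nhds z] 1 ∧ (∀ w, 0 ≤ χ w) ∧ (∀ w, χ w ≤ 1) ∧
      ∀ w ∉ N, χ w = 0 := by
  obtain ⟨ε, hε, hN⟩ := Metric.mem_nhds_iff.1 hN
  let f : ContDiffBump z := ⟨ε / 2, ε, by positivity, by linarith⟩
  refine ⟨f, f.contDiff, f.eventuallyEq_one, fun w => f.nonneg, fun w => f.le_one, fun w hw => ?_⟩
  refine f.zero_of_le_dist ?_
  by_contra h
  exact hw (hN (Metric.mem_ball.2 (not_le.1 h)))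

lemma IsViscositySupersol.touchC {n : ℕ} {lam Lam : ℝ} {φ : ℝ → ℝ} {Q : Set (Sp n × ℝ)}
    {u : Sp n × ℝ → ℝ} (h : IsViscositySupersol lam Lam φ Q u) (hle : lam ≤ Lam)
    (hφ : MonotoneOn φ (Ici 0)) (hu : ∀ z ∈ Q, 0 ≤ u z) (G : ℝ) :
    TouchC lam Lam G (φ G) Q u := by
  intro ψ g B b hψ z hz hzu hloc hg α hα hB
  obtain ⟨χ, hχ, hχ1, hχ0, hχle, hχN⟩ := exists_cutoff
    (inter_mem (mem_interior_iff_mem_nhds.1 hz) hloc)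
  have hev : (fun w => χ w * ψ w) =ᶠ[nhds z] ψ := by
    filter_upwards [hχ1] with w hw
    simp [hw]
  have key := h z (interior_subset hz) (fun w => χ w * ψ w) (hχ.mul hψ.smooth).contDiffOn ?_ ?_
  · rw [hψ.spatialHessian_eq hev, hψ.timeDeriv_eq hev, hψ.norm_spatialGrad_eq hev] at key
    have h1 := pucciMinus_ge (hψ.isHermitian z) hle hα
      (fun v => by rw [← bilin_eq_dotProduct]; exact hB v)
    have h2 : (Matrix.of fun i j => B z (bv j) (bv i)).trace = btrace (B z) := rfl
    rw [h2] at h1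
    have h3 : φ ‖g z‖ ≤ φ G := hφ (norm_nonneg _) ((norm_nonneg _).trans hg) hg
    linarith
  · intro w hw
    by_cases hwN : w ∈ Q ∩ {w | ψ w ≤ u w}
    · rcases le_total 0 (ψ w) with h0 | h0
      · exact (mul_le_of_le_one_left h0 (hχle w)).trans hwN.2
      · exact (mul_nonpos_of_nonneg_of_nonpos (hχ0 w) h0).trans (hu w hw)
    · simp only [hχN w hwN, zero_mul]
      exact hu w hw
  · rw [hev.eq_of_nhds, hzu]

lemma IsViscositySubsol.touchC {n : ℕ} {lam Lam : ℝ} {φ : ℝ → ℝ} {Q : Set (Sp n × ℝ)}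
    {u F : Sp n × ℝ → ℝ} (h : IsViscositySubsol lam Lam φ Q u) (hle : lam ≤ Lam)
    (hφ : MonotoneOn φ (Ici 0)) (hF : ContDiffOn ℝ 2 F Q) (hu : ∀ z ∈ Q, u z ≤ F z) (L G : ℝ) :
    TouchC lam Lam G (φ G) Q (fun z => L - u z) := by
  intro ψ g B b hψ z hz hzu hloc hg α hα hB
  obtain ⟨χ, hχ, hχ1, hχ0, hχle, hχN⟩ := exists_cutoff
    (inter_mem (mem_interior_iff_mem_nhds.1 hz) hloc)
  have hψ2 := hψ.const_sub L
  have hev : (fun w => χ w * (L - ψ w) + (1 - χ w) * F w) =ᶠ[nhds z]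
      fun w => L - ψ w := by
    filter_upwards [hχ1] with w hw
    simp [hw]
  have key := h z (interior_subset hz) (fun w => χ w * (L - ψ w) + (1 - χ w) * F w)
    ((hχ.mul hψ2.smooth).contDiffOn.add ((contDiff_const.sub hχ).contDiffOn.mul hF)) ?_ ?_
  · rw [hψ2.spatialHessian_eq hev, hψ2.timeDeriv_eq hev, hψ2.norm_spatialGrad_eq hev] at key
    have h1 := pucciPlus_le (hψ2.isHermitian z) hle hα
      (fun v => by
        rw [← bilin_eq_dotProduct]
        have := hB v
        simp only [neg_apply]
        linarith)
    have h2 : (Matrix.of fun i j => (-B z) (bv j) (bv i)).trace =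
        -btrace (B z) := by
      simp [Matrix.trace, btrace]
    rw [h2] at h1
    have h3 : φ ‖g z‖ ≤ φ G := hφ (norm_nonneg _) ((norm_nonneg _).trans hg) hg
    have h4 : ‖-g z‖ = ‖g z‖ := norm_neg _
    rw [h4] at key
    linarith
  · intro w hw
    by_cases hwN : w ∈ Q ∩ {w | ψ w ≤ L - u w}
    · have h1 : u w ≤ L - ψ w := by have := hwN.2; simp only [mem_ofPred_eq] at this; linarith
      nlinarith [hχ0 w, hχle w, hu w hw]
    · simp only [hχN w hwN, zero_mul, sub_zero, one_mul, zero_add]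
      exact hu w hw
  · rw [hev.eq_of_nhds, hzu]; ring

/-- Pull-back of test data under a parabolic rescaling. -/
lemma TestData.rescale {n : ℕ} {ψ : Sp n × ℝ → ℝ} {g B b} (h : TestData ψ g B b) (x₀ : Sp n)
    (t₀ m r : ℝ) :
    TestData (fun z => m * ψ (r • (z.1 - x₀), r ^ 2 * (z.2 - t₀)))
      (fun z => (m * r) • g (r • (z.1 - x₀), r ^ 2 * (z.2 - t₀)))
      (fun z => (m * r ^ 2) • B (r • (z.1 - x₀), r ^ 2 * (z.2 - t₀)))
      (fun z => (m * r ^ 2) * b (r • (z.1 - x₀), r ^ 2 * (z.2 - t₀))) where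
  smooth := by
    have : ContDiff ℝ 2 (fun z : Sp n × ℝ => (r • (z.1 - x₀), r ^ 2 * (z.2 - t₀))) := by fun_prop
    exact contDiff_const.mul (h.smooth.comp this)
  grad z := by
    have h1 := (h.grad (r • (z.1 - x₀), r ^ 2 * (z.2 - t₀))).comp z.1
      (((hasFDerivAt_id z.1).sub_const x₀).const_smul r)
    have h2 := h1.const_mul m
    have e : (m * r) • g (r • (z.1 - x₀), r ^ 2 * (z.2 - t₀)) =
        m • (g (r • (z.1 - x₀), r ^ 2 * (z.2 - t₀))).comp (r • ContinuousLinearMap.id ℝ (Sp n)) := by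
      ext v; simp [mul_assoc]
    rw [e]
    exact h2
  hess z := by
    have h1 := (h.hess (r • (z.1 - x₀), r ^ 2 * (z.2 - t₀))).comp z.1
      (((hasFDerivAt_id z.1).sub_const x₀).const_smul r)
    have h2 := h1.const_smul (m * r)
    have e : (m * r ^ 2) • B (r • (z.1 - x₀), r ^ 2 * (z.2 - t₀)) =
        (m * r) • (B (r • (z.1 - x₀), r ^ 2 * (z.2 - t₀))).comp
          (r • ContinuousLinearMap.id ℝ (Sp n)) := by
      ext v w; simp; ring
    rw [e]
    exact h2
  symm z v w := by simp [h.symm _ v w]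
  time z := by
    have h1 := (h.time (r • (z.1 - x₀), r ^ 2 * (z.2 - t₀))).comp z.2
      (((hasDerivAt_id z.2).sub_const t₀).const_mul (r ^ 2))
    have h2 := h1.const_mul m
    have e : m * r ^ 2 * b (r • (z.1 - x₀), r ^ 2 * (z.2 - t₀)) =
        m * (b (r • (z.1 - x₀), r ^ 2 * (z.2 - t₀)) * (r ^ 2 * 1)) := by ring
    rw [e]
    exact h2

/-- The parabolic rescaling `z ↦ (x₀ + r x, t₀ + r² t)`. -/
noncomputable def pscale {n : ℕ} (x₀ : Sp n) (t₀ r : ℝ) (z : Sp n × ℝ) : Sp n × ℝ :=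
  (x₀ + r • z.1, t₀ + r ^ 2 * z.2)

lemma continuous_pscale {n : ℕ} (x₀ : Sp n) (t₀ r : ℝ) : Continuous (pscale x₀ t₀ r) := by
  unfold pscale; fun_prop

lemma SuperC.rescale {n : ℕ} {lam Lam G κ : ℝ} {D : Set (Sp n × ℝ)} {u : Sp n × ℝ → ℝ}
    (h : SuperC lam Lam G κ D u) (x₀ : Sp n) (t₀ : ℝ) {m r : ℝ} (hm : 0 < m) (hr : 0 < r) :
    SuperC lam Lam (G * r / m) (κ * r ^ 2 / m) (pscale x₀ t₀ r ⁻¹' D)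
      (fun z => u (pscale x₀ t₀ r z) / m) := by
  intro ψ g B b hψ K O T hK hO hOK hKD hstrict hbd
  have hr0 : r ≠ 0 := hr.ne'
  let inv : Sp n × ℝ → Sp n × ℝ := fun z => (r⁻¹ • (z.1 - x₀), r⁻¹ ^ 2 * (z.2 - t₀))
  have hli : ∀ z, inv (pscale x₀ t₀ r z) = z := by
    rintro ⟨x, t⟩
    simp [inv, pscale, smul_smul, hr0]
  have hri : ∀ z, pscale x₀ t₀ r (inv z) = z := by
    rintro ⟨x, t⟩
    simp [inv, pscale, smul_smul, hr0]
  have hinvc : Continuous inv := by fun_prop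
  have hT : ∀ z : Sp n × ℝ, z.2 ≤ t₀ + r ^ 2 * T ↔ (inv z).2 ≤ T := by
    intro z
    simp only [inv]
    rw [inv_pow, inv_mul_le_iff₀ (by positivity)]
    constructor <;> intro h <;> linarith
  have key := h _ _ _ _ (hψ.rescale x₀ t₀ m r⁻¹) (inv ⁻¹' K) (inv ⁻¹' O) (t₀ + r ^ 2 * T)
    ?_ (hO.preimage hinvc) (preimage_mono hOK) ?_ ?_ ?_
  · intro z hz hzT
    have := key (pscale x₀ t₀ r z) (by simpa [hli] using hz) ((hT _).2 (by simpa [hli] using hzT))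
    change m * ψ (inv (pscale x₀ t₀ r z)) ≤ _ at this
    rw [hli] at this
    rw [le_div_iff₀ hm]
    linarith
  · have : inv ⁻¹' K = pscale x₀ t₀ r '' K := by
      ext z
      constructor
      · intro hz
        exact ⟨inv z, hz, hri z⟩
      · rintro ⟨w, hw, rfl⟩
        simpa [hli] using hw
    rw [this]
    exact hK.image (continuous_pscale _ _ _)
  · intro z hz hzT
    have := hKD (inv z) hz ((hT z).1 hzT)
    simpa [hri] using this
  · intro z hz hzT
    obtain ⟨h1, α, hα, h2, h3⟩ := hstrict (inv z) hz ((hT z).1 hzT)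
    refine ⟨?_, m * r⁻¹ ^ 2 * α, by positivity, fun v => ?_, ?_⟩
    · change ‖(m * r⁻¹) • g (inv z)‖ ≤ G
      rw [norm_smul, Real.norm_of_nonneg (by positivity)]
      calc m * r⁻¹ * ‖g (inv z)‖ ≤ m * r⁻¹ * (G * r / m) := by gcongr
        _ = G := by field_simp
    · change _ ≤ ((m * r⁻¹ ^ 2) • B (inv z)) v v
      simp only [smul_apply, smul_eq_mul]
      have := h2 v
      have h4 : 0 ≤ m * r⁻¹ ^ 2 := by positivity
      nlinarith
    · change κ < lam * btrace ((m * r⁻¹ ^ 2) • B (inv z)) - _ - (m * r⁻¹ ^ 2) * b (inv z)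
      have h5 : btrace ((m * r⁻¹ ^ 2) • B (inv z)) = (m * r⁻¹ ^ 2) * btrace (B (inv z)) := by
        simp [btrace, Finset.mul_sum]
      rw [h5]
      have h4 : 0 < m * r⁻¹ ^ 2 := by positivity
      have h6 : κ = m * r⁻¹ ^ 2 * (κ * r ^ 2 / m) := by field_simp
      have := mul_lt_mul_of_pos_left h3 h4
      rw [← h6] at this
      linarith
  · intro z hz hzO hzT
    have := hbd (inv z) hz hzO ((hT z).1 hzT)
    change ψ (inv z) ≤ u (pscale x₀ t₀ r (inv z)) / m at this
    rw [hri, le_div_iff₀ hm] at this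
    change m * ψ (inv z) ≤ u z
    linarith

/-- Every family of bounds indexed by the naturals is dominated by a smooth function. -/
lemma exists_smooth_dominating (M : ℕ → ℝ) (hM : Monotone M) :
    ∃ f : ℝ → ℝ, ContDiff ℝ 2 f ∧ ∀ y, M ⌈y⌉₊ ≤ f y := by
  obtain ⟨f, hf⟩ := exists_contMDiffMap_forall_mem_convex_of_local_const
    (modelWithCornersSelf ℝ ℝ) (M := ℝ) (t := fun y => Ici (M ⌈y⌉₊)) (n := 2)
    (fun y => convex_Ici _) (fun x => ⟨M ⌈x + 1⌉₊, by
      filter_upwards [gt_mem_nhds (show x < x + 1 by linarith)] with y hy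
      exact hM (Nat.ceil_mono hy.le)⟩)
  exact ⟨f, f.contMDiff.contDiff, hf⟩

lemma isCompact_box {n : ℕ} (a b c : ℝ) :
    IsCompact {z : Sp n × ℝ | (∀ i, |z.1 i| ≤ a) ∧ b ≤ z.2 ∧ z.2 ≤ c} := by
  have h : IsCompact (((WithLp.toLp 2 : (Fin n → ℝ) → Sp n) ''
      (Set.pi univ fun _ => Icc (-a) a)) ×ˢ Icc b c) :=
    ((isCompact_univ_pi fun i => isCompact_Icc).image (PiLp.continuous_toLp 2 _)).prod
      isCompact_Icc
  convert h using 1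
  ext ⟨x, t⟩
  simp only [mem_ofPred_eq, mem_prod, mem_image, mem_Icc]
  refine and_congr ⟨fun hx => ⟨x.ofLp, fun i _ => abs_le.1 (hx i), rfl⟩, ?_⟩ Iff.rfl
  rintro ⟨y, hy, rfl⟩ i
  exact abs_le.2 (hy i (mem_univ i))

lemma exists_smooth_majorant {n : ℕ} {u : Sp n × ℝ → ℝ}
    (hu : ContinuousOn u (pcube (0 : Sp n) 0 2)) :
    ∃ F : Sp n × ℝ → ℝ, ContDiffOn ℝ 2 F (pcube (0 : Sp n) 0 2) ∧
      ∀ z ∈ pcube (0 : Sp n) 0 2, u z ≤ F z := by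
  set Q := pcube (0 : Sp n) 0 2 with hQ
  have hmem : ∀ z, z ∈ Q ↔ (∀ i, |z.1 i| < 2) ∧ -4 < z.2 ∧ z.2 ≤ 0 := by
    intro z
    simp only [hQ, pcube, mem_ofPred_eq, mem_Ioc]
    norm_num
  let s : Sp n × ℝ → ℝ := fun z => ∑ i, (4 - z.1 i ^ 2)⁻¹ + (z.2 + 4)⁻¹
  have hpos : ∀ z ∈ Q, (∀ i, 0 < 4 - z.1 i ^ 2) ∧ 0 < z.2 + 4 := by
    intro z hz
    rw [hmem] at hz
    refine ⟨fun i => ?_, by linarith [hz.2.1]⟩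
    have := hz.1 i
    rw [abs_lt] at this
    nlinarith
  have hs : ContDiffOn ℝ 2 s Q := by
    refine ContDiffOn.add (ContDiffOn.sum fun i _ => ContDiffOn.inv ?_ ?_)
      (ContDiffOn.inv ?_ ?_)
    · have : ContDiff ℝ 2 (fun z : Sp n × ℝ => 4 - z.1 i ^ 2) := by fun_prop
      exact this.contDiffOn
    · exact fun z hz => ((hpos z hz).1 i).ne'
    · have : ContDiff ℝ 2 (fun z : Sp n × ℝ => z.2 + 4) := by fun_prop
      exact this.contDiffOn
    · exact fun z hz => (hpos z hz).2.ne'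
  have hbound : ∀ k : ℕ, ∃ m : ℝ, ∀ z ∈ Q, s z ≤ k → u z ≤ m := by
    intro k
    let K : Set (Sp n × ℝ) := {z | (∀ i, |z.1 i| ≤ Real.sqrt (4 - ((k : ℝ) + 1)⁻¹)) ∧
      -4 + ((k : ℝ) + 1)⁻¹ ≤ z.2 ∧ z.2 ≤ 0}
    have hK : IsCompact K := isCompact_box _ _ _
    have hk : 0 < ((k : ℝ) + 1)⁻¹ := by positivity
    have hKQ : K ⊆ Q := by
      intro z hz
      rw [hmem]
      refine ⟨fun i => (hz.1 i).trans_lt ?_, by linarith [hz.2.1], hz.2.2⟩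
      rw [Real.sqrt_lt' (by norm_num)]
      linarith
    obtain ⟨m, hm⟩ := hK.bddAbove_image (hu.mono hKQ)
    refine ⟨m, fun z hz hzk => hm (mem_image_of_mem _ ?_)⟩
    have hp := hpos z hz
    have h1 : ∀ i, (4 - z.1 i ^ 2)⁻¹ ≤ s z := fun i => by
      have := Finset.single_le_sum (f := fun i => (4 - z.1 i ^ 2)⁻¹)
        (fun j _ => (inv_pos.2 (hp.1 j)).le) (Finset.mem_univ i)
      have h2 := inv_pos.2 hp.2
      simp only [s]
      linarith
    have h2 : (z.2 + 4)⁻¹ ≤ s z := by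
      have := Finset.sum_nonneg (s := Finset.univ) (f := fun i => (4 - z.1 i ^ 2)⁻¹)
        (fun j _ => (inv_pos.2 (hp.1 j)).le)
      simp only [s]
      linarith
    have h3 : ∀ a : ℝ, 0 < a → a⁻¹ ≤ s z → ((k : ℝ) + 1)⁻¹ ≤ a := fun a ha h => by
      rw [inv_le_comm₀ (by positivity) ha]
      linarith
    refine ⟨fun i => Real.le_sqrt_of_sq_le ?_, ?_, ((hmem z).1 hz).2.2⟩
    · have := h3 _ (hp.1 i) (h1 i)
      rw [sq_abs]; linarith
    · have := h3 _ hp.2 h2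
      linarith
  choose m hm using hbound
  obtain ⟨f, hf, hfm⟩ := exists_smooth_dominating (partialSups m) (partialSups m).monotone
  refine ⟨f ∘ s, hf.comp_contDiffOn hs, fun z hz => ?_⟩
  exact (hm _ z hz (Nat.le_ceil _)).trans ((le_partialSups m _).trans (hfm (s z)))

section Traces

variable {n : ℕ} (B B' : Sp n →L[ℝ] Sp n →L[ℝ] ℝ)

lemma btrace_add : btrace (B + B') = btrace B + btrace B' := by
  simp only [btrace, add_apply, Finset.sum_add_distrib]

lemma btrace_smul (c : ℝ) : btrace (c • B) = c * btrace B := by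
  simp only [btrace, smul_apply, smul_eq_mul, Finset.mul_sum]

lemma btrace_ip : btrace (ip : Sp n →L[ℝ] Sp n →L[ℝ] ℝ) = n := by
  have : ∀ i : Fin n, (ip : Sp n →L[ℝ] Sp n →L[ℝ] ℝ) (bv i) (bv i) = 1 := fun i => by
    rw [ip_apply]; simp
  simp only [btrace, this]
  simp

/-- The rank one form `v, w ↦ ⟪e, v⟫ ⟪e, w⟫`. -/
noncomputable def rankOne (e : Sp n) : Sp n →L[ℝ] Sp n →L[ℝ] ℝ :=
  (ip e).smulRight (ip e)

lemma rankOne_apply (e v w : Sp n) : rankOne e v w = inner ℝ e v * inner ℝ e w := rfl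

lemma btrace_rankOne (e : Sp n) : btrace (rankOne e) = ‖e‖ ^ 2 := by
  have : ∀ i : Fin n, rankOne e (bv i) (bv i) = e i ^ 2 := fun i => by
    rw [rankOne_apply]; simp [EuclideanSpace.inner_single_right, sq]
  simp only [btrace, this, EuclideanSpace.norm_sq_eq, Real.norm_eq_abs, sq_abs]

end Traces

/-- The square of an affine function of the space variable, as test data. -/
lemma TestData.affineSq {n : ℕ} (e x₀ : Sp n) (c : ℝ) :
    TestData (fun z => (inner ℝ e (z.1 - x₀) + c) ^ 2)
      (fun z => (2 * (inner ℝ e (z.1 - x₀) + c)) • ip e)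
      (fun _ => (2 : ℝ) • rankOne e) (fun _ => 0) where
  smooth := by
    have : ContDiff ℝ 2 (fun z : Sp n × ℝ => inner ℝ e (z.1 - x₀) + c) :=
      (contDiff_const.inner ℝ (contDiff_fst.sub contDiff_const)).add contDiff_const
    exact this.pow 2
  grad z := by
    have h1 : HasFDerivAt (fun y : Sp n => inner ℝ e (y - x₀) + c) (ip e) z.1 := by
      have := ((ip e).hasFDerivAt (x := z.1 - x₀)).comp z.1
        ((hasFDerivAt_id z.1).sub_const x₀)
      exact this.add_const c
    have h2 := h1.pow 2
    have e2 : (2 * (inner ℝ e (z.1 - x₀) + c)) • ip e =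
        (2 • (inner ℝ e (z.1 - x₀) + c) ^ (2 - 1)) • ip e := by
      rw [two_smul, two_mul, pow_one]
    rw [e2]
    exact h2
  hess z := by
    have h1 : HasFDerivAt (fun y : Sp n => inner ℝ e (y - x₀) + c) (ip e) z.1 := by
      have := ((ip e).hasFDerivAt (x := z.1 - x₀)).comp z.1
        ((hasFDerivAt_id z.1).sub_const x₀)
      exact this.add_const c
    have h2 := (h1.smul_const (ip e)).const_smul (2 : ℝ)
    have e2 : (fun y : Sp n => (2 * (inner ℝ e ((y, z.2).1 - x₀) + c)) • ip e) =
        fun y : Sp n => (2 : ℝ) • ((inner ℝ e (y - x₀) + c) • ip e) := by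
      ext y w; simp [mul_assoc]
    rw [e2]
    exact h2
  symm z v w := by
    change (2 : ℝ) * (inner ℝ e v * inner ℝ e w) = 2 * (inner ℝ e w * inner ℝ e v)
    ring
  time z := hasDerivAt_const z.2 ((inner ℝ e (z.1 - x₀) + c) ^ 2)

/-- The quadratic functions used for sliding, as test data. -/
lemma TestData.quadratic {n : ℕ} (a₁ a₂ a₃ c h b : ℝ) (y x₁ x₂ e : Sp n) :
    TestData (fun z => a₁ * ‖z.1 - y‖ ^ 2 + a₂ * ‖z.1 - x₁‖ ^ 2 +
        a₃ * (inner ℝ e (z.1 - x₂) + c) ^ 2 + (h + b * z.2))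
      (fun z => a₁ • ((2 : ℝ) • ip (z.1 - y)) + a₂ • ((2 : ℝ) • ip (z.1 - x₁)) +
        a₃ • ((2 * (inner ℝ e (z.1 - x₂) + c)) • ip e))
      (fun _ => a₁ • ((2 : ℝ) • (ip : Sp n →L[ℝ] Sp n →L[ℝ] ℝ)) + a₂ • ((2 : ℝ) • ip) +
        a₃ • ((2 : ℝ) • rankOne e))
      (fun _ => a₁ * 0 + a₂ * 0 + a₃ * 0 + b) :=
  ((((TestData.normSq y).const_mul a₁).add ((TestData.normSq x₁).const_mul a₂)).add
    ((TestData.affineSq e x₂ c).const_mul a₃)).add_time (f := fun t => h + b * t)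
    (f' := fun _ => b) (by fun_prop)
    (fun t => by simpa using ((hasDerivAt_id t).const_mul b).const_add h)

/-- Comparison with quadratic functions. -/
lemma SuperC.quadratic {n : ℕ} {lam Lam G κ : ℝ} {D : Set (Sp n × ℝ)} {u : Sp n × ℝ → ℝ}
    (H : SuperC lam Lam G κ D u) {a₁ a₂ a₃ c h b : ℝ} {y x₁ x₂ e : Sp n}
    (ha₁ : 0 ≤ a₁) (ha₂ : 0 ≤ a₂) (ha₃ : 0 ≤ a₃) (he : ‖e‖ ≤ 1) (K : Set (Sp n))
    (O : Set (Sp n)) (hK : IsCompact K) (hO : IsOpen O) (hOK : O ⊆ K) (T₀ T : ℝ)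
    (hD : ∀ x ∈ K, ∀ t, T₀ ≤ t → t ≤ T → (x, t) ∈ D) {A₁ A₂ A₃ : ℝ}
    (hA₁ : ∀ x ∈ O, ‖x - y‖ ≤ A₁) (hA₂ : ∀ x ∈ O, ‖x - x₁‖ ≤ A₂)
    (hA₃ : ∀ x ∈ O, |inner ℝ e (x - x₂) + c| ≤ A₃)
    (hG : 2 * a₁ * A₁ + 2 * a₂ * A₂ + 2 * a₃ * A₃ ≤ G)
    (hκ : κ < lam * (2 * a₃ * ‖e‖ ^ 2) - Lam * n * (2 * a₁ + 2 * a₂) - b)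
    (hbot : ∀ x ∈ K, T₀ ≤ T → h + b * T₀ - a₁ * ‖x - y‖ ^ 2 - a₂ * ‖x - x₁‖ ^ 2 +
      a₃ * (inner ℝ e (x - x₂) + c) ^ 2 ≤ u (x, T₀))
    (hlat : ∀ x ∈ K, x ∉ O → ∀ t, T₀ ≤ t → t ≤ T → h + b * t - a₁ * ‖x - y‖ ^ 2 -
      a₂ * ‖x - x₁‖ ^ 2 + a₃ * (inner ℝ e (x - x₂) + c) ^ 2 ≤ u (x, t)) :
    ∀ x ∈ K, ∀ t, T₀ ≤ t → t ≤ T → h + b * t - a₁ * ‖x - y‖ ^ 2 -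
      a₂ * ‖x - x₁‖ ^ 2 + a₃ * (inner ℝ e (x - x₂) + c) ^ 2 ≤ u (x, t) := by
  have key := H _ _ _ _ (TestData.quadratic (-a₁) (-a₂) a₃ c h b y x₁ x₂ e)
    (K ×ˢ Icc T₀ (T + 1)) (O ×ˢ Ioo T₀ (T + 1)) T (hK.prod isCompact_Icc) (hO.prod isOpen_Ioo)
    (prod_mono hOK Ioo_subset_Icc_self) (fun z hz hzT => hD z.1 hz.1 z.2 hz.2.1 hzT) ?_ ?_
  · intro x hx t ht htT
    have := key (x, t) ⟨hx, ht, by linarith⟩ htT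
    simp only at this
    linarith
  · rintro ⟨x, t⟩ hz htT
    refine ⟨?_, 2 * a₁ + 2 * a₂, by positivity, fun v => ?_, ?_⟩
    · refine le_trans ?_ hG
      refine (norm_add_le _ _).trans (add_le_add ((norm_add_le _ _).trans (add_le_add ?_ ?_)) ?_)
      · rw [norm_smul, norm_smul, norm_ip, norm_neg, Real.norm_of_nonneg ha₁]
        have := mul_le_mul_of_nonneg_left (hA₁ x hz.1) ha₁
        simp only [Real.norm_ofNat]
        linarith
      · rw [norm_smul, norm_smul, norm_ip, norm_neg, Real.norm_of_nonneg ha₂]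
        have := mul_le_mul_of_nonneg_left (hA₂ x hz.1) ha₂
        simp only [Real.norm_ofNat]
        linarith
      · rw [norm_smul, norm_smul, norm_ip, Real.norm_of_nonneg ha₃, norm_mul, Real.norm_eq_abs (_ + c)]
        have h1 := hA₃ x hz.1
        simp only [Real.norm_ofNat]
        have h2 : |inner ℝ e (x - x₂) + c| * ‖e‖ ≤ A₃ := by
          refine (mul_le_of_le_one_right (abs_nonneg _) he).trans h1
        have := mul_le_mul_of_nonneg_left h2 ha₃
        linarith
    · change _ ≤ -a₁ * (2 * inner ℝ v v) + -a₂ * (2 * inner ℝ v v) +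
        a₃ * (2 * (inner ℝ e v * inner ℝ e v))
      rw [real_inner_self_eq_norm_sq]
      have := mul_nonneg ha₃ (mul_self_nonneg (inner ℝ e v))
      linarith
    · simp only [btrace_add, btrace_smul, btrace_ip, btrace_rankOne]
      nlinarith
  · rintro ⟨x, t⟩ ⟨hx, ht⟩ hzO htT
    simp only at hx ht htT
    simp only
    by_cases hxO : x ∈ O
    · have : t = T₀ := by
        by_contra hne
        exact hzO ⟨hxO, lt_of_le_of_ne ht.1 (Ne.symm hne), by simp only; linarith⟩
      subst this
      have := hbot x hx htT
      linarith
    · have := hlat x hx hxO t ht.1 htT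
      linarith

/-- The paraboloids used for sliding from below. -/
noncomputable def par {n : ℕ} (y : Sp n) (h : ℝ) (z : Sp n × ℝ) : ℝ :=
  h - 32 * ‖z.1 - y‖ ^ 2 + 8 * z.2

/-- The cylinder on which paraboloids are slid. -/
def unitCyl (n : ℕ) : Set (Sp n × ℝ) := Metric.closedBall 0 1 ×ˢ Icc (-1) 0

/-- The paraboloid with parameters `y, h` touches `v` from below, for the first time, at `z`. -/
structure Touch {n : ℕ} (v : Sp n × ℝ → ℝ) (y : Sp n) (h : ℝ) (z : Sp n × ℝ) : Prop where
  norm_y : ‖y‖ ≤ 1 / 8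
  h_le : h ≤ 3
  norm_z : ‖z.1‖ ≤ 1 / 2
  time_ge : -(1 / 2) ≤ z.2
  time_le : z.2 ≤ 0
  eq : v z = par y h z
  le : ∀ w ∈ unitCyl n, w.2 ≤ z.2 → par y h w ≤ v w

lemma par_le {n : ℕ} {y : Sp n} {h : ℝ} {z : Sp n × ℝ} (hh : h ≤ 3) (hz : z.2 ≤ 0) :
    par y h z ≤ 3 := by
  unfold par
  nlinarith [sq_nonneg ‖z.1 - y‖]

lemma par_sub_diff {n : ℕ} (y₀ y₁ x x₀ : Sp n) :
    (-(32 * ‖x - y₁‖ ^ 2) + 32 * ‖x - y₀‖ ^ 2) - (-(32 * ‖x₀ - y₁‖ ^ 2) + 32 * ‖x₀ - y₀‖ ^ 2) =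
      64 * inner ℝ (y₁ - y₀) (x - x₀) := by
  simp only [norm_sub_sq_real, inner_sub_left, inner_sub_right, real_inner_comm y₁ x,
    real_inner_comm y₀ x, real_inner_comm y₁ x₀, real_inner_comm y₀ x₀]
  ring

lemma Touch.two_point_upper {n : ℕ} {lam Lam G : ℝ} (hlam : 0 < lam) (hLam : lam ≤ Lam)
    (hG : 96 ≤ G) {v : Sp n × ℝ → ℝ} (hv : ∀ z ∈ unitCyl n, 0 ≤ v z)
    (H : SuperC lam Lam G 1 (unitCyl n) v) {y₀ y₁ x₀ x₁ : Sp n} {h₀ h₁ t₀ t₁ : ℝ}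
    (T₀ : Touch v y₀ h₀ (x₀, t₀)) (T₁ : Touch v y₁ h₁ (x₁, t₁)) (ht : t₀ ≤ t₁) :
    -((10 + 192 * Lam * n) * (t₁ - t₀)) ≤
      (h₁ - 32 * ‖x₁ - y₁‖ ^ 2) - (h₀ - 32 * ‖x₁ - y₀‖ ^ 2) := by
  have hn : (0 : ℝ) ≤ n := Nat.cast_nonneg n
  have hLam0 : 0 < Lam := hlam.trans_le hLam
  set C := 10 + 192 * Lam * n with hC
  have hC0 : 0 ≤ C := by positivity
  have nx := T₁.norm_z
  have ny := T₀.norm_y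
  have tge := T₀.time_ge
  have tle := T₁.time_le
  simp only at nx tge tle
  have hball : ∀ x ∈ Metric.closedBall x₁ (1 / 4), ‖x‖ ≤ 3 / 4 := fun x hx => by
    rw [mem_closedBall_iff_norm] at hx
    have := norm_add_le (x - x₁) x₁
    rw [sub_add_cancel] at this
    linarith
  have hmem : ∀ x ∈ Metric.closedBall x₁ (1 / 4), ∀ t, t₀ ≤ t → t ≤ t₁ → (x, t) ∈ unitCyl n := by
    intro x hx t h1 h2
    refine ⟨mem_closedBall_zero_iff.2 ((hball x hx).trans (by norm_num)), ?_, ?_⟩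
    · simp only; linarith
    · simp only; linarith
  have key := H.quadratic (a₁ := 32) (a₂ := 64) (a₃ := 0) (c := 0) (h := h₀ + C * t₀)
    (b := 8 - C) (y := y₀) (x₁ := x₁) (x₂ := x₁) (e := 0) (by norm_num) (by norm_num) le_rfl
    (by simp) (Metric.closedBall x₁ (1 / 4)) (Metric.ball x₁ (1 / 4))
    (isCompact_closedBall _ _) Metric.isOpen_ball Metric.ball_subset_closedBall t₀ t₁ hmem
    (A₁ := 1) (A₂ := 1 / 4) (A₃ := 0)
    (fun x hx => ?_) (fun x hx => (mem_ball_iff_norm.1 hx).le) (by simp) (by linarith)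
    (by rw [hC]; simp only [norm_zero]; nlinarith) ?_ ?_
    x₁ (Metric.mem_closedBall_self (by norm_num)) t₁ ht le_rfl
  · have := T₁.eq
    simp only [par] at this
    rw [this] at key
    simp at key
    linarith
  · have h1 := hball x (Metric.ball_subset_closedBall hx)
    have := norm_sub_le x y₀
    linarith
  · intro x hx _
    have h1 := T₀.le (x, t₀) (hmem x hx t₀ le_rfl ht) le_rfl
    simp only [par] at h1
    have h2 := sq_nonneg ‖x - x₁‖
    simp
    linarith
  · intro x hx hxO t h1 h2
    have h3 := hv (x, t) (hmem x hx t h1 h2)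
    have h4 : 1 / 4 ≤ ‖x - x₁‖ := by
      rw [mem_ball_iff_norm, not_lt] at hxO
      exact hxO
    have h5 := T₀.h_le
    have h6 := sq_nonneg ‖x - y₀‖
    have h7 : C * t₀ ≤ C * t := mul_le_mul_of_nonneg_left h1 hC0
    simp
    have h8 := pow_le_pow_left₀ (by norm_num) h4 2
    norm_num at h8
    linarith

set_option maxHeartbeats 1000000 in
lemma Touch.two_point_lower {n : ℕ} {lam Lam G K r₀ : ℝ} (hlam : 0 < lam) (hLam : lam ≤ Lam)
    {γ δ R T : ℝ} (hγ : lam * γ = 64 * Lam * n + 10) (hδ : δ * (4 * (Lam * n + 1)) = lam)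
    (hδ0 : 0 < δ) (hR0 : 0 < R) (hR : δ * R ^ 2 = 64) (hT : lam / 2 * T = 64)
    (hG : 100 + γ * δ + 4 * γ ≤ G) (hK : K = γ / 2 + (10 + 192 * Lam * n))
    (hr₁ : r₀ ≤ 1 / 4) (hr₂ : R * r₀ ≤ 1 / 4) (hr₃ : T * r₀ ^ 2 ≤ 1 / 2)
    {v : Sp n × ℝ → ℝ} (hv : ∀ z ∈ unitCyl n, 0 ≤ v z)
    (H : SuperC lam Lam G 1 (unitCyl n) v) {y₀ y₁ x₀ x₁ : Sp n} {h₀ h₁ t₀ t₁ : ℝ}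
    (T₀ : Touch v y₀ h₀ (x₀, t₀)) (T₁ : Touch v y₁ h₁ (x₁, t₁)) (ht : t₀ ≤ t₁) {r : ℝ}
    (hr : 0 < r) (hrr : r ≤ r₀) (hx : ‖x₀ - x₁‖ ≤ r) (htr : t₁ - t₀ ≤ r ^ 2) :
    ‖y₁ - y₀‖ ≤ K * r := by
  by_contra hd
  push Not at hd
  have hn : (0 : ℝ) ≤ n := Nat.cast_nonneg n
  have hLam0 : 0 < Lam := hlam.trans_le hLam
  have hγ0 : 0 < γ := by
    by_contra h
    push Not at h
    nlinarith [mul_nonneg hLam0.le hn]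
  have hT0 : 0 < T := by
    by_contra h
    push Not at h
    nlinarith
  set d := ‖y₁ - y₀‖ with hd'
  have hK0 : 0 < K := by rw [hK]; positivity
  have hd0 : 0 < d := (by positivity : 0 ≤ K * r).trans_lt hd
  set e := d⁻¹ • (y₁ - y₀) with he
  have hen : ‖e‖ = 1 := by
    rw [he, norm_smul, ← hd', norm_inv, Real.norm_of_nonneg hd0.le, inv_mul_cancel₀ hd0.ne']
  have hde : y₁ - y₀ = d • e := by
    rw [he, smul_smul, mul_inv_cancel₀ hd0.ne', one_smul]
  have upper := Touch.two_point_upper hlam hLam (by linarith [mul_pos hγ0 hδ0]) hv H T₀ T₁ ht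
  set C := 10 + 192 * Lam * n with hC
  have hC0 : 0 ≤ C := by positivity
  have hRr : R * r ≤ 1 / 4 := (mul_le_mul_of_nonneg_left hrr hR0.le).trans hr₂
  have hTr : T * r ^ 2 ≤ 1 / 2 := by
    refine le_trans ?_ hr₃
    gcongr
  have nx := T₀.norm_z
  have ny := T₀.norm_y
  have tge := T₀.time_ge
  have tle := T₀.time_le
  simp only at nx tge tle
  -- lower bound for the difference of the paraboloids
  have hell : ∀ x, -(C * r ^ 2) - 64 * d * r + 64 * d * inner ℝ e (x - x₀) ≤
      (h₁ - 32 * ‖x - y₁‖ ^ 2) - (h₀ - 32 * ‖x - y₀‖ ^ 2) := by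
    intro x
    have h1 := par_sub_diff y₀ y₁ x x₁
    have h2 : inner ℝ (y₁ - y₀) (x - x₁) = d * inner ℝ e (x - x₀) + d * inner ℝ e (x₀ - x₁) := by
      rw [hde, real_inner_smul_left, ← mul_add, ← inner_add_right]
      congr 2; abel
    rw [h2] at h1
    have h3 : -r ≤ inner ℝ e (x₀ - x₁) := by
      have := abs_real_inner_le_norm e (x₀ - x₁)
      rw [hen, one_mul] at this
      linarith [(abs_le.1 (this.trans hx)).1]
    have h4 := mul_le_mul_of_nonneg_left h3 hd0.le
    have h5 := mul_le_mul_of_nonneg_left htr hC0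
    linarith
  set Kx := Metric.closedBall x₀ (R * r) ∩ {x | |inner ℝ e (x - x₀)| ≤ 4 * r} with hKx
  set Ox := Metric.ball x₀ (R * r) ∩ {x | |inner ℝ e (x - x₀)| < 4 * r} with hOx
  have hcont : Continuous fun x : Sp n => |inner ℝ e (x - x₀)| := by fun_prop
  have hball : ∀ x ∈ Kx, ‖x‖ ≤ 3 / 4 := fun x hx => by
    have := mem_closedBall_iff_norm.1 hx.1
    have := norm_add_le (x - x₀) x₀
    rw [sub_add_cancel] at this
    linarith
  have hmem : ∀ x ∈ Kx, ∀ t, t₀ - T * r ^ 2 ≤ t → t ≤ t₀ → (x, t) ∈ unitCyl n := by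
    intro x hx t h1 h2
    refine ⟨mem_closedBall_zero_iff.2 ((hball x hx).trans (by norm_num)), ?_, ?_⟩
    · simp only; linarith
    · simp only; linarith
  have hOK : Ox ⊆ Kx := fun x hx => ⟨Metric.ball_subset_closedBall hx.1, by
    have h : |inner ℝ e (x - x₀)| < 4 * r := hx.2
    exact h.le⟩
  have hx₀K : x₀ ∈ Kx := ⟨Metric.mem_closedBall_self (by positivity), by simp; positivity⟩
  have key := H.quadratic (a₁ := 32) (a₂ := γ * δ) (a₃ := γ) (c := 4 * r)
    (h := h₀ - γ * (lam / 2) * t₀)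
    (b := 8 + γ * (lam / 2)) (y := y₀) (x₁ := x₀) (x₂ := x₀) (e := e) (by norm_num) (by positivity)
    hγ0.le hen.le Kx Ox ((isCompact_closedBall _ _).inter_right
      (isClosed_le hcont continuous_const))
    (Metric.isOpen_ball.inter (isOpen_lt hcont continuous_const)) hOK (t₀ - T * r ^ 2) t₀ hmem
    (A₁ := 1) (A₂ := 1 / 4) (A₃ := 2)
    (fun x hx => ?_) (fun x hx => (mem_ball_iff_norm.1 hx.1).le.trans hRr) ?_ ?_ ?_ ?_ ?_
    x₀ hx₀K t₀ (by nlinarith [sq_nonneg r]) le_rfl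
  · have := T₀.eq
    simp only [par] at this
    rw [this] at key
    simp at key
    linarith [mul_pos hγ0 (mul_pos hr hr)]
  · have h1 := hball x (hOK hx)
    have := norm_sub_le x y₀
    linarith
  · intro x hx
    have h1 : |inner ℝ e (x - x₀)| < 4 * r := hx.2
    rw [abs_lt] at h1
    rw [abs_le]
    constructor <;> linarith
  · have := mul_pos hγ0 hδ0
    linarith
  · rw [hen]
    have h2 : 2 * δ * (Lam * n) ≤ lam / 2 := by linarith
    have h3 := mul_le_mul_of_nonneg_left h2 hγ0.le
    linarith
  · intro x hx hle
    have h1 := T₀.le (x, t₀ - T * r ^ 2) (hmem x hx _ le_rfl hle) hle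
    simp only [par] at h1
    have h2 : |inner ℝ e (x - x₀)| ≤ 4 * r := hx.2
    rw [abs_le] at h2
    have h3 : (inner ℝ e (x - x₀) + 4 * r) ^ 2 ≤ 64 * r ^ 2 :=
      (pow_le_pow_left₀ (by linarith) (by linarith : _ ≤ 8 * r) 2).trans_eq (by ring)
    have h4 := mul_le_mul_of_nonneg_left h3 hγ0.le
    have h5 : 0 ≤ γ * δ * ‖x - x₀‖ ^ 2 := by positivity
    have h6 : γ * (lam / 2) * (T * r ^ 2) = γ * (64 * r ^ 2) := by rw [← hT]; ring
    linarith
  · intro x hx hxO t h1 h2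
    have hm := hmem x hx t h1 h2
    have h3 : |inner ℝ e (x - x₀)| ≤ 4 * r := hx.2
    have h3' := abs_le.1 h3
    have h4 := T₀.le (x, t) hm h2
    have h5 := T₁.le (x, t) hm (h2.trans ht)
    simp only [par] at h4 h5
    have h6 : γ * (lam / 2) * (t - t₀) ≤ 0 :=
      mul_nonpos_of_nonneg_of_nonpos (by positivity) (by linarith)
    have h7 : 0 ≤ γ * δ * ‖x - x₀‖ ^ 2 := by positivity
    have h8 : (inner ℝ e (x - x₀) + 4 * r) ^ 2 ≤ 64 * r ^ 2 :=
      (pow_le_pow_left₀ (by linarith) (by linarith : _ ≤ 8 * r) 2).trans_eq (by ring)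
    have h8' := mul_le_mul_of_nonneg_left h8 hγ0.le
    by_cases hb : x ∈ Metric.ball x₀ (R * r)
    · have h9 : 4 * r ≤ |inner ℝ e (x - x₀)| := by
        by_contra h
        exact hxO ⟨hb, not_le.1 h⟩
      rcases le_or_gt 0 (inner ℝ e (x - x₀)) with h0 | h0
      · rw [abs_of_nonneg h0] at h9
        have h10 := hell x
        have h11 : inner ℝ e (x - x₀) = 4 * r := le_antisymm h3'.2 h9
        rw [h11] at h10 h8' ⊢
        have h12 : K * r * r ≤ d * r := mul_le_mul_of_nonneg_right hd.le hr.le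
        rw [hK] at h12
        have h13 : 0 ≤ C * r ^ 2 := by positivity
        have h14 : 0 ≤ γ * r ^ 2 := by positivity
        linarith
      · rw [abs_of_neg h0] at h9
        have h11 : inner ℝ e (x - x₀) = -(4 * r) := by linarith
        rw [h11]
        linarith
    · have h9 : R * r ≤ ‖x - x₀‖ := by
        rw [mem_ball_iff_norm, not_lt] at hb
        exact hb
      have h10 : (R * r) ^ 2 ≤ ‖x - x₀‖ ^ 2 := by gcongr
      have h11 := mul_le_mul_of_nonneg_left h10 (by positivity : 0 ≤ γ * δ)
      have h12 : γ * δ * (R * r) ^ 2 = γ * (64 * r ^ 2) := by rw [← hR]; ring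
      linarith

lemma Touch.two_point_ordered {n : ℕ} {lam Lam G K C r₀ : ℝ} (hlam : 0 < lam) (hLam : lam ≤ Lam)
    {γ δ R T : ℝ} (hγ : lam * γ = 64 * Lam * n + 10) (hδ : δ * (4 * (Lam * n + 1)) = lam)
    (hγ0 : 0 < γ) (hδ0 : 0 < δ) (hR0 : 0 < R) (hR : δ * R ^ 2 = 64) (hT : lam / 2 * T = 64)
    (hG : 100 + γ * δ + 4 * γ ≤ G) (hC : C = 10 + 192 * Lam * n) (hC0 : 0 < C)
    (hK : K = γ / 2 + C)
    (hr₁ : r₀ ≤ 1 / 4) (hr₂ : R * r₀ ≤ 1 / 4) (hr₃ : T * r₀ ^ 2 ≤ 1 / 2)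
    {v : Sp n × ℝ → ℝ} (hv : ∀ z ∈ unitCyl n, 0 ≤ v z)
    (H : SuperC lam Lam G 1 (unitCyl n) v) {y₀ y₁ x₀ x₁ : Sp n} {h₀ h₁ t₀ t₁ : ℝ}
    (T₀ : Touch v y₀ h₀ (x₀, t₀)) (T₁ : Touch v y₁ h₁ (x₁, t₁)) (ht : t₀ ≤ t₁) {r : ℝ}
    (hr : 0 < r) (hrr : r ≤ r₀) (hx : ‖x₀ - x₁‖ ≤ r) (htr : t₁ - t₀ ≤ r ^ 2) :
    ‖y₁ - y₀‖ ≤ K * r ∧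
      |(h₁ - 32 * ‖x₀ - y₁‖ ^ 2) - (h₀ - 32 * ‖x₀ - y₀‖ ^ 2)| ≤ (C + 128 * K) * r ^ 2 ∧
      |(h₁ - 32 * ‖x₁ - y₁‖ ^ 2) - (h₀ - 32 * ‖x₁ - y₀‖ ^ 2)| ≤ (C + 128 * K) * r ^ 2 := by
  have h1 : ‖y₁ - y₀‖ ≤ K * r :=
    Touch.two_point_lower hlam hLam hγ hδ hδ0 hR0 hR hT hG (by rw [hK, hC]) hr₁ hr₂ hr₃ hv H T₀ T₁
      ht hr hrr hx htr
  have h2 := Touch.two_point_upper hlam hLam (by linarith [mul_pos hγ0 hδ0]) hv H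
    T₀ T₁ ht
  have h3 : (h₁ - 32 * ‖x₀ - y₁‖ ^ 2) - (h₀ - 32 * ‖x₀ - y₀‖ ^ 2) ≤ 0 := by
    have e1 := T₀.eq
    have e2 := T₁.le (x₀, t₀) ⟨mem_closedBall_zero_iff.2 (T₀.norm_z.trans (by norm_num)),
      le_trans (by norm_num) T₀.time_ge, T₀.time_le⟩ ht
    rw [e1] at e2
    simp only [par] at e2
    linarith
  have h4 := par_sub_diff y₀ y₁ x₁ x₀
  have h5 : |inner ℝ (y₁ - y₀) (x₁ - x₀)| ≤ K * r * r := by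
    refine (abs_real_inner_le_norm _ _).trans ?_
    rw [norm_sub_rev x₁ x₀]
    have : 0 ≤ K * r := (norm_nonneg _).trans h1
    gcongr
  rw [abs_le] at h5
  have h6 := mul_le_mul_of_nonneg_left htr hC0.le
  rw [← hC] at h2
  have h7 : 0 ≤ C * r ^ 2 := by positivity
  have h8 : 0 ≤ K * r ^ 2 := by rw [hK]; positivity
  refine ⟨h1, ?_, ?_⟩ <;> rw [abs_le] <;> constructor <;> linarith

/-- Parameters of nearby touching paraboloids are close. -/
lemma exists_two_point_constants (n : ℕ) {lam Lam : ℝ} (hlam : 0 < lam) (hLam : lam ≤ Lam) :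
    ∃ G > 0, ∃ K > 0, ∃ r₀ > 0, ∀ v : Sp n × ℝ → ℝ, (∀ z ∈ unitCyl n, 0 ≤ v z) →
      SuperC lam Lam G 1 (unitCyl n) v → ∀ (y₀ y₁ x₀ x₁ : Sp n) (h₀ h₁ t₀ t₁ : ℝ),
      Touch v y₀ h₀ (x₀, t₀) → Touch v y₁ h₁ (x₁, t₁) → ∀ r, 0 < r → r ≤ r₀ → ‖x₀ - x₁‖ ≤ r →
      |t₀ - t₁| ≤ r ^ 2 → ‖y₁ - y₀‖ ≤ K * r ∧
        |(h₁ - 32 * ‖x₀ - y₁‖ ^ 2) - (h₀ - 32 * ‖x₀ - y₀‖ ^ 2)| ≤ K * r ^ 2 := by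
  have hn : (0 : ℝ) ≤ n := Nat.cast_nonneg n
  have hLam0 : 0 < Lam := hlam.trans_le hLam
  obtain ⟨γ, hγ0, hγ⟩ : ∃ γ > 0, lam * γ = 64 * Lam * n + 10 :=
    ⟨(64 * Lam * n + 10) / lam, by positivity, by field_simp⟩
  obtain ⟨δ, hδ0, hδ⟩ : ∃ δ > 0, δ * (4 * (Lam * n + 1)) = lam :=
    ⟨lam / (4 * (Lam * n + 1)), by positivity, by field_simp⟩
  obtain ⟨R, hR0, hR⟩ : ∃ R > 0, δ * R ^ 2 = 64 :=
    ⟨8 / Real.sqrt δ, by positivity, by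
      rw [div_pow, Real.sq_sqrt hδ0.le]; field_simp; norm_num⟩
  obtain ⟨T, hT0, hT⟩ : ∃ T > 0, lam / 2 * T = 64 :=
    ⟨128 / lam, by positivity, by field_simp; norm_num⟩
  obtain ⟨C, hC0, hC⟩ : ∃ C > 0, C = 10 + 192 * Lam * n := ⟨_, by positivity, rfl⟩
  obtain ⟨G, hG0, hG⟩ : ∃ G > 0, G = 100 + γ * δ + 4 * γ := ⟨_, by positivity, rfl⟩
  obtain ⟨K, hK0, hK⟩ : ∃ K > 0, K = γ / 2 + C := ⟨_, by positivity, rfl⟩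
  obtain ⟨r₀, hr₀0, hr₁, hr₂, hr₃⟩ : ∃ r₀ > 0, r₀ ≤ 1 / 4 ∧ R * r₀ ≤ 1 / 4 ∧
      T * r₀ ^ 2 ≤ 1 / 2 := by
    refine ⟨min (1 / 4) (min (1 / (4 * R)) (1 / (2 * T + 1))), by positivity, min_le_left _ _,
      ?_, ?_⟩
    · have : min (1 / 4) (min (1 / (4 * R)) (1 / (2 * T + 1))) ≤ 1 / (4 * R) :=
        (min_le_right _ _).trans (min_le_left _ _)
      calc _ ≤ R * (1 / (4 * R)) := by gcongr
        _ = 1 / 4 := by field_simp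
    · have h1 : min (1 / 4) (min (1 / (4 * R)) (1 / (2 * T + 1))) ≤ 1 / (2 * T + 1) :=
        (min_le_right _ _).trans (min_le_right _ _)
      have h0 : 0 < min (1 / 4) (min (1 / (4 * R)) (1 / (2 * T + 1))) := by positivity
      generalize min (1 / 4) (min (1 / (4 * R)) (1 / (2 * T + 1))) = r₀ at h0 h1
      rw [le_div_iff₀ (by positivity)] at h1
      have h2 : r₀ ≤ 1 := by nlinarith
      nlinarith
  refine ⟨G, hG0, C + 128 * K, by positivity, r₀, hr₀0, ?_⟩
  intro v hv H y₀ y₁ x₀ x₁ h₀ h₁ t₀ t₁ T₀ T₁ r hr hrr hx htr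
  have hKr : K * r ≤ (C + 128 * K) * r := by gcongr; linarith
  rw [abs_le] at htr
  rcases le_total t₀ t₁ with ht | ht
  · obtain ⟨a, b, -⟩ := Touch.two_point_ordered hlam hLam hγ hδ hγ0 hδ0 hR0 hR hT hG.ge hC hC0 hK
      hr₁ hr₂ hr₃ hv H T₀ T₁ ht hr hrr hx (by linarith)
    exact ⟨a.trans hKr, b⟩
  · obtain ⟨a, -, b⟩ := Touch.two_point_ordered hlam hLam hγ hδ hγ0 hδ0 hR0 hR hT hG.ge hC hC0 hK
      hr₁ hr₂ hr₃ hv H T₁ T₀ ht hr hrr (by rwa [norm_sub_rev]) (by linarith)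
    refine ⟨?_, ?_⟩
    · rw [norm_sub_rev]
      exact a.trans hKr
    · rw [abs_sub_comm]
      exact b

lemma isCompact_unitCyl (n : ℕ) : IsCompact (unitCyl n) :=
  (isCompact_closedBall _ _).prod isCompact_Icc

lemma continuous_par {n : ℕ} (y : Sp n) (h : ℝ) : Continuous (par y h) := by
  unfold par; fun_prop

lemma exists_touch {n : ℕ} {v : Sp n × ℝ → ℝ} (hv : ContinuousOn v (unitCyl n))
    (hv0 : ∀ z ∈ unitCyl n, 0 ≤ v z) (h1 : v (0, 0) ≤ 1) {y : Sp n} {h : ℝ} (hy : ‖y‖ ≤ 1 / 8)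
    (hh : 2 ≤ h) (hh' : h ≤ 3) : ∃ z, Touch v y h z := by
  have hcont : ContinuousOn (fun z => v z - par y h z) (unitCyl n) :=
    hv.sub (continuous_par y h).continuousOn
  have hmem0 : ((0 : Sp n), (0 : ℝ)) ∈ unitCyl n := ⟨by simp, by simp⟩
  have hcpt : IsCompact (unitCyl n ∩ (fun z => v z - par y h z) ⁻¹' Iic 0) :=
    (isCompact_unitCyl n).of_isClosed_subset
      (hcont.preimage_isClosed_of_isClosed (isCompact_unitCyl n).isClosed isClosed_Iic)
      inter_subset_left
  obtain ⟨z, ⟨hz, hzle⟩, hzmin⟩ := hcpt.exists_isMinOn ⟨(0, 0), hmem0, by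
    simp only [mem_preimage, mem_Iic, par, zero_sub, norm_neg]
    nlinarith [norm_nonneg y]⟩ continuous_snd.continuousOn
  have hzle' : v z ≤ par y h z := by
    have h2 : v z - par y h z ≤ 0 := hzle
    linarith
  have hlt : ∀ w ∈ unitCyl n, w.2 < z.2 → par y h w ≤ v w := by
    intro w hw hwz
    by_contra hcon
    push Not at hcon
    have : z.2 ≤ w.2 := hzmin ⟨hw, by
      change v w - par y h w ≤ 0
      linarith⟩
    linarith
  have hz2 : z.2 ≤ 0 := hz.2.2
  have hp : 0 ≤ par y h z := (hv0 z hz).trans hzle'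
  have hzt : -(3 / 8) ≤ z.2 := by
    unfold par at hp
    nlinarith [sq_nonneg ‖z.1 - y‖]
  have hle : ∀ w ∈ unitCyl n, w.2 ≤ z.2 → par y h w ≤ v w := by
    intro w hw hwz
    rcases hwz.lt_or_eq with hlt' | heq
    · exact hlt w hw hlt'
    have h2 : Tendsto (fun e : ℝ => ((w.1, w.2 - e) : Sp n × ℝ)) (nhdsWithin 0 (Ioi 0))
        (nhdsWithin w (unitCyl n)) := by
      have hc2 : Tendsto (fun e : ℝ => ((w.1, w.2 - e) : Sp n × ℝ)) (nhds 0) (nhds w) := by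
        have : Continuous (fun e : ℝ => ((w.1, w.2 - e) : Sp n × ℝ)) := by fun_prop
        exact this.tendsto' _ _ (by simp)
      refine tendsto_nhdsWithin_iff.2 ⟨hc2.mono_left nhdsWithin_le_nhds, ?_⟩
      have : Ioo (0 : ℝ) (1 / 8) ∈ nhdsWithin (0 : ℝ) (Ioi 0) := Ioo_mem_nhdsGT (by norm_num)
      filter_upwards [this] with e he
      refine ⟨hw.1, ?_, ?_⟩
      · change -1 ≤ w.2 - e
        linarith [he.2]
      · change w.2 - e ≤ 0
        linarith [he.1]
    have h3 := (hcont w hw).tendsto.comp h2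
    have h4 : 0 ≤ v w - par y h w := by
      refine ge_of_tendsto h3 ?_
      have : Ioo (0 : ℝ) (1 / 8) ∈ nhdsWithin (0 : ℝ) (Ioi 0) := Ioo_mem_nhdsGT (by norm_num)
      filter_upwards [this, h2.eventually self_mem_nhdsWithin] with e he he'
      have := hlt _ he' (by change w.2 - e < z.2; linarith [he.1])
      simp only [Function.comp]
      linarith
    linarith
  refine ⟨z, hy, hh', ?_, by linarith, hz2, le_antisymm hzle' (hle z hz le_rfl), hle⟩
  have h2 : ‖z.1 - y‖ ≤ 3 / 8 := by
    unfold par at hp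
    by_contra hcon
    push Not at hcon
    nlinarith
  have h3 := norm_add_le (z.1 - y) y
  rw [sub_add_cancel] at h3
  linarith

/-- Index of the parabolic grid cell of spatial side `1 / a` containing a point. -/
noncomputable def key {n : ℕ} (a : ℝ) (z : Sp n × ℝ) : (Fin n → ℤ) × ℤ :=
  (fun j => ⌊a * z.1 j⌋, ⌊a ^ 2 * z.2⌋)

/-- Parabolic grid cells of spatial side `1 / a`. -/
def cell {n : ℕ} (a : ℝ) (k : (Fin n → ℤ) × ℤ) : Set (Sp n × ℝ) := {z | key a z = k}

lemma floor_mul_eq_iff {a : ℝ} (ha : 0 < a) (t : ℝ) (m : ℤ) :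
    ⌊a * t⌋ = m ↔ t ∈ Ico (m / a) ((m + 1) / a) := by
  rw [Int.floor_eq_iff, mem_Ico, div_le_iff₀ ha, lt_div_iff₀ ha, mul_comm t a]

lemma cell_eq {n : ℕ} {a : ℝ} (ha : 0 < a) (k : (Fin n → ℤ) × ℤ) :
    cell a k = (WithLp.ofLp ⁻¹' (Set.pi univ fun j => Ico (k.1 j / a) ((k.1 j + 1) / a))) ×ˢ
      Ico (k.2 / a ^ 2) ((k.2 + 1) / a ^ 2) := by
  ext z
  simp only [cell, key, mem_ofPred_eq, Prod.ext_iff, funext_iff, mem_prod, mem_preimage, Set.mem_pi,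
    mem_univ, true_imp_iff, floor_mul_eq_iff ha, floor_mul_eq_iff (pow_pos ha 2)]

lemma measurableSet_cell {n : ℕ} {a : ℝ} (ha : 0 < a) (k : (Fin n → ℤ) × ℤ) :
    MeasurableSet (cell a k) := by
  rw [cell_eq ha]
  refine MeasurableSet.prod ?_ measurableSet_Ico
  exact (MeasurableSet.univ_pi fun _ => measurableSet_Ico).preimage
    (PiLp.volume_preserving_ofLp (Fin n)).measurable

lemma volume_cell {n : ℕ} {a : ℝ} (ha : 0 < a) (k : (Fin n → ℤ) × ℤ) :
    MeasureTheory.volume (cell a k) = ENNReal.ofReal ((a ^ (n + 2))⁻¹) := by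
  rw [cell_eq ha, MeasureTheory.Measure.volume_eq_prod, MeasureTheory.Measure.prod_prod,
    (PiLp.volume_preserving_ofLp (Fin n)).measure_preimage
      (MeasurableSet.univ_pi fun _ => measurableSet_Ico).nullMeasurableSet, Real.volume_pi_Ico,
    Real.volume_Ico]
  have h1 : ∀ i : Fin n, ENNReal.ofReal ((k.1 i + 1) / a - k.1 i / a) = ENNReal.ofReal (a⁻¹) := by
    intro i; congr 1; field_simp; ring
  have h2 : ((k.2 : ℝ) + 1) / a ^ 2 - k.2 / a ^ 2 = (a ^ 2)⁻¹ := by field_simp; ring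
  simp only [h1, h2, Finset.prod_const, Finset.card_univ, Fintype.card_fin]
  rw [← ENNReal.ofReal_pow (by positivity), ← ENNReal.ofReal_mul (by positivity)]
  congr 1
  rw [pow_add, mul_inv, inv_pow]

lemma pairwise_disjoint_cell {n : ℕ} (a : ℝ) :
    Pairwise (Function.onFun Disjoint (cell (n := n) a)) := by
  intro k l hkl
  rw [Function.onFun, Set.disjoint_left]
  intro z h1 h2
  exact hkl (h1.symm.trans h2)

lemma norm_le_of_abs_coord_le {n : ℕ} {x : Sp n} {r : ℝ} (hr : 0 ≤ r) (h : ∀ j, |x j| ≤ r) :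
    ‖x‖ ≤ (n + 1) * r := by
  refine le_of_sq_le_sq ?_ (by positivity)
  rw [EuclideanSpace.real_norm_sq_eq]
  calc ∑ i, x i ^ 2 ≤ ∑ _i : Fin n, r ^ 2 :=
        Finset.sum_le_sum fun i _ => sq_le_sq.2 (by rw [abs_of_nonneg hr]; exact h i)
    _ = n * r ^ 2 := by simp
    _ ≤ ((n + 1) * r) ^ 2 := by
      have : (0 : ℝ) ≤ n := n.cast_nonneg
      nlinarith [mul_nonneg this (sq_nonneg r), mul_nonneg (mul_nonneg this this) (sq_nonneg r)]

lemma abs_sub_le_of_floor_eq {a : ℝ} (ha : 0 < a) {s t : ℝ} (h : ⌊a * s⌋ = ⌊a * t⌋) :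
    |s - t| ≤ 1 / a := by
  have := Int.abs_sub_lt_one_of_floor_eq_floor h
  rw [← mul_sub, abs_mul, abs_of_pos ha] at this
  rw [le_div_iff₀ ha]
  linarith

lemma cell_dist {n : ℕ} {a : ℝ} (ha : 0 < a) {k : (Fin n → ℤ) × ℤ} {z w : Sp n × ℝ}
    (hz : z ∈ cell a k) (hw : w ∈ cell a k) :
    ‖z.1 - w.1‖ ≤ (n + 1) / a ∧ |z.2 - w.2| ≤ ((n + 1) / a) ^ 2 := by
  have h : key a z = key a w := Eq.trans hz (Eq.symm hw)
  simp only [key, Prod.ext_iff, funext_iff] at h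
  constructor
  · have := norm_le_of_abs_coord_le (x := z.1 - w.1) (r := 1 / a) (by positivity) fun j =>
      abs_sub_le_of_floor_eq ha (h.1 j)
    rwa [mul_one_div] at this
  · refine (abs_sub_le_of_floor_eq (pow_pos ha 2) h.2).trans ?_
    rw [div_pow]
    have : (0 : ℝ) ≤ n := n.cast_nonneg
    gcongr
    nlinarith

lemma volume_graph_nhd_le {n : ℕ} (y₀ : Sp n) {g : Sp n → ℝ} (hg : Continuous g) {ρ s : ℝ}
    (hρ : 0 ≤ ρ) (hs : 0 ≤ s) :
    MeasureTheory.volume {p : Sp n × ℝ | ‖p.1 - y₀‖ ≤ ρ ∧ |p.2 - g p.1| ≤ s} ≤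
      ENNReal.ofReal (2 * s * ρ ^ n) * MeasureTheory.volume (Metric.closedBall (0 : Sp n) 1) := by
  have hm : MeasurableSet {p : Sp n × ℝ | ‖p.1 - y₀‖ ≤ ρ ∧ |p.2 - g p.1| ≤ s} := by
    apply IsClosed.measurableSet
    have h1 : Continuous fun p : Sp n × ℝ => ‖p.1 - y₀‖ := by fun_prop
    have h2 : Continuous fun p : Sp n × ℝ => |p.2 - g p.1| := by fun_prop
    exact (isClosed_le h1 continuous_const).inter (isClosed_le h2 continuous_const)
  rw [MeasureTheory.Measure.volume_eq_prod, MeasureTheory.Measure.prod_apply hm]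
  have hle : ∀ x : Sp n, MeasureTheory.volume (Prod.mk x ⁻¹'
      {p : Sp n × ℝ | ‖p.1 - y₀‖ ≤ ρ ∧ |p.2 - g p.1| ≤ s}) ≤
      (Metric.closedBall y₀ ρ).indicator (fun _ => ENNReal.ofReal (2 * s)) x := by
    intro x
    by_cases hx : x ∈ Metric.closedBall y₀ ρ
    · rw [indicator_of_mem hx]
      refine (MeasureTheory.measure_mono (t := Icc (g x - s) (g x + s)) ?_).trans_eq ?_
      · intro t ht
        have h2 : |t - g x| ≤ s := ht.2
        rw [abs_le] at h2
        constructor <;> linarith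
      · rw [Real.volume_Icc]
        congr 1; ring
    · rw [indicator_of_notMem hx]
      have : Prod.mk x ⁻¹' {p : Sp n × ℝ | ‖p.1 - y₀‖ ≤ ρ ∧ |p.2 - g p.1| ≤ s} = ∅ := by
        ext t
        simp only [mem_preimage, mem_ofPred_eq, mem_empty_iff_false, iff_false, not_and]
        intro h
        exact absurd (mem_closedBall_iff_norm.2 h) hx
      rw [this, MeasureTheory.measure_empty]
  refine (MeasureTheory.lintegral_mono hle).trans ?_
  rw [MeasureTheory.lintegral_indicator Metric.isClosed_closedBall.measurableSet,
    MeasureTheory.setLIntegral_const, MeasureTheory.Measure.addHaar_closedBall' _ _ hρ,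
    finrank_euclideanSpace_fin, ← mul_assoc, ← ENNReal.ofReal_mul (by positivity)]

lemma volume_params_le {n : ℕ} {lam Lam G K r₀ : ℝ} (hK : 0 < K)
    (hc : ∀ v : Sp n × ℝ → ℝ, (∀ z ∈ unitCyl n, 0 ≤ v z) →
      SuperC lam Lam G 1 (unitCyl n) v → ∀ (y₀ y₁ x₀ x₁ : Sp n) (h₀ h₁ t₀ t₁ : ℝ),
      Touch v y₀ h₀ (x₀, t₀) → Touch v y₁ h₁ (x₁, t₁) → ∀ r, 0 < r → r ≤ r₀ → ‖x₀ - x₁‖ ≤ r →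
      |t₀ - t₁| ≤ r ^ 2 → ‖y₁ - y₀‖ ≤ K * r ∧
        |(h₁ - 32 * ‖x₀ - y₁‖ ^ 2) - (h₀ - 32 * ‖x₀ - y₀‖ ^ 2)| ≤ K * r ^ 2)
    {v : Sp n × ℝ → ℝ} (hv : ∀ z ∈ unitCyl n, 0 ≤ v z) (H : SuperC lam Lam G 1 (unitCyl n) v)
    {a : ℝ} (ha : 0 < a) (har : (n + 1) / a ≤ r₀) (k : (Fin n → ℤ) × ℤ) :
    MeasureTheory.volume {p : Sp n × ℝ | ∃ z ∈ cell a k, Touch v p.1 p.2 z} ≤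
      ENNReal.ofReal (2 * K * (n + 1) ^ 2 * (K * (n + 1)) ^ n) *
        MeasureTheory.volume (Metric.closedBall (0 : Sp n) 1) *
        MeasureTheory.volume (cell (n := n) a k) := by
  rcases Set.eq_empty_or_nonempty {p : Sp n × ℝ | ∃ z ∈ cell a k, Touch v p.1 p.2 z} with he | he
  · rw [he]; simp
  obtain ⟨⟨y₀, h₀⟩, ⟨x₀, t₀⟩, hz₀, T₀⟩ := he
  obtain ⟨r, hra⟩ : ∃ r : ℝ, r = (n + 1) / a := ⟨_, rfl⟩
  have hr : 0 < r := by rw [hra]; positivity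
  rw [← hra] at har
  have hg : Continuous fun y => 32 * ‖x₀ - y‖ ^ 2 + (h₀ - 32 * ‖x₀ - y₀‖ ^ 2) := by fun_prop
  have hbd := volume_graph_nhd_le y₀ hg (mul_pos hK hr).le
    (mul_pos hK (pow_pos hr 2)).le
  have hsub : {p : Sp n × ℝ | ∃ z ∈ cell a k, Touch v p.1 p.2 z} ⊆
      {p : Sp n × ℝ | ‖p.1 - y₀‖ ≤ K * r ∧
        |p.2 - (32 * ‖x₀ - p.1‖ ^ 2 + (h₀ - 32 * ‖x₀ - y₀‖ ^ 2))| ≤ K * r ^ 2} := by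
    rintro ⟨y₁, h₁⟩ ⟨⟨x₁, t₁⟩, hz₁, T₁⟩
    have hd := cell_dist ha hz₀ hz₁
    rw [← hra] at hd
    obtain ⟨h2, h3⟩ := hc v hv H _ _ _ _ _ _ _ _ T₀ T₁ r hr har hd.1 hd.2
    refine ⟨h2, ?_⟩
    rwa [← sub_sub]
  have hval : 2 * (K * r ^ 2) * (K * r) ^ n =
      2 * K * (n + 1) ^ 2 * (K * (n + 1)) ^ n * (a ^ (n + 2))⁻¹ := by
    rw [hra, mul_div_assoc', div_pow (K * (n + 1)) a, pow_add, mul_inv]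
    field_simp
  refine (MeasureTheory.measure_mono hsub).trans (hbd.trans_eq ?_)
  rw [hval, volume_cell ha, ENNReal.ofReal_mul (by positivity)]
  ring

/-- The sliding lemma: a supersolution that is small at one point is small on a set of positive
measure. -/
theorem exists_sliding (n : ℕ) {lam Lam : ℝ} (hlam : 0 < lam) (hLam : lam ≤ Lam) :
    ∃ G > 0, ∃ μ > 0, ∀ v : Sp n × ℝ → ℝ, ContinuousOn v (unitCyl n) →
      (∀ z ∈ unitCyl n, 0 ≤ v z) → SuperC lam Lam G 1 (unitCyl n) v → v (0, 0) ≤ 1 →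
      ENNReal.ofReal μ ≤ MeasureTheory.volume {z | z ∈ unitCyl n ∧ v z ≤ 3} := by
  obtain ⟨G, hG, K, hK, r₀, hr₀, hc⟩ := exists_two_point_constants n hlam hLam
  obtain ⟨C, hC, hCeq⟩ : ∃ C > 0, C = 2 * K * (n + 1) ^ 2 * (K * (n + 1)) ^ n :=
    ⟨_, by positivity, rfl⟩
  obtain ⟨B, hB⟩ : ∃ B, B = ENNReal.ofReal C *
    MeasureTheory.volume (Metric.closedBall (0 : Sp n) 1) := ⟨_, rfl⟩
  have hball0 : MeasureTheory.volume (Metric.closedBall (0 : Sp n) 1) ≠ 0 :=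
    (Metric.measure_closedBall_pos _ _ one_pos).ne'
  have hballT : MeasureTheory.volume (Metric.closedBall (0 : Sp n) 1) ≠ ⊤ :=
    (isCompact_closedBall _ _).measure_lt_top.ne
  have hB0 : B ≠ 0 := by
    rw [hB]; exact mul_ne_zero (by simpa using hC) hball0
  have hBT : B ≠ ⊤ := by
    rw [hB]; exact ENNReal.mul_ne_top ENNReal.ofReal_ne_top hballT
  obtain ⟨Y, hY⟩ : ∃ Y : Set (Sp n × ℝ), Y = Metric.closedBall 0 (1 / 8) ×ˢ Icc 2 3 := ⟨_, rfl⟩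
  have hY0 : MeasureTheory.volume Y ≠ 0 := by
    rw [hY, MeasureTheory.Measure.volume_eq_prod, MeasureTheory.Measure.prod_prod, Real.volume_Icc]
    refine mul_ne_zero (Metric.measure_closedBall_pos _ _ (by norm_num)).ne' ?_
    norm_num
  have hYT : MeasureTheory.volume Y ≠ ⊤ := by
    rw [hY]
    exact ((isCompact_closedBall _ _).prod isCompact_Icc).measure_lt_top.ne
  have hquo0 : MeasureTheory.volume Y / B ≠ 0 := ENNReal.div_ne_zero.2 ⟨hY0, hBT⟩
  have hquoT : MeasureTheory.volume Y / B ≠ ⊤ := ENNReal.div_ne_top hYT hB0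
  refine ⟨G, hG, (MeasureTheory.volume Y / B).toReal, ENNReal.toReal_pos hquo0 hquoT, ?_⟩
  intro v hvc hv H h1
  rw [ENNReal.ofReal_toReal hquoT]
  obtain ⟨A, hA⟩ : ∃ A, A = {z | z ∈ unitCyl n ∧ v z ≤ 3} := ⟨_, rfl⟩
  have hAc : IsCompact A := by
    rw [hA]
    exact (isCompact_unitCyl n).of_isClosed_subset
      (hvc.preimage_isClosed_of_isClosed (isCompact_unitCyl n).isClosed isClosed_Iic) fun z hz => hz.1
  rw [← hA]
  refine ENNReal.div_le_of_le_mul ?_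
  rw [mul_comm]
  have hstep : ∀ r, 0 < r → r ≤ r₀ → r ≤ 1 →
      MeasureTheory.volume Y ≤ B * MeasureTheory.volume (Metric.cthickening r A) := by
    intro r hr hr1 hr2
    obtain ⟨a, ha, har⟩ : ∃ a : ℝ, 0 < a ∧ (n + 1) / a = r :=
      ⟨(n + 1) / r, by positivity, by field_simp⟩
    classical
    let W : (Fin n → ℤ) × ℤ → Set (Sp n × ℝ) := fun k =>
      if {p : Sp n × ℝ | ∃ z ∈ cell a k, Touch v p.1 p.2 z}.Nonempty then cell a k else ∅
    have hWc : ∀ k, W k ⊆ cell a k := by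
      intro k
      by_cases h : {p : Sp n × ℝ | ∃ z ∈ cell a k, Touch v p.1 p.2 z}.Nonempty
      · simp only [W, if_pos h]; rfl
      · simp only [W, if_neg h]; exact empty_subset _
    have hWm : ∀ k, MeasurableSet (W k) := by
      intro k
      by_cases h : {p : Sp n × ℝ | ∃ z ∈ cell a k, Touch v p.1 p.2 z}.Nonempty
      · simp only [W, if_pos h]; exact measurableSet_cell ha k
      · simp only [W, if_neg h]; exact MeasurableSet.empty
    have hWv : ∀ k, MeasureTheory.volume {p : Sp n × ℝ | ∃ z ∈ cell a k, Touch v p.1 p.2 z} ≤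
        B * MeasureTheory.volume (W k) := by
      intro k
      by_cases h : {p : Sp n × ℝ | ∃ z ∈ cell a k, Touch v p.1 p.2 z}.Nonempty
      · simp only [W, if_pos h]
        rw [hB, hCeq]
        exact volume_params_le hK hc hv H ha (har.trans_le hr1) k
      · rw [not_nonempty_iff_eq_empty.1 h]; simp
    have hWU : ⋃ k, W k ⊆ Metric.cthickening r A := by
      refine iUnion_subset fun k => ?_
      by_cases h : {p : Sp n × ℝ | ∃ z ∈ cell a k, Touch v p.1 p.2 z}.Nonempty
      · simp only [W, if_pos h]
        obtain ⟨⟨y, s⟩, z, hz, T⟩ := h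
        intro w hw
        refine Metric.mem_cthickening_of_dist_le w z r A ?_ ?_
        · rw [hA]
          refine ⟨⟨mem_closedBall_zero_iff.2 (T.norm_z.trans (by norm_num)),
            le_trans (by norm_num) T.time_ge, T.time_le⟩, ?_⟩
          rw [T.eq]
          exact par_le T.h_le T.time_le
        · have hd := cell_dist ha hw hz
          rw [har] at hd
          rw [Prod.dist_eq, dist_eq_norm, Real.dist_eq]
          exact max_le hd.1 (hd.2.trans (by nlinarith))
      · simp only [W, if_neg h]; exact empty_subset _
    have hYU : Y ⊆ ⋃ k, {p : Sp n × ℝ | ∃ z ∈ cell a k, Touch v p.1 p.2 z} := by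
      rintro ⟨y, h⟩ hp
      rw [hY] at hp
      obtain ⟨z, hz⟩ := exists_touch hvc hv h1 (mem_closedBall_zero_iff.1 hp.1) hp.2.1 hp.2.2
      exact mem_iUnion.2 ⟨key a z, z, rfl, hz⟩
    calc MeasureTheory.volume Y
        ≤ ∑' k, MeasureTheory.volume {p : Sp n × ℝ | ∃ z ∈ cell a k, Touch v p.1 p.2 z} :=
          (MeasureTheory.measure_mono hYU).trans (MeasureTheory.measure_iUnion_le _)
      _ ≤ ∑' k, B * MeasureTheory.volume (W k) := ENNReal.tsum_le_tsum hWv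
      _ = B * MeasureTheory.volume (⋃ k, W k) := by
          rw [ENNReal.tsum_mul_left, MeasureTheory.measure_iUnion _ hWm]
          intro k l hkl
          exact (pairwise_disjoint_cell a hkl).mono (hWc k) (hWc l)
      _ ≤ B * MeasureTheory.volume (Metric.cthickening r A) := by
          gcongr
  have hlim := ((tendsto_measure_cthickening_of_isCompact (μ := MeasureTheory.volume) hAc).mono_left
    (nhdsWithin_le_nhds (s := Ioi 0)))
  refine ge_of_tendsto (ENNReal.Tendsto.const_mul hlim (Or.inr hBT)) ?_
  filter_upwards [Ioo_mem_nhdsGT hr₀, Ioo_mem_nhdsGT (one_pos : (0 : ℝ) < 1)] with r h2 h3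
  exact hstep r h2.1 h2.2.le h3.2.le

/-- A spreading bump, as test data. -/
lemma TestData.bump {n : ℕ} (c : Sp n) (C β t₁ R : ℝ) :
    TestData (fun z => Real.exp (-C * (z.2 - t₁)) *
        max (R + β * (z.2 - t₁) - ‖z.1 - c‖ ^ 2) 0 ^ 3)
      (fun z => (-6 * Real.exp (-C * (z.2 - t₁)) *
        max (R + β * (z.2 - t₁) - ‖z.1 - c‖ ^ 2) 0 ^ 2) • ip (z.1 - c))
      (fun z => (-6 * Real.exp (-C * (z.2 - t₁)) *
          max (R + β * (z.2 - t₁) - ‖z.1 - c‖ ^ 2) 0 ^ 2) • ip +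
        (24 * Real.exp (-C * (z.2 - t₁)) *
          max (R + β * (z.2 - t₁) - ‖z.1 - c‖ ^ 2) 0) • rankOne (z.1 - c))
      (fun z => Real.exp (-C * (z.2 - t₁)) *
        (3 * β * max (R + β * (z.2 - t₁) - ‖z.1 - c‖ ^ 2) 0 ^ 2 -
          C * max (R + β * (z.2 - t₁) - ‖z.1 - c‖ ^ 2) 0 ^ 3)) where
  smooth := by
    have h1 : ContDiff ℝ 2 fun z : Sp n × ℝ => R + β * (z.2 - t₁) - ‖z.1 - c‖ ^ 2 :=
      (contDiff_const.add (contDiff_const.mul (contDiff_snd.sub contDiff_const))).sub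
        ((contDiff_fst.sub contDiff_const).norm_sq ℝ)
    have h2 : ContDiff ℝ 2 fun z : Sp n × ℝ => Real.exp (-C * (z.2 - t₁)) :=
      (contDiff_const.mul (contDiff_snd.sub contDiff_const)).exp
    exact h2.mul (contDiff_posPart_cube.comp h1)
  grad z := by
    have h1 := ((TestData.normSq c).grad z).const_sub (R + β * (z.2 - t₁))
    have h2 := ((hasDerivAt_posPart_pow 1 (R + β * (z.2 - t₁) - ‖z.1 - c‖ ^ 2)).comp_hasFDerivAt
      z.1 h1).const_mul (Real.exp (-C * (z.2 - t₁)))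
    refine h2.congr_fderiv ?_
    ext v
    simp only [smul_apply, neg_apply, smul_eq_mul]
    push_cast
    ring
  hess z := by
    have h1 := ((TestData.normSq c).grad z).const_sub (R + β * (z.2 - t₁))
    have h2 := ((hasDerivAt_posPart_pow 0 (R + β * (z.2 - t₁) - ‖z.1 - c‖ ^ 2)).comp_hasFDerivAt
      z.1 h1).const_mul (-6 * Real.exp (-C * (z.2 - t₁)))
    have h3 : HasFDerivAt (fun y : Sp n => ip (y - c)) ip z.1 := by
      have := ((ip : Sp n →L[ℝ] Sp n →L[ℝ] ℝ).hasFDerivAt (x := z.1 - c)).comp z.1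
        ((hasFDerivAt_id z.1).sub_const c)
      exact this
    refine (h2.smul h3).congr_fderiv ?_
    ext v w
    change (-6 * Real.exp (-C * (z.2 - t₁)) * _) * ip v w +
      (-6 * Real.exp (-C * (z.2 - t₁)) * (((0 : ℕ) + 2 : ℝ) * _ * -(2 * ip (z.1 - c) v))) *
        ip (z.1 - c) w = (-6 * Real.exp (-C * (z.2 - t₁)) * _) * ip v w +
      (24 * Real.exp (-C * (z.2 - t₁)) * _) * (ip (z.1 - c) v * ip (z.1 - c) w)
    simp only [Nat.cast_zero, zero_add, pow_one, Function.comp]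
    ring
  symm z v w := by
    change _ * inner ℝ v w + _ * (inner ℝ (z.1 - c) v * inner ℝ (z.1 - c) w) =
      _ * inner ℝ w v + _ * (inner ℝ (z.1 - c) w * inner ℝ (z.1 - c) v)
    rw [real_inner_comm v w, mul_comm (inner ℝ (z.1 - c) v)]
  time z := by
    have h0 : HasDerivAt (fun s : ℝ => s - t₁) 1 z.2 := (hasDerivAt_id z.2).sub_const t₁
    have h1 := (h0.const_mul (-C)).exp
    have h2 := ((h0.const_mul β).const_add R).sub_const (‖z.1 - c‖ ^ 2)
    have h3 := (hasDerivAt_posPart_pow 1 (R + β * (z.2 - t₁) - ‖z.1 - c‖ ^ 2)).comp z.2 h2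
    refine (h1.mul h3).congr_deriv ?_
    simp only [Function.comp]
    push_cast
    ring

lemma SuperC.barrier {n : ℕ} {lam Lam G κ : ℝ} {D : Set (Sp n × ℝ)} {v : Sp n × ℝ → ℝ}
    (H : SuperC lam Lam G κ D v) (hlam : 0 < lam) (hLam : lam ≤ Lam) (hκ : 0 < κ) {c : Sp n}
    {ρ β t₁ T r C B : ℝ} (hρ : 0 < ρ) (hβ : 0 ≤ β) (hr : ρ ^ 2 + β * T = r ^ 2) (hr0 : 0 < r)
    (hB : B = 24 * lam + 6 * Lam * n + 3 * β) (hC0 : 0 ≤ C) (hC : B ^ 2 ≤ 96 * lam * ρ ^ 2 * C)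
    (hG : 6 * r ^ 5 / ρ ^ 6 ≤ G)
    (hD : ∀ x ∈ Metric.closedBall c r, ∀ t, t₁ ≤ t → t ≤ t₁ + T → (x, t) ∈ D)
    (hv : ∀ x ∈ Metric.closedBall c r, ∀ t, t₁ ≤ t → t ≤ t₁ + T → 0 ≤ v (x, t))
    (hv1 : ∀ x ∈ Metric.closedBall c ρ, 1 ≤ v (x, t₁)) :
    ∀ x ∈ Metric.closedBall c r, ∀ t, t₁ ≤ t → t ≤ t₁ + T →
      Real.exp (-C * (t - t₁)) * max (ρ ^ 2 + β * (t - t₁) - ‖x - c‖ ^ 2) 0 ^ 3 / ρ ^ 6 -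
        2 * κ * (t - t₁) ≤ v (x, t) := by
  have hn : (0 : ℝ) ≤ n := Nat.cast_nonneg n
  have hLam0 : 0 < Lam := hlam.trans_le hLam
  have htime : ContDiff ℝ 2 fun t : ℝ => -(2 * κ) * (t - t₁) := by fun_prop
  have key := H _ _ _ _ (((TestData.bump c C β t₁ (ρ ^ 2)).const_mul (ρ ^ 6)⁻¹).add_time htime
    (f' := fun _ => -(2 * κ))
    (fun t => by simpa using ((hasDerivAt_id t).sub_const t₁).const_mul (-(2 * κ))))
    (Metric.closedBall c r ×ˢ Icc t₁ (t₁ + T + 1)) (Metric.ball c r ×ˢ Ioo t₁ (t₁ + T + 1))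
    (t₁ + T) ((isCompact_closedBall _ _).prod isCompact_Icc) (Metric.isOpen_ball.prod isOpen_Ioo)
    (prod_mono Metric.ball_subset_closedBall Ioo_subset_Icc_self)
    (fun z hz hzT => hD z.1 hz.1 z.2 hz.2.1 hzT) ?_ ?_
  · intro x hx t ht htT
    have := key (x, t) ⟨hx, ht, by linarith⟩ htT
    simp only at this
    rw [mul_comm, ← div_eq_mul_inv] at this
    linarith
  · rintro ⟨x, t⟩ hz htT
    have hx : ‖x - c‖ ≤ r := (mem_ball_iff_norm.1 hz.1).le
    have ht : t₁ ≤ t := le_of_lt hz.2.1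
    simp only at htT
    simp only
    have hE1 : Real.exp (-C * (t - t₁)) ≤ 1 := by
      rw [Real.exp_le_one_iff]; nlinarith
    have hE0 := Real.exp_pos (-C * (t - t₁))
    obtain ⟨w, hw⟩ : ∃ w, w = max (ρ ^ 2 + β * (t - t₁) - ‖x - c‖ ^ 2) 0 := ⟨_, rfl⟩
    rw [← hw]
    have hw0 : 0 ≤ w := hw ▸ le_max_right _ _
    have hwr : w ≤ r ^ 2 := by
      rw [hw]
      refine max_le ?_ (by positivity)
      nlinarith [sq_nonneg ‖x - c‖]
    have hwx : w = 0 ∨ ρ ^ 2 - w ≤ ‖x - c‖ ^ 2 := by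
      rcases le_total (ρ ^ 2 + β * (t - t₁) - ‖x - c‖ ^ 2) 0 with h | h
      · left; rw [hw, max_eq_right h]
      · right; rw [hw, max_eq_left h]; nlinarith
    clear hw
    generalize Real.exp (-C * (t - t₁)) = E at *
    have hθ : 0 < (ρ ^ 6)⁻¹ := by positivity
    refine ⟨?_, (ρ ^ 6)⁻¹ * (6 * E * w ^ 2), by positivity, fun e => ?_, ?_⟩
    · refine le_trans ?_ hG
      rw [norm_smul, norm_smul, norm_ip, norm_mul, norm_mul, norm_pow, Real.norm_of_nonneg hw0,
        Real.norm_of_nonneg hE0.le, Real.norm_of_nonneg hθ.le, div_eq_inv_mul]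
      have h2 : w ^ 2 ≤ (r ^ 2) ^ 2 := by gcongr
      have h3 : E * w ^ 2 * ‖x - c‖ ≤ 1 * (r ^ 2) ^ 2 * r := by gcongr
      norm_num
      rw [mul_assoc, mul_assoc]
      refine mul_le_mul_of_nonneg_left ?_ hθ.le
      linarith
    · change _ ≤ (ρ ^ 6)⁻¹ * (-6 * E * w ^ 2 * inner ℝ e e +
        24 * E * w * (inner ℝ (x - c) e * inner ℝ (x - c) e))
      rw [real_inner_self_eq_norm_sq]
      have h1 : 0 ≤ (ρ ^ 6)⁻¹ * (24 * E * w * (inner ℝ (x - c) e * inner ℝ (x - c) e)) :=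
        mul_nonneg hθ.le (mul_nonneg (by positivity) (mul_self_nonneg _))
      linarith
    · simp only [btrace_add, btrace_smul, btrace_ip, btrace_rankOne]
      have h1 : 0 ≤ w * (24 * lam * ‖x - c‖ ^ 2 - (6 * Lam * n + 3 * β) * w + C * w ^ 2) := by
        rcases hwx with h | h
        · rw [h]; simp
        · refine mul_nonneg hw0 ?_
          have h2 : 0 ≤ 24 * lam * ρ ^ 2 - B * w + C * w ^ 2 := by
            have h3 : 0 ≤ (48 * lam * ρ ^ 2 - B * w) ^ 2 := sq_nonneg _
            have h4 := mul_le_mul_of_nonneg_right hC (sq_nonneg w)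
            have h5 : 0 ≤ 96 * (lam * ρ ^ 2) * (24 * lam * ρ ^ 2 - B * w + C * w ^ 2) := by
              linarith
            exact nonneg_of_mul_nonneg_right h5 (by positivity)
          have h3 := mul_le_mul_of_nonneg_left h (by positivity : 0 ≤ 24 * lam)
          rw [hB] at h2
          linarith
      have h2 := mul_nonneg (mul_nonneg hθ.le hE0.le) h1
      linarith
  · rintro ⟨x, t⟩ ⟨hx, ht⟩ hzO htT
    simp only at hx ht htT
    simp only
    have hθ : 0 < (ρ ^ 6)⁻¹ := by positivity
    have hle0 : ρ ^ 2 + β * (t - t₁) - ‖x - c‖ ^ 2 ≤ 0 → (ρ ^ 6)⁻¹ * (Real.exp (-C * (t - t₁)) *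
        max (ρ ^ 2 + β * (t - t₁) - ‖x - c‖ ^ 2) 0 ^ 3) + -(2 * κ) * (t - t₁) ≤ v (x, t) := by
      intro h
      rw [max_eq_right h]
      have h1 := hv x hx t ht.1 htT
      have h2 : 0 ≤ 2 * κ * (t - t₁) := mul_nonneg (by positivity) (by linarith [ht.1])
      simp
      linarith
    by_cases hxO : x ∈ Metric.ball c r
    · have htt : t = t₁ := by
        by_contra hne
        exact hzO ⟨hxO, lt_of_le_of_ne ht.1 (Ne.symm hne), by simp only; linarith⟩
      subst htt
      rcases le_or_gt (ρ ^ 2 + β * (t - t) - ‖x - c‖ ^ 2) 0 with h | h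
      · exact hle0 h
      · rw [max_eq_left h.le]
        simp only [sub_self, mul_zero, add_zero, Real.exp_zero, one_mul] at h ⊢
        have h1 : ‖x - c‖ ≤ ρ := le_of_lt (lt_of_pow_lt_pow_left₀ 2 hρ.le (by linarith))
        refine le_trans ?_ (hv1 x (mem_closedBall_iff_norm.2 h1))
        have h2 : (ρ ^ 2 - ‖x - c‖ ^ 2) ^ 3 ≤ (ρ ^ 2) ^ 3 := by
          gcongr
          linarith [sq_nonneg ‖x - c‖]
        rw [inv_mul_le_iff₀ (by positivity), mul_one]
        exact h2.trans_eq (by ring)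
    · apply hle0
      rw [mem_ball_iff_norm, not_lt] at hxO
      have h1 : r ^ 2 ≤ ‖x - c‖ ^ 2 := by gcongr
      have h2 := mul_le_mul_of_nonneg_left (by linarith : t - t₁ ≤ T) hβ
      linarith

lemma map_pscale_volume {n : ℕ} (x₀ : Sp n) (t₀ : ℝ) {r : ℝ} (hr : 0 < r) :
    MeasureTheory.Measure.map (pscale x₀ t₀ r) MeasureTheory.volume =
      ENNReal.ofReal ((r ^ (n + 2))⁻¹) • MeasureTheory.volume := by
  have h1 : MeasureTheory.Measure.map (fun x : Sp n => x₀ + r • x) MeasureTheory.volume =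
      ENNReal.ofReal ((r ^ n)⁻¹) • MeasureTheory.volume := by
    have := MeasureTheory.Measure.map_map (μ := (MeasureTheory.volume : MeasureTheory.Measure (Sp n)))
      (measurable_const_add x₀) (measurable_const_smul r)
    rw [MeasureTheory.Measure.map_addHaar_smul _ hr.ne', MeasureTheory.Measure.map_smul,
      MeasureTheory.map_add_left_eq_self, finrank_euclideanSpace_fin,
      abs_of_pos (by positivity)] at this
    exact this.symm
  have h2 : MeasureTheory.Measure.map (fun t : ℝ => t₀ + r ^ 2 * t) MeasureTheory.volume =
      ENNReal.ofReal ((r ^ 2)⁻¹) • MeasureTheory.volume := by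
    have := MeasureTheory.Measure.map_map (μ := (MeasureTheory.volume : MeasureTheory.Measure ℝ))
      (measurable_const_add t₀) (measurable_const_smul (r ^ 2))
    rw [MeasureTheory.Measure.map_addHaar_smul _ (by positivity), MeasureTheory.Measure.map_smul,
      MeasureTheory.map_add_left_eq_self, Module.finrank_self, pow_one,
      abs_of_pos (by positivity)] at this
    exact this.symm
  have h3 := MeasureTheory.Measure.map_prod_map
    (MeasureTheory.volume : MeasureTheory.Measure (Sp n))
    (MeasureTheory.volume : MeasureTheory.Measure ℝ) (f := fun x : Sp n => x₀ + r • x)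
    (g := fun t : ℝ => t₀ + r ^ 2 * t) (by fun_prop) (by fun_prop)
  rw [h1, h2, MeasureTheory.Measure.prod_smul_left, MeasureTheory.Measure.prod_smul_right, smul_smul,
    ← ENNReal.ofReal_mul (by positivity), ← MeasureTheory.Measure.volume_eq_prod, ← mul_inv,
    ← pow_add] at h3
  exact h3.symm

lemma volume_preimage_pscale {n : ℕ} (x₀ : Sp n) (t₀ : ℝ) {r : ℝ} (hr : 0 < r)
    {S : Set (Sp n × ℝ)} (hS : MeasurableSet S) :
    MeasureTheory.volume (pscale x₀ t₀ r ⁻¹' S) =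
      ENNReal.ofReal ((r ^ (n + 2))⁻¹) * MeasureTheory.volume S := by
  rw [← MeasureTheory.Measure.map_apply (continuous_pscale x₀ t₀ r).measurable hS,
    map_pscale_volume x₀ t₀ hr]
  rfl

lemma pscale_one {n : ℕ} : pscale (0 : Sp n) 0 1 = id := by
  ext z <;> simp [pscale]

lemma SuperC.barrier_scaled {n : ℕ} {lam Lam G κ : ℝ} {D : Set (Sp n × ℝ)} {v : Sp n × ℝ → ℝ}
    (H : SuperC lam Lam G κ D v) (hlam : 0 < lam) (hLam : lam ≤ Lam) (hκ : 0 < κ) {c : Sp n}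
    {ρ β t₁ T r C B m : ℝ} (hm : 0 < m) (hρ : 0 < ρ) (hβ : 0 ≤ β)
    (hr : ρ ^ 2 + β * T = r ^ 2) (hr0 : 0 < r)
    (hB : B = 24 * lam + 6 * Lam * n + 3 * β) (hC0 : 0 ≤ C) (hC : B ^ 2 ≤ 96 * lam * ρ ^ 2 * C)
    (hG : m * (6 * r ^ 5 / ρ ^ 6) ≤ G)
    (hD : ∀ x ∈ Metric.closedBall c r, ∀ t, t₁ ≤ t → t ≤ t₁ + T → (x, t) ∈ D)
    (hv : ∀ x ∈ Metric.closedBall c r, ∀ t, t₁ ≤ t → t ≤ t₁ + T → 0 ≤ v (x, t))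
    (hv1 : ∀ x ∈ Metric.closedBall c ρ, m ≤ v (x, t₁)) :
    ∀ x ∈ Metric.closedBall c r, ∀ t, t₁ ≤ t → t ≤ t₁ + T →
      m * (Real.exp (-C * (t - t₁)) * max (ρ ^ 2 + β * (t - t₁) - ‖x - c‖ ^ 2) 0 ^ 3 / ρ ^ 6) -
        2 * κ * (t - t₁) ≤ v (x, t) := by
  have H' := H.rescale 0 0 hm one_pos
  simp only [pscale_one, id, one_pow, mul_one] at H'
  intro x hx t h1 h2
  have := H'.barrier hlam hLam (by positivity) hρ hβ hr hr0 hB hC0 hC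
    (by rw [le_div_iff₀ hm]; linarith) hD (fun x hx t h1 h2 => div_nonneg (hv x hx t h1 h2) hm.le)
    (fun x hx => by rw [one_le_div hm]; exact hv1 x hx) x hx t h1 h2
  rw [le_div_iff₀ hm] at this
  refine le_trans (le_of_eq ?_) this
  field_simp

lemma exists_one_shot_point {n : ℕ} {lam Lam : ℝ} (hlam : 0 < lam) (hLam : lam ≤ Lam) {H : ℝ}
    (hH : 0 ≤ H) : ∃ N ≥ 1, ∃ G > 0, ∃ κ > 0, κ ≤ 1 ∧ ∀ (v : Sp n × ℝ → ℝ) (p : Sp n × ℝ),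
      (∀ z ∈ Metric.closedBall (0 : Sp n) (2 * n + 5) ×ˢ Icc 0 p.2, 0 ≤ v z) →
      SuperC lam Lam G κ (Metric.closedBall (0 : Sp n) (2 * n + 5) ×ˢ Icc 0 p.2) v →
      ‖p.1‖ ≤ 2 * (n + 1) → 1 ≤ p.2 → p.2 ≤ 1 + H → v p ≤ 1 →
      ∃ x : Sp n, ‖x‖ ≤ 1 / 8 ∧ v (x, 1 / 2) ≤ N := by
  have hn : (0 : ℝ) ≤ n := n.cast_nonneg
  obtain ⟨R, hR⟩ : ∃ R : ℝ, R = 2 * n + 3 := ⟨_, rfl⟩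
  have hR0 : 3 ≤ R := by linarith
  obtain ⟨β, hβ⟩ : ∃ β : ℝ, β = 2 * (R ^ 2 + 1) := ⟨_, rfl⟩
  have hβ0 : 0 ≤ β := by rw [hβ]; positivity
  obtain ⟨r, hr⟩ : ∃ r : ℝ, r = Real.sqrt (1 / 64 + (R ^ 2 + 1)) := ⟨_, rfl⟩
  have hr2 : r ^ 2 = 1 / 64 + (R ^ 2 + 1) := by rw [hr, Real.sq_sqrt (by positivity)]
  have hr0 : 0 < r := by rw [hr]; positivity
  have hrR : r ≤ R + 1 := by
    apply le_of_sq_le_sq _ (by linarith)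
    rw [hr2]; nlinarith
  have hRr : R ≤ r := by
    apply le_of_sq_le_sq _ hr0.le
    rw [hr2]; linarith
  obtain ⟨B, hB⟩ : ∃ B : ℝ, B = 24 * lam + 6 * Lam * n + 3 * β := ⟨_, rfl⟩
  obtain ⟨C, hC⟩ : ∃ C : ℝ, C = B ^ 2 / (96 * lam * (1 / 8) ^ 2) := ⟨_, rfl⟩
  have hC0 : 0 ≤ C := by rw [hC]; positivity
  obtain ⟨B', hB'⟩ : ∃ B : ℝ, B = 24 * lam + 6 * Lam * n + 3 * 0 := ⟨_, rfl⟩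
  obtain ⟨C', hC'⟩ : ∃ C : ℝ, C = B' ^ 2 / (96 * lam * R ^ 2) := ⟨_, rfl⟩
  have hC'0 : 0 ≤ C' := by rw [hC']; positivity
  obtain ⟨m₁, hm₁⟩ : ∃ m : ℝ, m = Real.exp (-C * (1 / 2)) / 2 := ⟨_, rfl⟩
  obtain ⟨m₂, hm₂⟩ : ∃ m : ℝ, m = Real.exp (-C' * H) / (2 * R ^ 6) := ⟨_, rfl⟩
  have hm₁0 : 0 < m₁ := by rw [hm₁]; positivity
  have hm₂0 : 0 < m₂ := by rw [hm₂]; positivity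
  have hm₁1 : m₁ ≤ 1 := by
    have : Real.exp (-C * (1 / 2)) ≤ 1 := Real.exp_le_one_iff.2 (by nlinarith)
    rw [hm₁]; linarith
  have hm₂1 : m₂ ≤ 1 := by
    have h1 : Real.exp (-C' * H) ≤ 1 := Real.exp_le_one_iff.2 (by nlinarith)
    have h2 : (1 : ℝ) ≤ R ^ 6 := one_le_pow₀ (by linarith)
    rw [hm₂, div_le_one (by positivity)]; linarith
  obtain ⟨N, hN⟩ : ∃ N : ℝ, N = 2 / (m₁ * m₂) := ⟨_, rfl⟩
  have hN0 : 0 < N := by rw [hN]; positivity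
  have hNm : N * m₁ * m₂ = 2 := by rw [hN]; field_simp
  have hNm1 : 1 ≤ N * m₁ := by
    have : N * m₁ * m₂ ≤ N * m₁ * 1 := mul_le_mul_of_nonneg_left hm₂1 (by positivity)
    linarith
  have hN1 : 1 ≤ N := by
    have : N * m₁ ≤ N * 1 := mul_le_mul_of_nonneg_left hm₁1 (by positivity)
    linarith
  have hκ1 : 1 / (H + 1) ≤ 1 := by rw [div_le_one (by linarith)]; linarith
  refine ⟨N, hN1, N * (6 * r ^ 5 / (1 / 8) ^ 6) + N * m₁ * (6 * R ^ 5 / R ^ 6), by positivity,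
    1 / (H + 1), by positivity, hκ1, ?_⟩
  intro v p hv hS hp1 hp2 hp3 hvp
  by_contra hcon
  push Not at hcon
  have hA := hS.barrier_scaled hlam hLam (by positivity) (c := 0) (ρ := 1 / 8) (β := β) (t₁ := 1 / 2)
    (T := 1 / 2) (r := r) (m := N) hN0 (by norm_num) hβ0 (by rw [hr2, hβ]; ring) hr0 hB hC0
    (by rw [hC]; field_simp; rfl)
    (by have : 0 ≤ N * m₁ * (6 * R ^ 5 / R ^ 6) := by positivity
        linarith)
    (fun x hx t h1 h2 => ⟨Metric.closedBall_subset_closedBall (by linarith) hx, by linarith,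
      by linarith⟩)
    (fun x hx t h1 h2 => hv _ ⟨Metric.closedBall_subset_closedBall (by linarith) hx, by linarith,
      by linarith⟩)
    (fun x hx => (hcon x (mem_closedBall_zero_iff.1 hx)).le)
  have hA1 : ∀ x ∈ Metric.closedBall (0 : Sp n) R, N * m₁ ≤ v (x, 1) := by
    intro x hx
    have h := hA x (Metric.closedBall_subset_closedBall hRr hx) 1 (by norm_num) (by norm_num)
    have hx2 : ‖x‖ ^ 2 ≤ R ^ 2 :=
      pow_le_pow_left₀ (norm_nonneg _) (mem_closedBall_zero_iff.1 hx) 2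
    have h1 : 1 ≤ max ((1 / 8 : ℝ) ^ 2 + β * (1 - 1 / 2) - ‖x - 0‖ ^ 2) 0 ^ 3 / (1 / 8) ^ 6 := by
      have : (1 : ℝ) ≤ max ((1 / 8 : ℝ) ^ 2 + β * (1 - 1 / 2) - ‖x - 0‖ ^ 2) 0 := by
        rw [sub_zero]
        refine le_max_of_le_left ?_
        rw [hβ]; linarith
      have := one_le_pow₀ this (n := 3)
      rw [le_div_iff₀ (by norm_num)]
      refine le_trans (by norm_num) this
    have h2 : Real.exp (-C * (1 - 1 / 2)) = 2 * m₁ := by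
      rw [hm₁, show (1 : ℝ) - 1 / 2 = 1 / 2 by norm_num]; ring
    rw [mul_div_assoc, h2] at h
    have h3 : N * (2 * m₁) * 1 ≤ N * (2 * m₁) * (max ((1 / 8 : ℝ) ^ 2 + β * (1 - 1 / 2) -
        ‖x - 0‖ ^ 2) 0 ^ 3 / (1 / 8) ^ 6) := mul_le_mul_of_nonneg_left h1 (by positivity)
    linarith
  have hB := hS.barrier_scaled hlam hLam (by positivity) (c := 0) (ρ := R) (β := 0) (t₁ := 1)
    (T := p.2 - 1) (r := R) (m := N * m₁) (by positivity) (by linarith) le_rfl (by ring)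
    (by linarith) hB' hC'0
    (by rw [hC']; field_simp; rfl)
    (by have : 0 ≤ N * (6 * r ^ 5 / (1 / 8) ^ 6) := by positivity
        linarith)
    (fun x hx t h1 h2 => ⟨Metric.closedBall_subset_closedBall (by linarith) hx, by linarith,
      by linarith⟩)
    (fun x hx t h1 h2 => hv _ ⟨Metric.closedBall_subset_closedBall (by linarith) hx, by linarith,
      by linarith⟩) hA1 p.1 (mem_closedBall_zero_iff.2 (by linarith)) p.2 hp2 (by linarith)
  have hx2 : ‖p.1‖ ^ 2 ≤ (R - 1) ^ 2 := pow_le_pow_left₀ (norm_nonneg _) (by linarith) 2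
  have h1 : 1 ≤ max (R ^ 2 + 0 * (p.2 - 1) - ‖p.1 - 0‖ ^ 2) 0 ^ 3 := by
    refine one_le_pow₀ (le_max_of_le_left ?_)
    have h3 : (R - 1) ^ 2 = R ^ 2 - 2 * R + 1 := by ring
    rw [sub_zero]; linarith
  have h2 : 2 * m₂ ≤ Real.exp (-C' * (p.2 - 1)) * max (R ^ 2 + 0 * (p.2 - 1) - ‖p.1 - 0‖ ^ 2) 0 ^ 3 /
      R ^ 6 := by
    have h3 : Real.exp (-C' * H) ≤ Real.exp (-C' * (p.2 - 1)) := by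
      have h5 : C' * (p.2 - 1) ≤ C' * H := mul_le_mul_of_nonneg_left (by linarith) hC'0
      exact Real.exp_le_exp.2 (by linarith)
    have h4 : Real.exp (-C' * H) * 1 ≤ Real.exp (-C' * (p.2 - 1)) *
        max (R ^ 2 + 0 * (p.2 - 1) - ‖p.1 - 0‖ ^ 2) 0 ^ 3 :=
      mul_le_mul h3 h1 (by norm_num) (by positivity)
    rw [hm₂]
    calc 2 * (Real.exp (-C' * H) / (2 * R ^ 6)) = Real.exp (-C' * H) * 1 / R ^ 6 := by
          field_simp
      _ ≤ _ := by gcongr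
  have h5 := mul_le_mul_of_nonneg_left h2 (show 0 ≤ N * m₁ by positivity)
  have h6 : 1 / (H + 1) * (p.2 - 1) ≤ 1 := by
    rw [div_mul_eq_mul_div, div_le_one (by linarith)]; linarith
  change _ ≤ v p at hB
  linarith

/-- If `v` is small at a later point then it is small on a definite fraction of an earlier
cylinder. -/
lemma exists_one_shot (n : ℕ) {lam Lam : ℝ} (hlam : 0 < lam) (hLam : lam ≤ Lam) :
    ∃ δ > 0, ∀ H : ℝ, 0 ≤ H → ∃ N > 1, ∃ G > 0, ∃ κ > 0, ∀ (v : Sp n × ℝ → ℝ) (p : Sp n × ℝ),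
      ContinuousOn v (Metric.closedBall (0 : Sp n) (2 * n + 5) ×ˢ Icc 0 p.2) →
      (∀ z ∈ Metric.closedBall (0 : Sp n) (2 * n + 5) ×ˢ Icc 0 p.2, 0 ≤ v z) →
      SuperC lam Lam G κ (Metric.closedBall (0 : Sp n) (2 * n + 5) ×ˢ Icc 0 p.2) v →
      ‖p.1‖ ≤ 2 * (n + 1) → 1 ≤ p.2 → p.2 ≤ 1 + H → v p ≤ 1 →
      ENNReal.ofReal δ ≤ MeasureTheory.volume
        {z : Sp n × ℝ | ‖z.1‖ ≤ 3 / 8 ∧ 7 / 16 ≤ z.2 ∧ z.2 ≤ 1 / 2 ∧ v z ≤ N} := by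
  obtain ⟨G₁, hG₁, μ, hμ, hSL⟩ := exists_sliding n hlam hLam
  refine ⟨(1 / 4) ^ (n + 2) * μ, by positivity, fun H hH => ?_⟩
  obtain ⟨N, hN, G, hG, κ, hκ, hκ1, hP⟩ := exists_one_shot_point (n := n) hlam hLam hH
  refine ⟨3 * N, by linarith, G + 4 * N * G₁, by positivity, κ, hκ, ?_⟩
  intro v p hvc hv hS hp1 hp2 hp3 hvp
  have hn : (0 : ℝ) ≤ n := n.cast_nonneg
  have hGN : 0 < 4 * N * G₁ := by positivity
  obtain ⟨x, hx, hxN⟩ := hP v p hv (hS.mono (by linarith) le_rfl le_rfl) hp1 hp2 hp3 hvp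
  have hmaps : ∀ z ∈ unitCyl n, ‖(pscale x (1 / 2) (1 / 4) z).1‖ ≤ 3 / 8 ∧
      7 / 16 ≤ (pscale x (1 / 2) (1 / 4) z).2 ∧ (pscale x (1 / 2) (1 / 4) z).2 ≤ 1 / 2 := by
    rintro z ⟨h1, h2, h3⟩
    refine ⟨?_, ?_, ?_⟩
    · refine (norm_add_le _ _).trans ?_
      rw [norm_smul, Real.norm_of_nonneg (by norm_num)]
      have := mem_closedBall_zero_iff.1 h1
      linarith
    · simp only [pscale]; linarith
    · simp only [pscale]; linarith
  have hsub : {z : Sp n × ℝ | ‖z.1‖ ≤ 3 / 8 ∧ 7 / 16 ≤ z.2 ∧ z.2 ≤ 1 / 2} ⊆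
      Metric.closedBall (0 : Sp n) (2 * n + 5) ×ˢ Icc 0 p.2 := by
    rintro z ⟨h1, h2, h3⟩
    exact ⟨mem_closedBall_zero_iff.2 (by linarith), by linarith, by linarith⟩
  have h := hSL (fun z => v (pscale x (1 / 2) (1 / 4) z) / N)
    (((hvc.comp (continuous_pscale _ _ _).continuousOn
      (fun z hz => hsub (hmaps z hz)))).div_const N)
    (fun z hz => div_nonneg (hv _ (hsub (hmaps z hz))) (by linarith))
    ((hS.rescale x (1 / 2) (m := N) (r := 1 / 4) (by linarith) (by norm_num)).mono
      (by rw [le_div_iff₀ (by linarith)]; linarith)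
      (by rw [div_le_one (by linarith)]; linarith) (fun z hz => hsub (hmaps z hz)))
    (by rw [div_le_one (by linarith)]
        simpa [pscale] using hxN)
  obtain ⟨S, hSdef⟩ : ∃ S : Set (Sp n × ℝ), S =
    {z | ‖z.1‖ ≤ 3 / 8 ∧ 7 / 16 ≤ z.2 ∧ z.2 ≤ 1 / 2 ∧ v z ≤ 3 * N} := ⟨_, rfl⟩
  have hScl : IsClosed S := by
    have hc : IsClosed {z : Sp n × ℝ | ‖z.1‖ ≤ 3 / 8 ∧ 7 / 16 ≤ z.2 ∧ z.2 ≤ 1 / 2} := by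
      have h1 : Continuous fun z : Sp n × ℝ => ‖z.1‖ := by fun_prop
      exact (isClosed_le h1 continuous_const).inter
        ((isClosed_le continuous_const continuous_snd).inter
          (isClosed_le continuous_snd continuous_const))
    have := (hvc.mono hsub).preimage_isClosed_of_isClosed hc (isClosed_Iic (a := 3 * N))
    convert this using 1
    rw [hSdef]; ext z
    simp only [mem_inter_iff, mem_preimage, mem_Iic, mem_ofPred_eq]
    tauto
  rw [← hSdef]
  have hle : MeasureTheory.volume {z | z ∈ unitCyl n ∧ v (pscale x (1 / 2) (1 / 4) z) / N ≤ 3} ≤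
      MeasureTheory.volume (pscale x (1 / 2) (1 / 4) ⁻¹' S) := by
    apply MeasureTheory.measure_mono
    rintro z ⟨hz, hz2⟩
    rw [mem_preimage, hSdef]
    obtain ⟨h1, h2, h3⟩ := hmaps z hz
    rw [div_le_iff₀ (by linarith)] at hz2
    exact ⟨h1, h2, h3, hz2⟩
  rw [volume_preimage_pscale x _ (by norm_num) hScl.measurableSet] at hle
  have h2 := mul_le_mul_right (h.trans hle) (ENNReal.ofReal ((1 / 4) ^ (n + 2)))
  rw [← mul_assoc, ← ENNReal.ofReal_mul (by positivity), ← ENNReal.ofReal_mul (by positivity),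
    mul_inv_cancel₀ (by positivity), ENNReal.ofReal_one, one_mul] at h2
  exact h2

lemma volume_preimage_pscale_le {n : ℕ} (x₀ : Sp n) (t₀ : ℝ) {r : ℝ} (hr : 0 < r)
    (S : Set (Sp n × ℝ)) :
    MeasureTheory.volume (pscale x₀ t₀ r ⁻¹' S) ≤
      ENNReal.ofReal ((r ^ (n + 2))⁻¹) * MeasureTheory.volume S := by
  rw [← MeasureTheory.measure_toMeasurable S,
    ← volume_preimage_pscale x₀ t₀ hr (MeasureTheory.measurableSet_toMeasurable _ _)]
  exact MeasureTheory.measure_mono (preimage_mono (MeasureTheory.subset_toMeasurable _ _))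

/-- Finite one-dimensional covering: intervals are controlled by the stacks lying to their right. -/
lemma volume_biUnion_Ico_le_stack {ι : Type*} (s : Finset ι) (a h : ι → ℝ) (hh : ∀ j, 0 < h j)
    (m : ℕ) : ∀ (k : ℕ) (σ : ℝ), (s.filter fun j => σ < a j + (m + 1) * h j).card ≤ k →
      (m : ENNReal) * MeasureTheory.volume ((⋃ j ∈ s, Ico (a j) (a j + h j)) ∩ Ici σ) ≤
        (m + 1) * MeasureTheory.volume
          ((⋃ j ∈ s, Ico (a j + h j) (a j + (m + 1) * h j)) ∩ Ici σ) := by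
  intro k
  induction k with
  | zero =>
    intro σ hσ
    have : (⋃ j ∈ s, Ico (a j) (a j + h j)) ∩ Ici σ = ∅ := by
      rw [eq_empty_iff_forall_notMem]
      rintro t ⟨ht, htσ⟩
      obtain ⟨j, hj, ht1, ht2⟩ := mem_iUnion₂.1 ht
      have h1 : j ∈ s.filter fun j => σ < a j + (m + 1) * h j := by
        rw [Finset.mem_filter]
        have : 0 ≤ (m : ℝ) * h j := mul_nonneg m.cast_nonneg (hh j).le
        have htσ' : σ ≤ t := htσ
        exact ⟨hj, by linarith⟩
      rw [Finset.card_eq_zero.1 (Nat.le_zero.1 hσ)] at h1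
      exact absurd h1 (Finset.notMem_empty _)
    rw [this]; simp
  | succ k ih =>
    intro σ hσ
    by_cases hne : (s.filter fun j => σ < a j + h j).Nonempty
    · obtain ⟨j, hj, hmin⟩ := Finset.exists_min_image _ (fun j => max (a j) σ) hne
      rw [Finset.mem_filter] at hj
      have hmh : 0 ≤ (m : ℝ) * h j := mul_nonneg m.cast_nonneg (hh j).le
      obtain ⟨τ, hτ⟩ : ∃ τ, τ = a j + (m + 1) * h j := ⟨_, rfl⟩
      have hστ : σ < τ := by rw [hτ]; linarith [hj.2]
      have hcard : (s.filter fun l => τ < a l + (m + 1) * h l).card ≤ k := by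
        have : (s.filter fun l => τ < a l + (m + 1) * h l) ⊂
            (s.filter fun l => σ < a l + (m + 1) * h l) := by
          rw [Finset.ssubset_iff_of_subset
            (Finset.monotone_filter_right _ fun l _ hl => hστ.trans hl)]
          refine ⟨j, ?_, ?_⟩
          · rw [Finset.mem_filter]; exact ⟨hj.1, hτ ▸ hστ⟩
          · rw [Finset.mem_filter]; rintro ⟨-, h2⟩; exact absurd h2 (by rw [hτ]; exact lt_irrefl _)
        have := Finset.card_lt_card this
        omega
      have hI := ih τ hcard
      have hsub : (⋃ l ∈ s, Ico (a l) (a l + h l)) ∩ Ici σ ⊆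
          Ico (max (a j) σ) τ ∪ ((⋃ l ∈ s, Ico (a l) (a l + h l)) ∩ Ici τ) := by
        rintro t ⟨ht, htσ⟩
        by_cases htτ : τ ≤ t
        · exact Or.inr ⟨ht, htτ⟩
        · left
          obtain ⟨l, hl, ht1, ht2⟩ := mem_iUnion₂.1 ht
          have htσ' : σ ≤ t := htσ
          refine ⟨(hmin l ?_).trans (max_le ht1 htσ'), not_le.1 htτ⟩
          rw [Finset.mem_filter]; exact ⟨hl, by linarith⟩
      have hsup : Ico (a j + h j) τ ∪
          ((⋃ l ∈ s, Ico (a l + h l) (a l + (m + 1) * h l)) ∩ Ici τ) ⊆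
          (⋃ l ∈ s, Ico (a l + h l) (a l + (m + 1) * h l)) ∩ Ici σ := by
        rintro t (⟨h1, h2⟩ | ⟨h1, h2⟩)
        · exact ⟨mem_iUnion₂.2 ⟨j, hj.1, h1, hτ ▸ h2⟩, show σ ≤ t by linarith [hj.2]⟩
        · exact ⟨h1, show σ ≤ t from hστ.le.trans h2⟩
      have hmeas : MeasurableSet ((⋃ l ∈ s, Ico (a l + h l) (a l + (m + 1) * h l)) ∩ Ici τ) :=
        (Finset.measurableSet_biUnion _ fun _ _ => measurableSet_Ico).inter measurableSet_Ici
      have hdisj : Disjoint (Ico (a j + h j) τ)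
          ((⋃ l ∈ s, Ico (a l + h l) (a l + (m + 1) * h l)) ∩ Ici τ) := by
        rw [Set.disjoint_left]
        rintro t ⟨_, h1⟩ ⟨_, h2⟩
        exact absurd h1 (not_lt.2 h2)
      calc (m : ENNReal) * MeasureTheory.volume ((⋃ l ∈ s, Ico (a l) (a l + h l)) ∩ Ici σ)
          ≤ m * (MeasureTheory.volume (Ico (max (a j) σ) τ) +
              MeasureTheory.volume ((⋃ l ∈ s, Ico (a l) (a l + h l)) ∩ Ici τ)) := by
            gcongr
            exact (MeasureTheory.measure_mono hsub).trans (MeasureTheory.measure_union_le _ _)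
        _ ≤ (m + 1) * (MeasureTheory.volume (Ico (a j + h j) τ) + MeasureTheory.volume
              ((⋃ l ∈ s, Ico (a l + h l) (a l + (m + 1) * h l)) ∩ Ici τ)) := by
            rw [mul_add, mul_add]
            refine add_le_add ?_ hI
            rw [Real.volume_Ico, Real.volume_Ico, ← ENNReal.ofReal_natCast,
              ← ENNReal.ofReal_one, ← ENNReal.ofReal_add m.cast_nonneg zero_le_one,
              ← ENNReal.ofReal_mul m.cast_nonneg, ← ENNReal.ofReal_mul (by positivity)]
            apply ENNReal.ofReal_le_ofReal
            have h1 : τ - max (a j) σ ≤ (m + 1) * h j := by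
              have := le_max_left (a j) σ
              rw [hτ]; linarith
            calc (m : ℝ) * (τ - max (a j) σ) ≤ m * ((m + 1) * h j) := by gcongr
              _ = (m + 1) * (τ - (a j + h j)) := by rw [hτ]; ring
        _ ≤ _ := by
            gcongr
            rw [← MeasureTheory.measure_union hdisj hmeas]
            exact MeasureTheory.measure_mono hsup
    · have : (⋃ j ∈ s, Ico (a j) (a j + h j)) ∩ Ici σ = ∅ := by
        rw [eq_empty_iff_forall_notMem]
        rintro t ⟨ht, htσ⟩
        obtain ⟨j, hj, ht1, ht2⟩ := mem_iUnion₂.1 ht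
        have htσ' : σ ≤ t := htσ
        exact hne ⟨j, Finset.mem_filter.2 ⟨hj, by linarith⟩⟩
      rw [this]; simp

lemma volume_iUnion_Ico_le_stack {ι : Type*} [Countable ι] (a h : ι → ℝ) (hh : ∀ j, 0 < h j)
    (m : ℕ) (A : Set ι) :
    (m : ENNReal) * MeasureTheory.volume (⋃ j ∈ A, Ico (a j) (a j + h j)) ≤
        (m + 1) * MeasureTheory.volume (⋃ j ∈ A, Ico (a j + h j) (a j + (m + 1) * h j)) := by
  have hfin : ∀ s : Finset A,
      (m : ENNReal) * MeasureTheory.volume (⋃ j ∈ s, Ico (a j) (a j + h j)) ≤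
        (m + 1) * MeasureTheory.volume (⋃ j ∈ A, Ico (a j + h j) (a j + (m + 1) * h j)) := by
    intro s
    rcases s.eq_empty_or_nonempty with rfl | hs
    · simp
    obtain ⟨l, hl, hmin⟩ := s.exists_min_image (fun j => a j) hs
    have key := volume_biUnion_Ico_le_stack s (fun j => a j) (fun j => h j) (fun j => hh j) m _
      (a l) le_rfl
    have h1 : (⋃ j ∈ s, Ico (a j) (a j + h j)) ∩ Ici (a l) = ⋃ j ∈ s, Ico (a j) (a j + h j) := by
      rw [inter_eq_left]
      intro t ht
      obtain ⟨j, hj, ht1, ht2⟩ := mem_iUnion₂.1 ht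
      exact (hmin j hj).trans ht1
    rw [h1] at key
    refine key.trans ?_
    gcongr
    rintro t ⟨ht, -⟩
    obtain ⟨j, hj, ht⟩ := mem_iUnion₂.1 ht
    exact mem_iUnion₂.2 ⟨j, j.2, ht⟩
  have h2 : (⋃ j ∈ A, Ico (a j) (a j + h j)) =
      ⋃ s : Finset A, ⋃ j ∈ s, Ico (a j) (a j + h j) := by
    rw [biUnion_eq_iUnion, iUnion_eq_iUnion_finset]
  have hdir : Directed (· ⊆ ·) fun s : Finset A => ⋃ j ∈ s, Ico (a j) (a j + h j) :=
    Monotone.directed_le fun s t hst => biUnion_subset_biUnion_left hst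
  rw [h2, hdir.measure_iUnion, ENNReal.mul_iSup]
  exact iSup_le hfin

lemma volume_iUnion_box_le_stack {n : ℕ} {ι : Type*} [Countable ι] (S : ι → Set (Sp n))
    (hS : ∀ j, MeasurableSet (S j)) (a h : ι → ℝ) (hh : ∀ j, 0 < h j) (m : ℕ) (A : Set ι) :
    (m : ENNReal) * MeasureTheory.volume (⋃ j ∈ A, S j ×ˢ Ico (a j) (a j + h j)) ≤
      (m + 1) * MeasureTheory.volume
        (⋃ j ∈ A, S j ×ˢ Ico (a j + h j) (a j + (m + 1) * h j)) := by
  have hm1 : MeasurableSet (⋃ j ∈ A, S j ×ˢ Ico (a j) (a j + h j)) :=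
    MeasurableSet.biUnion (to_countable A) fun j _ => (hS j).prod measurableSet_Ico
  have hm2 : MeasurableSet (⋃ j ∈ A, S j ×ˢ Ico (a j + h j) (a j + (m + 1) * h j)) :=
    MeasurableSet.biUnion (to_countable A) fun j _ => (hS j).prod measurableSet_Ico
  have hsec : ∀ (l r : ι → ℝ) (x : Sp n), Prod.mk x ⁻¹' (⋃ j ∈ A, S j ×ˢ Ico (l j) (r j)) =
      ⋃ j ∈ {j | j ∈ A ∧ x ∈ S j}, Ico (l j) (r j) := by
    intro l r x
    ext t
    simp only [mem_preimage, mem_iUnion, mem_prod, mem_ofPred_eq, exists_prop]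
    constructor
    · rintro ⟨j, h1, h2, h3⟩; exact ⟨j, ⟨h1, h2⟩, h3⟩
    · rintro ⟨j, ⟨h1, h2⟩, h3⟩; exact ⟨j, h1, h2, h3⟩
  rw [MeasureTheory.Measure.volume_eq_prod, MeasureTheory.Measure.prod_apply hm1,
    MeasureTheory.Measure.prod_apply hm2,
    ← MeasureTheory.lintegral_const_mul _ (measurable_measure_prodMk_left hm1),
    ← MeasureTheory.lintegral_const_mul _ (measurable_measure_prodMk_left hm2)]
  refine MeasureTheory.lintegral_mono fun x => ?_
  rw [hsec, hsec]
  exact volume_iUnion_Ico_le_stack a h hh m _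

/-- The property provided by `exists_one_shot`, for given constants. -/
def OneShot (n : ℕ) (lam Lam δ H N G κ : ℝ) : Prop :=
  ∀ (v : Sp n × ℝ → ℝ) (p : Sp n × ℝ),
    ContinuousOn v (Metric.closedBall (0 : Sp n) (2 * n + 5) ×ˢ Icc 0 p.2) →
    (∀ z ∈ Metric.closedBall (0 : Sp n) (2 * n + 5) ×ˢ Icc 0 p.2, 0 ≤ v z) →
    SuperC lam Lam G κ (Metric.closedBall (0 : Sp n) (2 * n + 5) ×ˢ Icc 0 p.2) v →
    ‖p.1‖ ≤ 2 * (n + 1) → 1 ≤ p.2 → p.2 ≤ 1 + H → v p ≤ 1 →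
    ENNReal.ofReal δ ≤ MeasureTheory.volume
      {z : Sp n × ℝ | ‖z.1‖ ≤ 3 / 8 ∧ 7 / 16 ≤ z.2 ∧ z.2 ≤ 1 / 2 ∧ v z ≤ N}

/-- The centre of the unit cube. -/
noncomputable def cubeCenter (n : ℕ) : Sp n := WithLp.toLp 2 fun _ => 1 / 2

/-- The spatial unit cube. -/
def unitCube (n : ℕ) : Set (Sp n) := {x | ∀ j, x j ∈ Ico (0 : ℝ) 1}

/-- The normalized space-time domain. -/
def dom (n : ℕ) (T : ℝ) : Set (Sp n × ℝ) :=
  Metric.closedBall (cubeCenter n) (3 * n + 6) ×ˢ Icc 0 T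

/-- The spatial centre of the grid cell of `x`. -/
noncomputable def cellCenter {n : ℕ} (a : ℝ) (x : Sp n) : Sp n :=
  WithLp.toLp 2 fun j => (⌊a * x j⌋ + 1 / 2) / a

lemma floor_cellCenter {n : ℕ} {a : ℝ} (ha : 0 < a) (x : Sp n) (j : Fin n) :
    ⌊a * cellCenter a x j⌋ = ⌊a * x j⌋ := by
  have : a * cellCenter a x j = ⌊a * x j⌋ + 1 / 2 := by
    simp only [cellCenter]; field_simp
  rw [this, Int.floor_intCast_add]
  norm_num

lemma mem_ball_of_mem_unitCube {n : ℕ} {x : Sp n} (hx : x ∈ unitCube n) :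
    ‖x - cubeCenter n‖ ≤ (n + 1) / 2 := by
  have := norm_le_of_abs_coord_le (x := x - cubeCenter n) (r := 1 / 2) (by norm_num) fun j => by
    have h : (x - cubeCenter n) j = x j - 1 / 2 := rfl
    rw [h, abs_le]
    have := hx j
    constructor <;> linarith [this.1, this.2]
  linarith

lemma OneShot.cell {n : ℕ} {lam Lam δ H N G κ : ℝ} (hOS : OneShot n lam Lam δ H N G κ)
    {T : ℝ} {v : Sp n × ℝ → ℝ} (hvc : ContinuousOn v (dom n T))
    (hv : ∀ z ∈ dom n T, 0 ≤ v z) {a L : ℝ} (ha : 1 ≤ a) (hL : 0 < L)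
    (hS : SuperC lam Lam (G * L * a) (κ * L * a ^ 2) (dom n T) v) {z q : Sp n × ℝ}
    (hz : z.1 ∈ unitCube n) (hz2 : 0 ≤ z.2) (hq1 : ‖q.1 - cellCenter a z.1‖ ≤ 2 * (n + 1) / a)
    (hq2 : ⌊a ^ 2 * z.2⌋ + 1 ≤ a ^ 2 * q.2) (hq3 : a ^ 2 * q.2 ≤ ⌊a ^ 2 * z.2⌋ + 1 + H)
    (hqT : q.2 ≤ T) (hvq : v q ≤ L) :
    ENNReal.ofReal δ * MeasureTheory.volume (cell a (key a z)) ≤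
      MeasureTheory.volume {w | w ∈ cell a (key a z) ∧ v w ≤ N * L} := by
  have ha0 : 0 < a := by linarith
  have hn : (0 : ℝ) ≤ n := n.cast_nonneg
  obtain ⟨b, hb⟩ : ∃ b : ℝ, b = ⌊a ^ 2 * z.2⌋ / a ^ 2 := ⟨_, rfl⟩
  have hba : a ^ 2 * b = ⌊a ^ 2 * z.2⌋ := by rw [hb]; field_simp
  have hb0 : 0 ≤ b := by
    rw [hb]
    have : 0 ≤ ⌊a ^ 2 * z.2⌋ := Int.floor_nonneg.2 (by positivity)
    have : (0 : ℝ) ≤ ⌊a ^ 2 * z.2⌋ := by exact_mod_cast this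
    positivity
  obtain ⟨c, hc⟩ : ∃ c : Sp n, c = cellCenter a z.1 := ⟨_, rfl⟩
  rw [← hc] at hq1
  have hcx : ‖c - cubeCenter n‖ ≤ n + 1 := by
    have hcube : ∀ j, |(c - cubeCenter n) j| ≤ 1 := by
      intro j
      have h3 : (c - cubeCenter n) j = c j - 1 / 2 := rfl
      have h4 := hz j
      have h5 : c j = (⌊a * z.1 j⌋ + 1 / 2) / a := by rw [hc]; rfl
      have h6 : (0 : ℝ) ≤ ⌊a * z.1 j⌋ := by
        exact_mod_cast Int.floor_nonneg.2 (mul_nonneg ha0.le h4.1)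
      have h7 : (⌊a * z.1 j⌋ : ℝ) ≤ a * z.1 j := Int.floor_le _
      rw [h3, abs_le]
      constructor
      · have : 0 ≤ c j := by rw [h5]; positivity
        linarith
      · have : c j ≤ z.1 j + 1 / 2 := by
          rw [h5, div_le_iff₀ ha0]; nlinarith
        linarith [h4.2]
    have := norm_le_of_abs_coord_le zero_le_one hcube
    linarith
  have hp : pscale c b a⁻¹ (a • (q.1 - c), a ^ 2 * (q.2 - b)) = q := by
    ext1
    · simp [pscale, smul_smul, ha0.ne']
    · simp only [pscale]; field_simp; ring
  have hmaps : ∀ w ∈ Metric.closedBall (0 : Sp n) (2 * n + 5) ×ˢ Icc 0 (a ^ 2 * (q.2 - b)),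
      pscale c b a⁻¹ w ∈ dom n T := by
    rintro w ⟨h1, h2, h3⟩
    have hinv : a⁻¹ ≤ 1 := inv_le_one_of_one_le₀ ha
    refine ⟨mem_closedBall_iff_norm.2 ?_, ?_, ?_⟩
    · have h4 : (pscale c b a⁻¹ w).1 - cubeCenter n = (c - cubeCenter n) + a⁻¹ • w.1 := by
        simp only [pscale]; abel
      rw [h4]
      refine (norm_add_le _ _).trans ?_
      rw [norm_smul, Real.norm_of_nonneg (by positivity)]
      have h5 : a⁻¹ * ‖w.1‖ ≤ 1 * (2 * n + 5) :=
        mul_le_mul hinv (mem_closedBall_zero_iff.1 h1) (norm_nonneg _) zero_le_one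
      linarith
    · simp only [pscale]; positivity
    · have h4 : a⁻¹ ^ 2 * w.2 ≤ a⁻¹ ^ 2 * (a ^ 2 * (q.2 - b)) := by gcongr
      have h5 : a⁻¹ ^ 2 * (a ^ 2 * (q.2 - b)) = q.2 - b := by field_simp
      simp only [pscale]; linarith
  have h := hOS (fun w => v (pscale c b a⁻¹ w) / L) (a • (q.1 - c), a ^ 2 * (q.2 - b))
    ((hvc.comp (continuous_pscale _ _ _).continuousOn hmaps).div_const L)
    (fun w hw => div_nonneg (hv _ (hmaps w hw)) hL.le)
    ((hS.rescale c b (m := L) (r := a⁻¹) hL (by positivity)).mono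
      (by rw [le_div_iff₀ hL]; apply le_of_eq; field_simp)
      (by rw [div_le_iff₀ hL]; apply le_of_eq; field_simp) hmaps)
    (by
      simp only
      rw [norm_smul, Real.norm_of_nonneg ha0.le]
      rw [le_div_iff₀ ha0] at hq1; linarith)
    (by simp only; rw [mul_sub, hba]; linarith)
    (by simp only; rw [mul_sub, hba]; linarith)
    (by rw [hp, div_le_one hL]; exact hvq)
  have hle : MeasureTheory.volume {w : Sp n × ℝ | ‖w.1‖ ≤ 3 / 8 ∧ 7 / 16 ≤ w.2 ∧ w.2 ≤ 1 / 2 ∧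
      v (pscale c b a⁻¹ w) / L ≤ N} ≤ MeasureTheory.volume (pscale c b a⁻¹ ⁻¹'
        {w | w ∈ _root_.cell a (key a z) ∧ v w ≤ N * L}) := by
    apply MeasureTheory.measure_mono
    rintro w ⟨h1, h2, h3, h4⟩
    refine ⟨?_, by rwa [div_le_iff₀ hL] at h4⟩
    have h5 : ∀ j, ⌊a * (pscale c b a⁻¹ w).1 j⌋ = ⌊a * z.1 j⌋ := by
      intro j
      have e : a * (pscale c b a⁻¹ w).1 j = ⌊a * z.1 j⌋ + (1 / 2 + w.1 j) := by
        have e1 : (pscale c b a⁻¹ w).1 j = c j + a⁻¹ * w.1 j := rfl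
        rw [e1, hc]; simp only [cellCenter]; field_simp; ring
      rw [e, Int.floor_intCast_add]
      have e2 := (PiLp.norm_apply_le w.1 j).trans h1
      rw [Real.norm_eq_abs, abs_le] at e2
      have : ⌊1 / 2 + w.1 j⌋ = 0 := by
        rw [Int.floor_eq_zero_iff]; constructor <;> linarith [e2.1, e2.2]
      rw [this, add_zero]
    have h6 : ⌊a ^ 2 * (pscale c b a⁻¹ w).2⌋ = ⌊a ^ 2 * z.2⌋ := by
      have e : a ^ 2 * (pscale c b a⁻¹ w).2 = ⌊a ^ 2 * z.2⌋ + w.2 := by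
        have e1 : (pscale c b a⁻¹ w).2 = b + a⁻¹ ^ 2 * w.2 := rfl
        rw [e1, mul_add, hba]; field_simp
      rw [e, Int.floor_intCast_add]
      have : ⌊w.2⌋ = 0 := by
        rw [Int.floor_eq_zero_iff]; constructor <;> linarith
      rw [this, add_zero]
    exact Prod.ext (funext h5) h6
  have h2 := (h.trans hle).trans (volume_preimage_pscale_le c b (by positivity) _)
  have h3 := mul_le_mul_right h2 (ENNReal.ofReal ((a ^ (n + 2))⁻¹))
  rw [← mul_assoc, ← ENNReal.ofReal_mul (by positivity), inv_pow, inv_inv,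
    ← ENNReal.ofReal_mul (by positivity), inv_mul_cancel₀ (by positivity), ENNReal.ofReal_one,
    one_mul] at h3
  rw [volume_cell ha0, mul_comm, ← ENNReal.ofReal_mul (by positivity)]
  exact h3

lemma floor_two_pow_succ (i : ℕ) (x : ℝ) : ⌊(2 : ℝ) ^ i * x⌋ = ⌊(2 : ℝ) ^ (i + 1) * x⌋ / 2 := by
  have h := Int.floor_div_natCast ((2 : ℝ) ^ (i + 1) * x) 2
  push_cast at h
  rw [← h]
  congr 1; ring

lemma floor_four_pow_succ (i : ℕ) (x : ℝ) :
    ⌊((2 : ℝ) ^ i) ^ 2 * x⌋ = ⌊((2 : ℝ) ^ (i + 1)) ^ 2 * x⌋ / 4 := by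
  have h := Int.floor_div_natCast (((2 : ℝ) ^ (i + 1)) ^ 2 * x) 4
  push_cast at h
  rw [← h]
  congr 1; ring

/-- The dyadic cell of generation `i` containing `z`. -/
noncomputable def dyadic {n : ℕ} (i : ℕ) (z : Sp n × ℝ) : Set (Sp n × ℝ) :=
  cell ((2 : ℝ) ^ i) (key (2 ^ i) z)

lemma mem_dyadic {n : ℕ} {i : ℕ} {z w : Sp n × ℝ} : w ∈ dyadic i z ↔
    (∀ j, ⌊(2 : ℝ) ^ i * w.1 j⌋ = ⌊(2 : ℝ) ^ i * z.1 j⌋) ∧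
      ⌊((2 : ℝ) ^ i) ^ 2 * w.2⌋ = ⌊((2 : ℝ) ^ i) ^ 2 * z.2⌋ := by
  simp only [dyadic, cell, key, mem_ofPred_eq, Prod.ext_iff, funext_iff]

lemma self_mem_dyadic {n : ℕ} (i : ℕ) (z : Sp n × ℝ) : z ∈ dyadic i z :=
  mem_dyadic.2 ⟨fun _ => rfl, rfl⟩

lemma dyadic_succ_subset {n : ℕ} (i : ℕ) (z : Sp n × ℝ) : dyadic (i + 1) z ⊆ dyadic i z := by
  intro w hw
  rw [mem_dyadic] at hw ⊢
  refine ⟨fun j => ?_, ?_⟩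
  · rw [floor_two_pow_succ, hw.1 j, ← floor_two_pow_succ]
  · rw [floor_four_pow_succ, hw.2, ← floor_four_pow_succ]

lemma dyadic_anti {n : ℕ} {i j : ℕ} (h : i ≤ j) (z : Sp n × ℝ) : dyadic j z ⊆ dyadic i z :=
  antitone_nat_of_succ_le (f := fun i => dyadic i z) (fun i => dyadic_succ_subset i z) h

lemma dyadic_eq {n : ℕ} {i : ℕ} {z w : Sp n × ℝ} (h : w ∈ dyadic i z) :
    dyadic i w = dyadic i z := by
  have : key (2 ^ i) w = key (2 ^ i) z := h
  rw [dyadic, dyadic, this]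

lemma mem_unitCube_iff {n : ℕ} {x : Sp n} : x ∈ unitCube n ↔ ∀ j, ⌊(2 : ℝ) ^ 0 * x j⌋ = 0 := by
  simp only [unitCube, mem_ofPred_eq, pow_zero, one_mul, Int.floor_eq_zero_iff]

lemma floor_eq_of_floor_eq {i j : ℕ} (h : i ≤ j) {s t : ℝ}
    (hst : ⌊(2 : ℝ) ^ j * s⌋ = ⌊(2 : ℝ) ^ j * t⌋) :
    ⌊(2 : ℝ) ^ i * s⌋ = ⌊(2 : ℝ) ^ i * t⌋ := by
  induction j, h using Nat.le_induction with
  | base => exact hst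
  | succ j _ ih => exact ih (by rw [floor_two_pow_succ, hst, ← floor_two_pow_succ])

lemma mem_unitCube_of_floor_eq {n i : ℕ} {x y : Sp n}
    (h : ∀ j, ⌊(2 : ℝ) ^ i * x j⌋ = ⌊(2 : ℝ) ^ i * y j⌋) (hy : y ∈ unitCube n) :
    x ∈ unitCube n := by
  rw [mem_unitCube_iff] at hy ⊢
  exact fun j => (floor_eq_of_floor_eq (Nat.zero_le i) (h j)).trans (hy j)

lemma norm_sub_le_of_floor_eq {n : ℕ} {a : ℝ} (ha : 0 < a) {x y : Sp n}
    (h : ∀ j, ⌊a * x j⌋ = ⌊a * y j⌋) : ‖x - y‖ ≤ (n + 1) / a :=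
  (cell_dist ha (k := key a (y, 0)) (z := (x, 0)) (w := (y, 0))
    (Prod.ext (funext h) rfl) rfl).1

lemma dyadic_subset_dom {n : ℕ} {i : ℕ} {z : Sp n × ℝ} (hz : z.1 ∈ unitCube n) (hz2 : 0 ≤ z.2)
    {T : ℝ} (hT : z.2 + 1 ≤ T) : dyadic i z ⊆ dom n T := by
  intro w hw
  have h := mem_dyadic.1 hw
  have hn : (0 : ℝ) ≤ n := n.cast_nonneg
  refine ⟨mem_closedBall_iff_norm.2 ?_, ?_, ?_⟩
  · have := mem_ball_of_mem_unitCube (mem_unitCube_of_floor_eq h.1 hz)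
    linarith
  · have h1 : 0 ≤ ⌊((2 : ℝ) ^ i) ^ 2 * w.2⌋ := by rw [h.2]; exact Int.floor_nonneg.2 (by positivity)
    have h2 : 0 ≤ ((2 : ℝ) ^ i) ^ 2 * w.2 := Int.floor_nonneg.1 h1
    exact nonneg_of_mul_nonneg_right h2 (by positivity)
  · have h1 := abs_sub_le_of_floor_eq (by positivity) h.2
    have h2 : 1 / ((2 : ℝ) ^ i) ^ 2 ≤ 1 := by
      rw [div_le_one (by positivity)]
      exact one_le_pow₀ (one_le_pow₀ (by norm_num))
    have := (abs_le.1 (h1.trans h2)).2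
    linarith

/-- The dyadic cell of generation `i` at `z` carries at least a fraction `δ` of `{v ≤ c}`. -/
def Sparse {n : ℕ} (δ : ℝ) (v : Sp n × ℝ → ℝ) (c : ℝ) (i : ℕ) (z : Sp n × ℝ) : Prop :=
  ENNReal.ofReal δ * MeasureTheory.volume (dyadic i z) ≤
    MeasureTheory.volume {w | w ∈ dyadic i z ∧ v w ≤ c}

lemma Sparse.congr {n : ℕ} {δ : ℝ} {v : Sp n × ℝ → ℝ} {c : ℝ} {i : ℕ} {z w : Sp n × ℝ}
    (h : w ∈ dyadic i z) : Sparse δ v c i w ↔ Sparse δ v c i z := by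
  rw [Sparse, Sparse, dyadic_eq h]

lemma volume_dyadic {n : ℕ} (i : ℕ) (z : Sp n × ℝ) : MeasureTheory.volume (dyadic i z) =
    ENNReal.ofReal ((((2 : ℝ) ^ i) ^ (n + 2))⁻¹) := volume_cell (by positivity) _

lemma Sparse.exists_le {n : ℕ} {δ : ℝ} (hδ : 0 < δ) {v : Sp n × ℝ → ℝ} {c : ℝ} {i : ℕ}
    {z : Sp n × ℝ} (h : Sparse δ v c i z) : ∃ w ∈ dyadic i z, v w ≤ c := by
  by_contra hcon
  push Not at hcon
  have he : {w | w ∈ dyadic i z ∧ v w ≤ c} = ∅ := by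
    rw [eq_empty_iff_forall_notMem]
    rintro w ⟨h1, h2⟩
    exact absurd h2 (not_le.2 (hcon w h1))
  rw [Sparse, he, MeasureTheory.measure_empty, volume_dyadic,
    ← ENNReal.ofReal_mul hδ.le] at h
  have : 0 < δ * (((2 : ℝ) ^ i) ^ (n + 2))⁻¹ := by positivity
  exact absurd h (not_le.2 (ENNReal.ofReal_pos.2 this))

/-- All the normalized scaled comparison inequalities needed in the covering argument. -/
structure Normalized (n : ℕ) (lam Lam G κ N T : ℝ) (v : Sp n × ℝ → ℝ) : Prop where
  cont : ContinuousOn v (dom n T)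
  nonneg : ∀ z ∈ dom n T, 0 ≤ v z
  superC : ∀ k i : ℕ, k ≤ i →
    SuperC lam Lam (G * N ^ k * 2 ^ i) (κ * N ^ k * (2 ^ i) ^ 2) (dom n T) v

lemma Normalized.sparse_of_le {n : ℕ} {lam Lam δ H N G κ T : ℝ} {v : Sp n × ℝ → ℝ}
    (hV : Normalized n lam Lam G κ N T v) (hOS : OneShot n lam Lam δ H N G κ)
    (hN : 1 < N) {i k : ℕ} (hk : k ≤ i) {z q : Sp n × ℝ} (hz : z.1 ∈ unitCube n) (hz2 : 0 ≤ z.2)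
    (hq1 : ‖q.1 - cellCenter (2 ^ i) z.1‖ ≤ 2 * (n + 1) / 2 ^ i)
    (hq2 : ⌊((2 : ℝ) ^ i) ^ 2 * z.2⌋ + 1 ≤ ((2 : ℝ) ^ i) ^ 2 * q.2)
    (hq3 : ((2 : ℝ) ^ i) ^ 2 * q.2 ≤ ⌊((2 : ℝ) ^ i) ^ 2 * z.2⌋ + 1 + H)
    (hqT : q.2 ≤ T) (hvq : v q ≤ N ^ k) : Sparse δ v (N ^ (k + 1)) i z := by
  have := hOS.cell hV.cont hV.nonneg (one_le_pow₀ (by norm_num : (1 : ℝ) ≤ 2))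
    (pow_pos (by linarith) k) (hV.superC k i hk) hz hz2 hq1 hq2 hq3 hqT hvq
  rw [← pow_succ'] at this
  exact this

lemma norm_sub_cellCenter_le {n i : ℕ} {x y : Sp n}
    (h : ∀ j, ⌊(2 : ℝ) ^ i * x j⌋ = ⌊(2 : ℝ) ^ i * y j⌋) :
    ‖x - cellCenter (2 ^ (i + 1)) y‖ ≤ 2 * (n + 1) / 2 ^ (i + 1) := by
  have := norm_sub_le_of_floor_eq (a := (2 : ℝ) ^ i) (by positivity) (x := x)
    (y := cellCenter (2 ^ (i + 1)) y) fun j => (h j).trans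
      (floor_eq_of_floor_eq i.le_succ (floor_cellCenter (by positivity) y j)).symm
  refine this.trans_eq ?_
  rw [pow_succ']; field_simp

lemma Normalized.sparse {n : ℕ} {lam Lam δ H N G κ : ℝ} {v : Sp n × ℝ → ℝ} {p : Sp n × ℝ}
    (hV : Normalized n lam Lam G κ N p.2 v) (hOS : OneShot n lam Lam δ H N G κ) (hδ : 0 < δ)
    (hN : 1 < N) (hH : 8 ≤ H) (hp1 : p.1 ∈ unitCube n) (hp2 : 5 ≤ p.2) (hp3 : p.2 ≤ 1 + H)
    (hvp : v p ≤ 1) (i : ℕ) : ∀ z : Sp n × ℝ, z.1 ∈ unitCube n → 0 ≤ z.2 →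
      3 * (⌊((2 : ℝ) ^ i) ^ 2 * z.2⌋ : ℝ) ≤ 8 * ((2 : ℝ) ^ i) ^ 2 + 4 →
        Sparse δ v (N ^ (i + 1)) i z := by
  have hn : (0 : ℝ) ≤ n := n.cast_nonneg
  induction i with
  | zero =>
    intro z hz hz2 hz3
    have h0 : (0 : ℝ) ≤ ⌊((2 : ℝ) ^ 0) ^ 2 * z.2⌋ := by
      exact_mod_cast Int.floor_nonneg.2 (by positivity)
    have h4 : ((2 : ℝ) ^ 0) ^ 2 = 1 := by norm_num
    refine hV.sparse_of_le hOS hN le_rfl hz hz2 (q := p) ?_ ?_ ?_ le_rfl (by simpa using hvp)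
    · have := norm_sub_le_of_floor_eq (a := (2 : ℝ) ^ 0) (by positivity) (x := p.1)
        (y := cellCenter (2 ^ 0) z.1) fun j => by
          rw [floor_cellCenter (by positivity), mem_unitCube_iff.1 hp1, mem_unitCube_iff.1 hz]
      refine this.trans ?_
      rw [pow_zero, div_one, div_one]; linarith
    · rw [h4] at hz3 h0 ⊢; linarith
    · rw [h4] at hz3 h0 ⊢; linarith
  | succ i ih =>
    intro z hz hz2 hz3
    obtain ⟨F, hF⟩ : ∃ F : ℤ, F = ⌊((2 : ℝ) ^ (i + 1)) ^ 2 * z.2⌋ := ⟨_, rfl⟩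
    obtain ⟨f, hf⟩ : ∃ f : ℤ, f = ⌊((2 : ℝ) ^ i) ^ 2 * z.2⌋ := ⟨_, rfl⟩
    have hfF : f = F / 4 := by rw [hf, hF, floor_four_pow_succ]
    have hfF1 : (4 * f : ℝ) ≤ F := by exact_mod_cast (by omega : 4 * f ≤ F)
    have hfF2 : (F : ℝ) ≤ 4 * f + 3 := by exact_mod_cast (by omega : F ≤ 4 * f + 3)
    have e4 : ((2 : ℝ) ^ (i + 1)) ^ 2 = 4 * ((2 : ℝ) ^ i) ^ 2 := by ring
    obtain ⟨b, hb⟩ : ∃ b : ℝ, b = ((2 : ℝ) ^ i) ^ 2 := ⟨_, rfl⟩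
    have hb1 : 1 ≤ b := by rw [hb]; exact one_le_pow₀ (one_le_pow₀ (by norm_num))
    rw [← hF] at hz3
    rw [e4, ← hb] at hz3
    have hz' : ⌊((2 : ℝ) ^ i) ^ 2 * (z.2 + 1 / b)⌋ = f + 1 := by
      rw [hf, ← Int.floor_add_one, ← hb]
      congr 1; field_simp
    obtain ⟨q, hq, hvq⟩ := (ih (z.1, z.2 + 1 / b) hz (by positivity)
      (by rw [hz', ← hb]; push_cast; linarith)).exists_le hδ
    rw [mem_dyadic] at hq
    have hq2 := hq.2
    simp only at hq2
    rw [hz', Int.floor_eq_iff, ← hb] at hq2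
    push_cast at hq2
    refine hV.sparse_of_le hOS hN le_rfl hz hz2 (q := q) (norm_sub_cellCenter_le hq.1) ?_ ?_ ?_ hvq
    · rw [← hF, e4, ← hb]; linarith
    · rw [← hF, e4, ← hb]; linarith
    · refine le_trans ?_ hp2
      by_contra hcon
      push Not at hcon
      have : b * 5 < b * q.2 := by gcongr
      linarith

/-- The superlevel set of generation `k`. -/
def superlevel {n : ℕ} (N : ℝ) (v : Sp n × ℝ → ℝ) (k : ℕ) : Set (Sp n × ℝ) :=
  {z | z.1 ∈ unitCube n ∧ 0 ≤ z.2 ∧ z.2 * 2 ^ k < 2 ^ k + 1 ∧ N ^ k < v z}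

/-- A parent cell which is sparse but contains a dense child. -/
def Good {n : ℕ} (δ : ℝ) (v : Sp n × ℝ → ℝ) (c : ℝ) (i : ℕ) (z : Sp n × ℝ) : Prop :=
  Sparse δ v c i z ∧ ∃ w ∈ dyadic i z, ¬ Sparse δ v c (i + 1) w

lemma Good.congr {n : ℕ} {δ : ℝ} {v : Sp n × ℝ → ℝ} {c : ℝ} {i : ℕ} {z w : Sp n × ℝ}
    (h : w ∈ dyadic i z) : Good δ v c i w ↔ Good δ v c i z := by
  rw [Good, Good, dyadic_eq h, Sparse.congr h]

lemma Normalized.measurableSet_le {n : ℕ} {lam Lam N G κ T : ℝ} {v : Sp n × ℝ → ℝ}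
    (hV : Normalized n lam Lam G κ N T v) (c : ℝ) {S : Set (Sp n × ℝ)} (hS : MeasurableSet S)
    (hsub : S ⊆ dom n T) : MeasurableSet {w | w ∈ S ∧ v w ≤ c} := by
  have hcl : IsClosed (dom n T) := Metric.isClosed_closedBall.prod isClosed_Icc
  have := (hV.cont.preimage_isClosed_of_isClosed hcl (isClosed_Iic (a := c))).measurableSet
  convert hS.inter this using 1
  ext w
  simp only [mem_ofPred_eq, mem_inter_iff, mem_preimage, mem_Iic]
  exact ⟨fun h => ⟨h.1, hsub h.1, h.2⟩, fun h => ⟨h.1, h.2.2⟩⟩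

lemma Sparse.volume_gt_le {n : ℕ} {lam Lam N G κ T δ : ℝ} {v : Sp n × ℝ → ℝ}
    (hV : Normalized n lam Lam G κ N T v) (hδ : 0 < δ) {c : ℝ} {i : ℕ} {z : Sp n × ℝ}
    (hsub : dyadic i z ⊆ dom n T) (h : Sparse δ v c i z) :
    MeasureTheory.volume {w | w ∈ dyadic i z ∧ c < v w} ≤
      ENNReal.ofReal (1 - δ) * MeasureTheory.volume (dyadic i z) := by
  have hm : MeasurableSet (dyadic i z) := measurableSet_cell (by positivity) _
  have he : {w | w ∈ dyadic i z ∧ c < v w} = dyadic i z \ {w | w ∈ dyadic i z ∧ v w ≤ c} := by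
    ext w
    simp only [mem_ofPred_eq, Set.mem_sdiff, not_and, not_le]
    exact ⟨fun h => ⟨h.1, fun _ => h.2⟩, fun h => ⟨h.1, h.2 h.1⟩⟩
  have hfin : MeasureTheory.volume (dyadic i z) ≠ ⊤ := by
    rw [volume_dyadic]; exact ENNReal.ofReal_ne_top
  rw [he, MeasureTheory.measure_sdiff (fun w hw => hw.1)
    (hV.measurableSet_le c hm hsub).nullMeasurableSet
    (ne_top_of_le_ne_top hfin (MeasureTheory.measure_mono fun w hw => hw.1)),
    ENNReal.ofReal_sub _ hδ.le, ENNReal.ofReal_one, ENNReal.sub_mul (fun _ _ => hfin), one_mul]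
  exact tsub_le_tsub_left h _

lemma Normalized.exists_good {n : ℕ} {lam Lam δ N G κ T : ℝ} {v : Sp n × ℝ → ℝ}
    (hV : Normalized n lam Lam G κ N T v) (hδ : 0 < δ) (hT : 5 ≤ T) {k : ℕ}
    (hsp : ∀ z : Sp n × ℝ, z.1 ∈ unitCube n → 0 ≤ z.2 →
      3 * (⌊((2 : ℝ) ^ k) ^ 2 * z.2⌋ : ℝ) ≤ 8 * ((2 : ℝ) ^ k) ^ 2 + 4 → Sparse δ v (N ^ (k + 1)) k z)
    {z : Sp n × ℝ} (hz : z ∈ superlevel N v (k + 1)) :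
    ∃ i, k ≤ i ∧ Good δ v (N ^ (k + 1)) i z := by
  obtain ⟨h1, h2, h3, h4⟩ := hz
  have hz2 : z.2 ≤ 2 := by
    have hp : (1 : ℝ) ≤ 2 ^ (k + 1) := one_le_pow₀ (by norm_num)
    by_contra hcon
    push Not at hcon
    have : 2 * (2 : ℝ) ^ (k + 1) < z.2 * 2 ^ (k + 1) := by gcongr
    linarith
  -- small cells are full
  have hnot : ∃ i, k ≤ i ∧ ¬ Sparse δ v (N ^ (k + 1)) i z := by
    have hzd : z ∈ dom n T := dyadic_subset_dom (i := 0) h1 h2 (by linarith) (self_mem_dyadic 0 z)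
    have hev : ∀ᶠ w in nhdsWithin z (dom n T), N ^ (k + 1) < v w :=
      (hV.cont z hzd).eventually (lt_mem_nhds h4)
    obtain ⟨ε, hε, hball⟩ := Metric.mem_nhdsWithin_iff.1 hev
    have hlim : Tendsto (fun i : ℕ => (n + 1) / (2 : ℝ) ^ i) atTop (nhds 0) :=
      tendsto_const_nhds.div_atTop (tendsto_pow_atTop_atTop_of_one_lt (by norm_num))
    obtain ⟨i, hik, hi⟩ := ((eventually_ge_atTop k).and
      ((hlim.eventually (gt_mem_nhds (lt_min hε one_pos))))).exists
    refine ⟨i, hik, fun hs => ?_⟩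
    obtain ⟨w, hw, hvw⟩ := hs.exists_le hδ
    have hd := cell_dist (by positivity) hw (self_mem_dyadic i z)
    have hi1 := hi.trans_le (min_le_left _ _)
    have hi2 := hi.trans_le (min_le_right _ _)
    have hpos : 0 ≤ (n + 1) / (2 : ℝ) ^ i := by positivity
    have : dist w z < ε := by
      rw [Prod.dist_eq, max_lt_iff]
      refine ⟨by rw [dist_eq_norm]; exact hd.1.trans_lt hi1, ?_⟩
      rw [Real.dist_eq]
      refine hd.2.trans_lt (lt_of_le_of_lt ?_ hi1)
      rw [pow_two]
      exact mul_le_of_le_one_left hpos hi2.le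
    exact absurd hvw (not_le.2 (hball ⟨this, dyadic_subset_dom h1 h2 (by linarith) hw⟩))
  classical
  obtain ⟨hki, hi⟩ := Nat.find_spec hnot
  have hmin : ∀ j < Nat.find hnot, k ≤ j → Sparse δ v (N ^ (k + 1)) j z := by
    intro j hj hkj
    have := Nat.find_min hnot hj
    by_contra h
    exact this ⟨hkj, h⟩
  have hne : k ≠ Nat.find hnot := by
    intro heq
    refine hi ?_
    rw [← heq]
    refine hsp z h1 h2 ?_
    have h5 : (⌊((2 : ℝ) ^ k) ^ 2 * z.2⌋ : ℝ) ≤ ((2 : ℝ) ^ k) ^ 2 * z.2 := Int.floor_le _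
    have h6 : ((2 : ℝ) ^ k) ^ 2 * z.2 ≤ ((2 : ℝ) ^ k) ^ 2 * 2 := by gcongr
    have h7 : 0 ≤ ((2 : ℝ) ^ k) ^ 2 := by positivity
    linarith
  obtain ⟨j, hj⟩ : ∃ j, Nat.find hnot = j + 1 := ⟨Nat.find hnot - 1, by omega⟩
  rw [hj] at hmin hi
  exact ⟨j, by omega, hmin j (by omega) (by omega), z, self_mem_dyadic j z, hi⟩

lemma Normalized.decay_step {n : ℕ} {lam Lam δ H N G κ : ℝ} {v : Sp n × ℝ → ℝ} {p : Sp n × ℝ}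
    (hV : Normalized n lam Lam G κ N p.2 v) (hOS : OneShot n lam Lam δ H N G κ) (hδ : 0 < δ)
    (hN : 1 < N) {m : ℕ} (hH : 8 + 4 * m ≤ H) (hp1 : p.1 ∈ unitCube n) (hp2 : 5 ≤ p.2)
    (hp3 : p.2 ≤ 1 + H) (hvp : v p ≤ 1) {k : ℕ} (hk : (m + 1) * 2 ^ (k + 1) ≤ ((2 : ℝ) ^ k) ^ 2) :
    (m : ENNReal) * MeasureTheory.volume (superlevel N v (k + 1)) ≤
      ENNReal.ofReal ((m + 1) * (1 - δ)) * MeasureTheory.volume (superlevel N v k) := by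
  classical
  have hm0 : (0 : ℝ) ≤ m := m.cast_nonneg
  have hsp := hV.sparse hOS hδ hN (by linarith) hp1 hp2 hp3 hvp k
  have hz2 : ∀ z ∈ superlevel N v (k + 1), z.2 + 1 ≤ p.2 := by
    intro z hz
    have hp : (1 : ℝ) ≤ 2 ^ (k + 1) := one_le_pow₀ (by norm_num)
    by_contra hcon
    push Not at hcon
    have : 4 * (2 : ℝ) ^ (k + 1) < z.2 * 2 ^ (k + 1) := by
      gcongr; linarith
    linarith [hz.2.2.1]
  have hex : ∀ z : superlevel N v (k + 1), ∃ i, k ≤ i ∧ Good δ v (N ^ (k + 1)) i z.1 :=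
    fun z => hV.exists_good hδ hp2 hsp z.2
  obtain ⟨J, hJdef⟩ : ∃ J : superlevel N v (k + 1) → ℕ, J = fun z => Nat.find (hex z) := ⟨_, rfl⟩
  have hJk : ∀ z, k ≤ J z := fun z => by rw [hJdef]; exact (Nat.find_spec (hex z)).1
  have hJg : ∀ z, Good δ v (N ^ (k + 1)) (J z) z.1 := fun z => by
    rw [hJdef]; exact (Nat.find_spec (hex z)).2
  have hJmin : ∀ z i, k ≤ i → Good δ v (N ^ (k + 1)) i z.1 → J z ≤ i := fun z i h1 h2 => by
    rw [hJdef]; exact Nat.find_min' (hex z) ⟨h1, h2⟩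
  obtain ⟨F, hF⟩ : ∃ F : superlevel N v (k + 1) → ℕ × ((Fin n → ℤ) × ℤ),
    F = fun z => (J z, key (2 ^ J z) z.1) := ⟨_, rfl⟩
  obtain ⟨P, hP⟩ : ∃ P : Set (ℕ × ((Fin n → ℤ) × ℤ)), P = range F := ⟨_, rfl⟩
  have hPc : P.Countable := to_countable P
  obtain ⟨C, hC⟩ : ∃ C : ℕ × ((Fin n → ℤ) × ℤ) → Set (Sp n × ℝ),
    C = fun l => cell ((2 : ℝ) ^ l.1) l.2 := ⟨_, rfl⟩
  have hCF : ∀ z, C (F z) = dyadic (J z) z.1 := fun z => by rw [hC, hF]; rfl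
  have hCm : ∀ l, MeasurableSet (C l) := fun l => by
    rw [hC]; exact measurableSet_cell (by positivity) _
  have hdisj : P.PairwiseDisjoint C := by
    have hwlog : ∀ z z', J z ≤ J z' → ∀ w, w ∈ C (F z) → w ∈ C (F z') → F z = F z' := by
      intro z z' hle w h1 h2
      rw [hCF] at h1 h2
      have h3 : w ∈ dyadic (J z) z'.1 := dyadic_anti hle _ h2
      have h4 : Good δ v (N ^ (k + 1)) (J z) z'.1 :=
        (Good.congr h3).1 ((Good.congr h1).2 (hJg z))
      have h5 : J z = J z' := le_antisymm hle (hJmin z' _ (hJk z) h4)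
      rw [hF]
      refine Prod.ext h5 ?_
      have e1 : key (2 ^ J z) w = key (2 ^ J z) z.1 := h1
      have e2 : key (2 ^ J z') w = key (2 ^ J z') z'.1 := h2
      simp only
      rw [← e1, ← e2, h5]
    rw [hP]
    rintro _ ⟨z, rfl⟩ _ ⟨z', rfl⟩ hne
    rw [Function.onFun, Set.disjoint_left]
    intro w h1 h2
    rcases le_total (J z) (J z') with h | h
    · exact hne (hwlog z z' h w h1 h2)
    · exact hne (hwlog z' z h w h2 h1).symm
  have hA : MeasureTheory.volume (superlevel N v (k + 1)) ≤
      ENNReal.ofReal (1 - δ) * MeasureTheory.volume (⋃ l ∈ P, C l) := by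
    have hcov : superlevel N v (k + 1) ⊆ ⋃ l ∈ P, {w | w ∈ C l ∧ N ^ (k + 1) < v w} := by
      intro z hz
      refine mem_iUnion₂.2 ⟨F ⟨z, hz⟩, by rw [hP]; exact mem_range_self _, ?_, hz.2.2.2⟩
      rw [hCF]; exact self_mem_dyadic _ _
    refine (MeasureTheory.measure_mono hcov).trans ?_
    refine (MeasureTheory.measure_biUnion_le _ hPc _).trans ?_
    rw [MeasureTheory.measure_biUnion hPc hdisj fun l _ => hCm l, ← ENNReal.tsum_mul_left]
    refine ENNReal.tsum_le_tsum fun l => ?_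
    obtain ⟨l, hl⟩ := l
    rw [hP] at hl
    obtain ⟨z, rfl⟩ := hl
    simp only [hCF]
    exact (hJg z).1.volume_gt_le hV hδ (dyadic_subset_dom z.2.1 z.2.2.1 (hz2 z z.2))
  have hstack := volume_iUnion_box_le_stack
    (fun l : ℕ × ((Fin n → ℤ) × ℤ) => WithLp.ofLp ⁻¹' (Set.pi univ fun j =>
      Ico (l.2.1 j / (2 : ℝ) ^ l.1) ((l.2.1 j + 1) / (2 : ℝ) ^ l.1)))
    (fun l => (MeasurableSet.univ_pi fun _ => measurableSet_Ico).preimage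
      (PiLp.volume_preserving_ofLp (Fin n)).measurable)
    (fun l => l.2.2 / ((2 : ℝ) ^ l.1) ^ 2) (fun l => 1 / ((2 : ℝ) ^ l.1) ^ 2)
    (fun l => by positivity) m P
  have hC' : ∀ l : ℕ × ((Fin n → ℤ) × ℤ), (WithLp.ofLp ⁻¹' (Set.pi univ fun j =>
      Ico (l.2.1 j / (2 : ℝ) ^ l.1) ((l.2.1 j + 1) / (2 : ℝ) ^ l.1))) ×ˢ
      Ico (l.2.2 / ((2 : ℝ) ^ l.1) ^ 2) (l.2.2 / ((2 : ℝ) ^ l.1) ^ 2 + 1 / ((2 : ℝ) ^ l.1) ^ 2) =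
      C l := by
    intro l
    rw [hC, ← add_div]
    exact (cell_eq (by positivity) _).symm
  simp only [hC'] at hstack
  have hsub : (⋃ l ∈ P, (WithLp.ofLp ⁻¹' (Set.pi univ fun j =>
      Ico (l.2.1 j / (2 : ℝ) ^ l.1) ((l.2.1 j + 1) / (2 : ℝ) ^ l.1))) ×ˢ
      Ico (l.2.2 / ((2 : ℝ) ^ l.1) ^ 2 + 1 / ((2 : ℝ) ^ l.1) ^ 2)
        (l.2.2 / ((2 : ℝ) ^ l.1) ^ 2 + (m + 1) * (1 / ((2 : ℝ) ^ l.1) ^ 2))) ⊆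
      superlevel N v k := by
    intro w hw
    obtain ⟨l, hl, hw1, hw2⟩ := mem_iUnion₂.1 hw
    rw [hP] at hl
    obtain ⟨z, rfl⟩ := hl
    simp only [hF, mem_preimage, Set.mem_pi, mem_univ, true_imp_iff] at hw1 hw2
    obtain ⟨i, hi⟩ : ∃ i, i = J z := ⟨_, rfl⟩
    have hki : k ≤ i := hi ▸ hJk z
    have hgood := hJg z
    rw [← hi] at hw1 hw2 hgood
    have hfl : ∀ j, ⌊(2 : ℝ) ^ i * w.1 j⌋ = ⌊(2 : ℝ) ^ i * z.1.1 j⌋ := fun j =>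
      (floor_mul_eq_iff (by positivity) _ _).2 (hw1 j)
    have hwX : w.1 ∈ unitCube n := mem_unitCube_of_floor_eq hfl z.2.1
    obtain ⟨b, hb⟩ : ∃ b : ℝ, b = ((2 : ℝ) ^ i) ^ 2 := ⟨_, rfl⟩
    have hb0 : 0 < b := by rw [hb]; positivity
    obtain ⟨f, hf⟩ : ∃ f : ℤ, f = ⌊((2 : ℝ) ^ i) ^ 2 * z.1.2⌋ := ⟨_, rfl⟩
    simp only [key] at hw2
    rw [← hf, ← hb, ← add_div, mul_one_div, ← add_div, mem_Ico, div_le_iff₀ hb0,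
      lt_div_iff₀ hb0] at hw2
    have hf0 : (0 : ℝ) ≤ f := by
      rw [hf]; exact_mod_cast Int.floor_nonneg.2 (mul_nonneg (by positivity) z.2.2.1)
    have hfz : (f : ℝ) ≤ b * z.1.2 := by rw [hf, hb]; exact Int.floor_le _
    have hw0 : 0 ≤ w.2 := by
      have : 0 ≤ w.2 * b := by linarith
      exact nonneg_of_mul_nonneg_left this hb0
    have hwk : w.2 * 2 ^ k < 2 ^ k + 1 := by
      have h1 : z.1.2 * 2 ^ (k + 1) < 2 ^ (k + 1) + 1 := z.2.2.2.1
      have h2 : (m + 1) * 2 ^ (k + 1) ≤ b := by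
        refine hk.trans ?_
        rw [hb]
        exact pow_le_pow_left₀ (by positivity) (pow_le_pow_right₀ (by norm_num) hki) 2
      rw [pow_succ] at h1 h2
      obtain ⟨e, he⟩ : ∃ e : ℝ, e = 2 ^ k := ⟨_, rfl⟩
      have he0 : 0 < e := by rw [he]; positivity
      rw [← he] at h1 h2 ⊢
      have h3 : w.2 * b * (2 * e) < (b * z.1.2 + (m + 1)) * (2 * e) := by
        apply mul_lt_mul_of_pos_right _ (by positivity); linarith
      have h4 : b * (z.1.2 * (e * 2)) < b * (e * 2 + 1) := mul_lt_mul_of_pos_left h1 hb0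
      by_contra hcon
      push Not at hcon
      have h5 : (e + 1) * (2 * b) ≤ w.2 * e * (2 * b) :=
        mul_le_mul_of_nonneg_right hcon (by positivity)
      linarith
    have hw2' : w.2 ≤ 2 := by
      have hp : (1 : ℝ) ≤ 2 ^ k := one_le_pow₀ (by norm_num)
      by_contra hcon
      push Not at hcon
      have : 2 * (2 : ℝ) ^ k < w.2 * 2 ^ k := by gcongr
      linarith
    refine ⟨hwX, hw0, hwk, ?_⟩
    by_contra hcon
    push Not at hcon
    obtain ⟨-, w', hw', hdense⟩ := hgood
    have hw'' := mem_dyadic.1 hw'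
    obtain ⟨F', hF'⟩ : ∃ F : ℤ, F = ⌊((2 : ℝ) ^ (i + 1)) ^ 2 * w'.2⌋ := ⟨_, rfl⟩
    have hfF : f = F' / 4 := by rw [hf, hF', ← hw''.2, floor_four_pow_succ]
    have hfF1 : (4 * f : ℝ) ≤ F' := by exact_mod_cast (by omega : 4 * f ≤ F')
    have hfF2 : (F' : ℝ) ≤ 4 * f + 3 := by exact_mod_cast (by omega : F' ≤ 4 * f + 3)
    have e4 : ((2 : ℝ) ^ (i + 1)) ^ 2 = 4 * b := by rw [hb]; ring
    have hw'd := dyadic_subset_dom z.2.1 z.2.2.1 (hz2 z z.2) hw'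
    refine hdense (hV.sparse_of_le hOS hN (by omega) (mem_unitCube_of_floor_eq hw''.1 z.2.1)
      hw'd.2.1 (q := w) (norm_sub_cellCenter_le fun j => (hfl j).trans (hw''.1 j).symm)
      ?_ ?_ (by linarith) hcon)
    · rw [← hF', e4]; linarith
    · rw [← hF', e4]; linarith
  calc (m : ENNReal) * MeasureTheory.volume (superlevel N v (k + 1))
      ≤ m * (ENNReal.ofReal (1 - δ) * MeasureTheory.volume (⋃ l ∈ P, C l)) := by gcongr
    _ = ENNReal.ofReal (1 - δ) * (m * MeasureTheory.volume (⋃ l ∈ P, C l)) := by ring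
    _ ≤ ENNReal.ofReal (1 - δ) * ((m + 1) * MeasureTheory.volume (superlevel N v k)) := by
        exact mul_le_mul_right
          (hstack.trans (mul_le_mul_right (MeasureTheory.measure_mono hsub) _)) _
    _ = _ := by
        rw [ENNReal.ofReal_mul (by positivity), ENNReal.ofReal_add hm0 zero_le_one,
          ENNReal.ofReal_natCast, ENNReal.ofReal_one]
        ring

lemma volume_superlevel_le {n : ℕ} (N : ℝ) (v : Sp n × ℝ → ℝ) (k : ℕ) :
    MeasureTheory.volume (superlevel N v k) ≤ ENNReal.ofReal 2 := by
  have hsub : superlevel N v k ⊆ dyadic 0 (cubeCenter n, 0) ∪ dyadic 0 (cubeCenter n, 1) := by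
    rintro z ⟨h1, h2, h3, -⟩
    have hp : (1 : ℝ) ≤ 2 ^ k := one_le_pow₀ (by norm_num)
    have hz2 : z.2 < 2 := by
      by_contra hcon
      push Not at hcon
      have : 2 * (2 : ℝ) ^ k ≤ z.2 * 2 ^ k := by gcongr
      linarith
    have hc : ∀ j, ⌊(2 : ℝ) ^ 0 * z.1 j⌋ = ⌊(2 : ℝ) ^ 0 * cubeCenter n j⌋ := by
      intro j
      have e : cubeCenter n j = 1 / 2 := rfl
      rw [mem_unitCube_iff.1 h1, e]
      norm_num
    rcases lt_or_ge z.2 1 with h | h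
    · refine Or.inl (mem_dyadic.2 ⟨hc, ?_⟩)
      rw [pow_zero, one_pow, one_mul, mul_zero, Int.floor_zero, Int.floor_eq_zero_iff]
      exact ⟨h2, h⟩
    · refine Or.inr (mem_dyadic.2 ⟨hc, ?_⟩)
      rw [pow_zero, one_pow, one_mul, mul_one, Int.floor_one, Int.floor_eq_iff]
      push_cast
      constructor <;> linarith
  refine (MeasureTheory.measure_mono hsub).trans ((MeasureTheory.measure_union_le _ _).trans ?_)
  rw [volume_dyadic, volume_dyadic, ← ENNReal.ofReal_add (by positivity) (by positivity)]
  apply ENNReal.ofReal_le_ofReal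
  norm_num

lemma exists_decay (n : ℕ) {lam Lam : ℝ} (hlam : 0 < lam) (hLam : lam ≤ Lam) :
    ∃ N > 1, ∃ G > 0, ∃ κ > 0, ∃ θ ∈ Ioo (0 : ℝ) 1, ∃ k₀ : ℕ, ∀ (v : Sp n × ℝ → ℝ) (p : Sp n × ℝ),
      Normalized n lam Lam G κ N p.2 v → p.1 ∈ unitCube n → 5 ≤ p.2 →
      p.2 ≤ (3 * n + 6) ^ 2 + 1 → v p ≤ 1 → ∀ k : ℕ,
        MeasureTheory.volume (superlevel N v (k₀ + k)) ≤ ENNReal.ofReal (2 * θ ^ k) := by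
  obtain ⟨δ, hδ, hOS⟩ := exists_one_shot n hlam hLam
  obtain ⟨m, hm⟩ := exists_nat_gt (1 / δ)
  have hm0 : (0 : ℝ) < m := lt_trans (by positivity) hm
  rw [div_lt_iff₀ hδ] at hm
  obtain ⟨H, hH⟩ : ∃ H : ℝ, H = 8 + 4 * m + ((3 * n + 6) ^ 2 + 1) := ⟨_, rfl⟩
  have hn2 : (0 : ℝ) ≤ (3 * n + 6) ^ 2 := by positivity
  obtain ⟨N, hN, G, hG, κ, hκ, hOS⟩ := hOS H (by rw [hH]; positivity)
  obtain ⟨k₀, hk₀⟩ := pow_unbounded_of_one_lt (2 * (m + 1) : ℝ) one_lt_two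
  obtain ⟨θ, hθ⟩ : ∃ θ : ℝ, θ = max ((m + 1) * (1 - δ) / m) (1 / 2) := ⟨_, rfl⟩
  have hθ0 : 0 < θ := by rw [hθ]; exact lt_max_of_lt_right (by norm_num)
  have hθ1 : θ < 1 := by
    rw [hθ]
    refine max_lt ?_ (by norm_num)
    rw [div_lt_one hm0]
    linarith
  have hθm : (m + 1) * (1 - δ) ≤ m * θ := by
    have := (div_le_iff₀ hm0).1 (hθ ▸ le_max_left _ _ : (m + 1) * (1 - δ) / m ≤ θ)
    linarith
  refine ⟨N, hN, G, hG, κ, hκ, θ, ⟨hθ0, hθ1⟩, k₀, ?_⟩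
  intro v p hV hp1 hp2 hp3 hvp k
  induction k with
  | zero => rw [pow_zero, mul_one]; exact volume_superlevel_le _ _ _
  | succ k ih =>
    have hk : (m + 1) * 2 ^ (k₀ + k + 1) ≤ ((2 : ℝ) ^ (k₀ + k)) ^ 2 := by
      have h1 : (2 : ℝ) ^ k₀ ≤ 2 ^ (k₀ + k) := pow_le_pow_right₀ (by norm_num) (by omega)
      have h2 : (2 * (m + 1)) * (2 : ℝ) ^ (k₀ + k) ≤ 2 ^ (k₀ + k) * 2 ^ (k₀ + k) :=
        mul_le_mul_of_nonneg_right (hk₀.le.trans h1) (by positivity)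
      rw [pow_succ, pow_two]
      linarith
    have hstep := hV.decay_step hOS hδ hN (m := m) (by rw [hH]; linarith) hp1 hp2
      (by rw [hH]; linarith) hvp hk
    have hm' : (m : ENNReal) = ENNReal.ofReal m := (ENNReal.ofReal_natCast m).symm
    have h1 : (m : ENNReal) * MeasureTheory.volume (superlevel N v (k₀ + k + 1)) ≤
        m * (ENNReal.ofReal θ * ENNReal.ofReal (2 * θ ^ k)) := by
      refine hstep.trans ?_
      rw [← mul_assoc]
      refine mul_le_mul' ?_ ih
      rw [hm', ← ENNReal.ofReal_mul hm0.le]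
      exact ENNReal.ofReal_le_ofReal hθm
    have h2 := (ENNReal.mul_le_mul_iff_right (by rw [hm']; exact (ENNReal.ofReal_pos.2 hm0).ne')
      (by rw [hm']; exact ENNReal.ofReal_ne_top)).1 h1
    refine h2.trans_eq ?_
    rw [← ENNReal.ofReal_mul hθ0.le]
    congr 1
    ring

/-- The normalized scaled comparison inequalities for the reflected function. -/
def Reflected (n : ℕ) (lam Lam G C T : ℝ) (γ : ℕ) (v : Sp n × ℝ → ℝ) : Prop :=
  ∀ r L : ℝ, 0 < r → r ≤ 1 → 1 ≤ L → L * r ^ γ ≤ C →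
    SuperC lam Lam (G * (L / 8) / r) (L / 8 / r ^ 2) (dom n T) (fun z => 9 / 8 * L - v z)

/-- If `v` is bounded by `9/8` of its value at the top of a cylinder, it is comparable to this
value on a large part of the cylinder. -/
lemma Reflected.volume_ge {n : ℕ} {lam Lam G C T μ : ℝ} {γ : ℕ} {v : Sp n × ℝ → ℝ}
    (hR : Reflected n lam Lam G C T γ v)
    (hSL : ∀ v : Sp n × ℝ → ℝ, ContinuousOn v (unitCyl n) → (∀ z ∈ unitCyl n, 0 ≤ v z) →
      SuperC lam Lam G 1 (unitCyl n) v → v (0, 0) ≤ 1 →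
      ENNReal.ofReal μ ≤ MeasureTheory.volume {z | z ∈ unitCyl n ∧ v z ≤ 3})
    (hvc : ContinuousOn v (dom n T)) {r : ℝ} {z₀ : Sp n × ℝ} (hr : 0 < r) (hr1 : r ≤ 1)
    (hL : 1 ≤ v z₀) (hC : v z₀ * r ^ γ ≤ C)
    (hmaps : MapsTo (pscale z₀.1 z₀.2 r) (unitCyl n) (dom n T))
    (hle : ∀ z ∈ unitCyl n, v (pscale z₀.1 z₀.2 r z) ≤ 9 / 8 * v z₀) :
    ENNReal.ofReal (μ * r ^ (n + 2)) ≤ MeasureTheory.volume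
      {w | w ∈ pscale z₀.1 z₀.2 r '' unitCyl n ∧ 3 / 4 * v z₀ ≤ v w} := by
  have hm : 0 < v z₀ / 8 := by linarith
  have hS := (hR r (v z₀) hr hr1 hL hC).rescale z₀.1 z₀.2 hm hr
  have hS' := hS.mono (G' := G) (κ' := 1) (D' := unitCyl n) (by field_simp; rfl)
    (by field_simp; rfl) hmaps
  have hcont : ContinuousOn (fun z => (9 / 8 * v z₀ - v (pscale z₀.1 z₀.2 r z)) / (v z₀ / 8))
      (unitCyl n) :=
    (continuousOn_const.sub (hvc.comp (continuous_pscale _ _ _).continuousOn hmaps)).div_const _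
  have hps : pscale z₀.1 z₀.2 r (0, 0) = z₀ := by simp [pscale]
  have h1 := hSL _ hcont (fun z hz => div_nonneg (by linarith [hle z hz]) hm.le) hS' (by
    rw [hps, div_le_one hm]; linarith)
  have hsub : {z | z ∈ unitCyl n ∧
      (9 / 8 * v z₀ - v (pscale z₀.1 z₀.2 r z)) / (v z₀ / 8) ≤ 3} ⊆
      pscale z₀.1 z₀.2 r ⁻¹' {w | w ∈ pscale z₀.1 z₀.2 r '' unitCyl n ∧ 3 / 4 * v z₀ ≤ v w} := by
    rintro z ⟨hz1, hz2⟩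
    refine ⟨mem_image_of_mem _ hz1, ?_⟩
    rw [div_le_iff₀ hm] at hz2
    linarith
  have h2 := h1.trans ((MeasureTheory.measure_mono hsub).trans
    (volume_preimage_pscale_le z₀.1 z₀.2 hr _))
  have h3 := mul_le_mul_right h2 (ENNReal.ofReal (r ^ (n + 2)))
  rw [← mul_assoc, ← ENNReal.ofReal_mul (by positivity), ← ENNReal.ofReal_mul (by positivity),
    mul_inv_cancel₀ (by positivity), ENNReal.ofReal_one, one_mul, mul_comm] at h3
  exact h3

lemma exists_weighted_max {n : ℕ} {T M₀ : ℝ} {γ : ℕ} (hγ : γ ≠ 0) {v : Sp n × ℝ → ℝ} (hT : 1 ≤ T)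
    (hvc : ContinuousOn v (dom n T)) (hv : ∀ z ∈ dom n T, 0 ≤ v z) (hM₀ : 0 < M₀)
    (h : M₀ ≤ v (cubeCenter n, 1 / 2)) :
    ∃ (z₀ : Sp n × ℝ) (d : ℝ), 0 < d ∧ d ≤ 1 / 4 ∧ ‖z₀.1 - cubeCenter n‖ + d ≤ 1 / 4 ∧ d ≤ z₀.2 ∧
      z₀.2 ≤ 1 / 2 ∧ M₀ * (1 / 4) ^ γ ≤ v z₀ * d ^ γ ∧
      ∀ (z : Sp n × ℝ) (e : ℝ), 0 ≤ e → ‖z.1 - cubeCenter n‖ + e ≤ 1 / 4 → e ≤ z.2 → z.2 ≤ 1 / 2 →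
        v z * e ^ γ ≤ v z₀ * d ^ γ := by
  have hn : (0 : ℝ) ≤ n := n.cast_nonneg
  obtain ⟨Z, hZ⟩ : ∃ Z : Set (Sp n × ℝ),
    Z = Metric.closedBall (cubeCenter n) (1 / 4) ×ˢ Icc 0 (1 / 2) := ⟨_, rfl⟩
  have hZc : IsCompact Z := by
    rw [hZ]; exact (isCompact_closedBall _ _).prod isCompact_Icc
  have hsub : Z ⊆ dom n T := by
    rw [hZ]
    exact prod_mono (Metric.closedBall_subset_closedBall (by linarith))
      (Icc_subset_Icc le_rfl (by linarith))
  obtain ⟨D, hD⟩ : ∃ D : Sp n × ℝ → ℝ, D = fun z => min (1 / 4 - ‖z.1 - cubeCenter n‖) z.2 :=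
    ⟨_, rfl⟩
  have hDc : Continuous D := by rw [hD]; fun_prop
  have hcZ : (cubeCenter n, 1 / 2) ∈ Z := by
    rw [hZ]
    exact ⟨Metric.mem_closedBall_self (by norm_num), by norm_num, le_rfl⟩
  obtain ⟨z₀, hz₀, hmax⟩ := hZc.exists_isMaxOn ⟨_, hcZ⟩
    ((hvc.mono hsub).mul (hDc.pow γ).continuousOn)
  have hDz : ∀ z ∈ Z, 0 ≤ D z := by
    rintro z hz
    rw [hZ] at hz
    rw [hD]
    exact le_min (by linarith [mem_closedBall_iff_norm.1 hz.1]) hz.2.1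
  have hDcen : D (cubeCenter n, 1 / 2) = 1 / 4 := by
    rw [hD]
    simp only [sub_self, norm_zero, sub_zero]
    norm_num
  have h0 : M₀ * (1 / 4) ^ γ ≤ v z₀ * D z₀ ^ γ := by
    have h1 := hmax hcZ
    simp only [mem_ofPred_eq, Pi.mul_apply, Pi.pow_apply, hDcen] at h1
    exact (mul_le_mul_of_nonneg_right h (by positivity)).trans h1
  have hDl : D z₀ ≤ 1 / 4 - ‖z₀.1 - cubeCenter n‖ := by rw [hD]; exact min_le_left _ _
  have hDr : D z₀ ≤ z₀.2 := by rw [hD]; exact min_le_right _ _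
  have hD0 : 0 < D z₀ := by
    refine lt_of_le_of_ne (hDz z₀ hz₀) fun heq => ?_
    rw [← heq, zero_pow hγ, mul_zero] at h0
    have : 0 < M₀ * (1 / 4) ^ γ := by positivity
    linarith
  have hz₀' := hz₀
  rw [hZ] at hz₀'
  refine ⟨z₀, D z₀, hD0, by linarith [norm_nonneg (z₀.1 - cubeCenter n)], by linarith, hDr,
    hz₀'.2.2, h0, ?_⟩
  intro z e he h1 h2 h3
  have hz : z ∈ Z := by
    rw [hZ]
    exact ⟨mem_closedBall_iff_norm.2 (by linarith), by linarith, h3⟩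
  have heD : e ≤ D z := by rw [hD]; exact le_min (by linarith) h2
  exact (mul_le_mul_of_nonneg_left (pow_le_pow_left₀ he heD γ) (hv z (hsub hz))).trans (hmax hz)

lemma exists_center_le (n : ℕ) {lam Lam : ℝ} (hlam : 0 < lam) (hLam : lam ≤ Lam) :
    ∃ N > 1, ∃ G > 0, ∃ κ > 0, ∃ G₁ > 0, ∃ C > 0, ∃ γ : ℕ, ∃ M₀ > 0,
      ∀ (v : Sp n × ℝ → ℝ) (p : Sp n × ℝ), Normalized n lam Lam G κ N p.2 v →
        Reflected n lam Lam G₁ C p.2 γ v → p.1 ∈ unitCube n → 5 ≤ p.2 →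
        p.2 ≤ (3 * n + 6) ^ 2 + 1 → v p ≤ 1 → v (cubeCenter n, 1 / 2) ≤ M₀ := by
  obtain ⟨N, hN, G, hG, κ, hκ, θ, ⟨hθ0, hθ1⟩, k₀, hdecay⟩ := exists_decay n hlam hLam
  obtain ⟨G₁, hG₁, μ, hμ, hSL⟩ := exists_sliding n hlam hLam
  have hn : (0 : ℝ) ≤ n := n.cast_nonneg
  obtain ⟨q, hq0, hq1, hqθ⟩ : ∃ q : ℝ, 0 < q ∧ q < 1 ∧ θ ≤ q ^ (n + 2) := by
    refine ⟨1 + (-((1 - θ) / (n + 2))), ?_, ?_, ?_⟩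
    · have : (1 - θ) / (n + 2) < 1 := by rw [div_lt_one (by positivity)]; linarith
      linarith
    · have : 0 < (1 - θ) / (n + 2) := div_pos (by linarith) (by positivity)
      linarith
    · have h1 : (1 - θ) / (n + 2) ≤ 1 := by rw [div_le_one (by positivity)]; linarith
      have := one_add_mul_le_pow (a := -((1 - θ) / (n + 2))) (by linarith) (n + 2)
      refine le_trans (le_of_eq ?_) this
      push_cast
      field_simp
      ring
  obtain ⟨γ, hγ0, hγ⟩ : ∃ γ : ℕ, γ ≠ 0 ∧ N * q ^ γ ≤ 1 := by
    obtain ⟨g, hg⟩ := exists_pow_lt_of_lt_one (show 0 < 1 / N by positivity) hq1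
    refine ⟨g + 1, by omega, ?_⟩
    rw [lt_div_iff₀ (by linarith)] at hg
    have : q ^ (g + 1) ≤ q ^ g := pow_le_pow_of_le_one hq0.le hq1.le (by omega)
    have := mul_le_mul_of_nonneg_left this (by linarith : 0 ≤ N)
    linarith
  have hγ1 : (1 : ℝ) ≤ γ := by exact_mod_cast Nat.one_le_iff_ne_zero.2 hγ0
  obtain ⟨A, hA⟩ : ∃ A : ℝ, A = max 1 (3 / μ) := ⟨_, rfl⟩
  have hA1 : 1 ≤ A := by rw [hA]; exact le_max_left _ _
  have hAμ : 3 ≤ μ * A ^ (n + 2) := by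
    have h1 : 3 / μ ≤ A := by rw [hA]; exact le_max_right _ _
    have h2 : A ≤ A ^ (n + 2) := le_self_pow₀ hA1 (by omega)
    rw [div_le_iff₀ hμ] at h1
    have := mul_le_mul_of_nonneg_left h2 hμ.le
    linarith
  obtain ⟨K, hK⟩ : ∃ K : ℝ, K = 4 / 3 * N ^ (k₀ + 1) := ⟨_, rfl⟩
  have hK0 : 0 < K := by rw [hK]; positivity
  obtain ⟨τ, hτ⟩ : ∃ τ : ℝ, τ = 1 / (9 * γ) := ⟨_, rfl⟩
  have hτ0 : 0 < τ := by rw [hτ]; positivity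
  have hτγ : τ * γ = 1 / 9 := by rw [hτ]; field_simp
  have hτ1 : τ ≤ 1 := by
    have := mul_le_mul_of_nonneg_left hγ1 hτ0.le
    linarith
  have hτp : 8 / 9 ≤ (1 - τ) ^ γ := by
    have := one_add_mul_le_pow (a := -τ) (by linarith) γ
    rw [← sub_eq_add_neg] at this
    refine le_trans (le_of_eq ?_) this
    linarith
  obtain ⟨M₀, hM₀⟩ : ∃ M : ℝ, M = K * (4 * A / τ) ^ γ + 2 * N ^ k₀ := ⟨_, rfl⟩
  have hNk : 1 ≤ N ^ k₀ := one_le_pow₀ hN.le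
  have hM₀1 : K * (4 * A / τ) ^ γ ≤ M₀ := by rw [hM₀]; linarith
  have hM₀2 : 2 * N ^ k₀ ≤ M₀ := by
    have : 0 < K * (4 * A / τ) ^ γ := by positivity
    rw [hM₀]; linarith
  have hM₀0 : 0 < M₀ := by linarith
  refine ⟨N, hN, G, hG, κ, hκ, G₁, hG₁, K * A ^ γ, by positivity, γ, M₀, hM₀0, ?_⟩
  intro v p hV hR hp1 hp2 hp3 hvp
  by_contra hcon
  push Not at hcon
  obtain ⟨z₀, d, hd0, hd1, hz1, hz2, hz3, hmax0, hmax⟩ :=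
    exists_weighted_max hγ0 (by linarith) hV.cont hV.nonneg hM₀0 hcon.le
  have hdγ : d ^ γ ≤ (1 / 4) ^ γ := pow_le_pow_left₀ hd0.le hd1 _
  have hMge : M₀ ≤ v z₀ := by
    have h4 : (0 : ℝ) < (1 / 4) ^ γ := by positivity
    have hv0 : 0 ≤ v z₀ := by
      by_contra hneg
      push Not at hneg
      have h1 : v z₀ * d ^ γ < 0 := mul_neg_of_neg_of_pos hneg (by positivity)
      have h2 : 0 < M₀ * (1 / 4) ^ γ := by positivity
      linarith
    exact le_of_mul_le_mul_right (hmax0.trans (mul_le_mul_of_nonneg_left hdγ hv0)) h4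
  obtain ⟨j, hj1, hj2⟩ : ∃ j : ℕ, N ^ (k₀ + j) < 3 / 4 * v z₀ ∧ 3 / 4 * v z₀ ≤ N ^ (k₀ + j + 1) := by
    have hex : ∃ i : ℕ, 3 / 4 * v z₀ ≤ N ^ (k₀ + i) := by
      obtain ⟨i, hi⟩ := pow_unbounded_of_one_lt (3 / 4 * v z₀) hN
      exact ⟨i, hi.le.trans (pow_le_pow_right₀ hN.le (by omega))⟩
    classical
    have h0 : Nat.find hex ≠ 0 := by
      intro h
      have := Nat.find_spec hex
      rw [h, add_zero] at this
      linarith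
    obtain ⟨i, hi⟩ : ∃ i, Nat.find hex = i + 1 := ⟨Nat.find hex - 1, by omega⟩
    refine ⟨i, not_le.1 (Nat.find_min hex (by omega)), ?_⟩
    have := Nat.find_spec hex
    rw [hi] at this
    exact this
  obtain ⟨r, hr⟩ : ∃ r : ℝ, r = A * q ^ j := ⟨_, rfl⟩
  have hr0 : 0 < r := by rw [hr]; positivity
  have hMK : v z₀ * (q ^ j) ^ γ ≤ K := by
    have h1 : v z₀ ≤ K * N ^ j := by
      rw [hK]
      have : N ^ (k₀ + j + 1) = N ^ (k₀ + 1) * N ^ j := by ring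
      linarith
    have h2 : N ^ j * (q ^ j) ^ γ ≤ 1 := by
      rw [← pow_mul, mul_comm j γ, pow_mul, ← mul_pow]
      exact pow_le_one₀ (by positivity) hγ
    calc v z₀ * (q ^ j) ^ γ ≤ K * N ^ j * (q ^ j) ^ γ := by gcongr
      _ = K * (N ^ j * (q ^ j) ^ γ) := by ring
      _ ≤ K * 1 := by gcongr
      _ = K := mul_one K
  have hrd : r ≤ τ * d := by
    refine le_of_pow_le_pow_left₀ hγ0 (by positivity) ?_
    have hvz : 0 < v z₀ := by linarith
    have h1 : K * (4 * A / τ) ^ γ * (1 / 4) ^ γ ≤ v z₀ * d ^ γ :=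
      (mul_le_mul_of_nonneg_right hM₀1 (by positivity)).trans hmax0
    have h2 : K * (4 * A / τ) ^ γ * (1 / 4) ^ γ * τ ^ γ = K * A ^ γ := by
      rw [mul_assoc, mul_assoc, ← mul_pow, ← mul_pow]
      congr 2
      field_simp
    have h3 : K * A ^ γ ≤ v z₀ * (τ * d) ^ γ := by
      rw [← h2]
      refine (mul_le_mul_of_nonneg_right h1 (by positivity)).trans_eq ?_
      rw [mul_pow]; ring
    have h4 : v z₀ * r ^ γ ≤ K * A ^ γ := by
      rw [hr, mul_pow]
      have := mul_le_mul_of_nonneg_right hMK (by positivity : 0 ≤ A ^ γ)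
      linarith
    exact le_of_mul_le_mul_left (h4.trans h3) hvz
  have hr1 : r ≤ 1 := by
    have := mul_le_mul_of_nonneg_right hτ1 hd0.le
    linarith
  have hrr : r ^ 2 ≤ r := by rw [pow_two]; exact mul_le_of_le_one_left hr0.le hr1
  have hin : ∀ z ∈ unitCyl n, ‖(pscale z₀.1 z₀.2 r z).1 - cubeCenter n‖ + (1 - τ) * d ≤ 1 / 4 ∧
      (1 - τ) * d ≤ (pscale z₀.1 z₀.2 r z).2 ∧ (pscale z₀.1 z₀.2 r z).2 ≤ 1 / 2 := by
    rintro z ⟨h1, h2, h3⟩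
    have hx : ‖z₀.1 + r • z.1 - cubeCenter n‖ ≤ ‖z₀.1 - cubeCenter n‖ + r := by
      have e : z₀.1 + r • z.1 - cubeCenter n = (z₀.1 - cubeCenter n) + r • z.1 := by abel
      rw [e]
      refine (norm_add_le _ _).trans ?_
      rw [norm_smul, Real.norm_of_nonneg hr0.le]
      have := mul_le_of_le_one_right hr0.le (mem_closedBall_zero_iff.1 h1)
      linarith
    have ht1 : r ^ 2 * (-1) ≤ r ^ 2 * z.2 := mul_le_mul_of_nonneg_left h2 (by positivity)
    have ht2 : r ^ 2 * z.2 ≤ 0 := mul_nonpos_of_nonneg_of_nonpos (by positivity) h3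
    simp only [pscale]
    refine ⟨?_, ?_, ?_⟩ <;> linarith
  have hτd : 0 ≤ (1 - τ) * d := mul_nonneg (by linarith) hd0.le
  have hvol := hR.volume_ge hSL hV.cont hr0 hr1 (by linarith) (by
      rw [hr, mul_pow]
      have := mul_le_mul_of_nonneg_right hMK (by positivity : 0 ≤ A ^ γ)
      linarith) (fun z hz => by
      obtain ⟨h1, h2, h3⟩ := hin z hz
      refine ⟨mem_closedBall_iff_norm.2 ?_, ?_, ?_⟩ <;> linarith) (fun z hz => by
      obtain ⟨h1, h2, h3⟩ := hin z hz
      have h4 := hmax _ _ hτd h1 h2 h3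
      have hdp : 0 < d ^ γ := by positivity
      rw [mul_pow, ← mul_assoc] at h4
      have h5 := le_of_mul_le_mul_right h4 hdp
      by_contra hlt
      push Not at hlt
      have h6 : 9 / 8 * v z₀ * (8 / 9) < v (pscale z₀.1 z₀.2 r z) * (8 / 9) := by linarith
      have h7 := mul_le_mul_of_nonneg_left hτp
        (by linarith : 0 ≤ v (pscale z₀.1 z₀.2 r z))
      linarith)
  have hsub : {w | w ∈ pscale z₀.1 z₀.2 r '' unitCyl n ∧ 3 / 4 * v z₀ ≤ v w} ⊆
      superlevel N v (k₀ + j) := by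
    rintro w ⟨⟨z, hz, rfl⟩, hw⟩
    obtain ⟨h1, h2, h3⟩ := hin z hz
    have hp : (1 : ℝ) ≤ 2 ^ (k₀ + j) := one_le_pow₀ (by norm_num)
    refine ⟨fun i => ?_, by linarith, ?_, by linarith⟩
    · have h4 := PiLp.norm_apply_le ((pscale z₀.1 z₀.2 r z).1 - cubeCenter n) i
      have e : ((pscale z₀.1 z₀.2 r z).1 - cubeCenter n) i =
        (pscale z₀.1 z₀.2 r z).1 i - 1 / 2 := rfl
      rw [e, Real.norm_eq_abs] at h4
      have h5 := abs_le.1 h4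
      constructor <;> linarith [h5.1, h5.2]
    · have := mul_le_mul_of_nonneg_right h3 (by linarith : (0 : ℝ) ≤ 2 ^ (k₀ + j))
      linarith
  have hfin := hvol.trans ((MeasureTheory.measure_mono hsub).trans
    (hdecay v p hV hp1 hp2 hp3 hvp j))
  have hθj : 0 < θ ^ j := by positivity
  rw [ENNReal.ofReal_le_ofReal_iff (by positivity), hr, mul_pow, ← pow_mul, mul_comm j (n + 2),
    pow_mul, ← mul_assoc] at hfin
  have h1 : θ ^ j ≤ (q ^ (n + 2)) ^ j := pow_le_pow_left₀ hθ0.le hqθ j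
  have h2 := mul_le_mul hAμ h1 hθj.le (by linarith)
  linarith

/-- The logarithm of the nonlinearity in logarithmic coordinates. -/
noncomputable def logEta (φ : ℝ → ℝ) (x : ℝ) : ℝ := Real.log (φ (Real.exp x)) - x

lemma PhiEta.phi_pos {φ η : ℝ → ℝ} {Λ₀ : ℝ} (h : PhiEta φ η Λ₀) {t : ℝ} (ht : 0 < t) : 0 < φ t :=
  ht.trans_le (h.phi_ge t ht.le)

lemma PhiEta.eta_eq_exp {φ η : ℝ → ℝ} {Λ₀ : ℝ} (h : PhiEta φ η Λ₀) (x : ℝ) :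
    η (Real.exp x) = Real.exp (logEta φ x) := by
  have hx := Real.exp_pos x
  rw [logEta, Real.exp_sub, Real.exp_log (h.phi_pos hx), h.phi_eq _ hx]
  field_simp

lemma PhiEta.logEta_eq {φ η : ℝ → ℝ} {Λ₀ : ℝ} (h : PhiEta φ η Λ₀) (x : ℝ) :
    logEta φ x = Real.log (η (Real.exp x)) := by
  rw [h.eta_eq_exp, Real.log_exp]

lemma PhiEta.logEta_nonneg {φ η : ℝ → ℝ} {Λ₀ : ℝ} (h : PhiEta φ η Λ₀) (x : ℝ) :
    0 ≤ logEta φ x := by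
  rw [h.logEta_eq]
  exact Real.log_nonneg (h.eta_ge_one _ (Real.exp_pos x))

lemma PhiEta.absolutelyContinuousOnInterval {φ η : ℝ → ℝ} {Λ₀ : ℝ} (h : PhiEta φ η Λ₀) {a b : ℝ}
    (hab : a ≤ b) : AbsolutelyContinuousOnInterval (fun x => logEta φ x ^ 2) a b := by
  obtain ⟨K₁, hK₁⟩ := (Real.contDiff_exp (n := 1)).contDiffOn.exists_lipschitzOnWith one_ne_zero
    (convex_Icc a b) isCompact_Icc
  obtain ⟨K₂, hK₂⟩ := (h.phi_lip.mono (fun t (ht : t ∈ Icc (Real.exp a) (Real.exp b)) =>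
    (Real.exp_pos a).trans_le ht.1)).exists_lipschitzOnWith_of_compact isCompact_Icc
  have hφ : ∀ t ∈ Icc (φ (Real.exp a)) (φ (Real.exp b)), t ≠ 0 := fun t ht =>
    ((h.phi_pos (Real.exp_pos a)).trans_le ht.1).ne'
  obtain ⟨K₃, hK₃⟩ := ((Real.contDiffOn_log (n := 1)).mono hφ).exists_lipschitzOnWith one_ne_zero
    (convex_Icc _ _) isCompact_Icc
  have hm1 : MapsTo Real.exp (Icc a b) (Icc (Real.exp a) (Real.exp b)) := fun x hx =>
    ⟨Real.exp_le_exp.2 hx.1, Real.exp_le_exp.2 hx.2⟩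
  have hm2 : MapsTo φ (Icc (Real.exp a) (Real.exp b)) (Icc (φ (Real.exp a)) (φ (Real.exp b))) :=
    fun t ht => by
      have ha := Real.exp_pos a
      have h0 : 0 ≤ t := ha.le.trans ht.1
      exact ⟨h.phi_mono ha.le h0 ht.1, h.phi_mono h0 (h0.trans ht.2) ht.2⟩
  have h1 := (hK₃.comp (hK₂.comp hK₁ hm1) (hm2.comp hm1))
  rw [← uIcc_of_le hab] at h1
  have h2 := h1.absolutelyContinuousOnInterval.sub
    (LipschitzWith.id.lipschitzOnWith (s := uIcc a b)).absolutelyContinuousOnInterval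
  convert h2.mul h2 using 1
  ext x
  exact pow_two _

lemma PhiEta.deriv_logEta_sq_le {φ η : ℝ → ℝ} {Λ₀ : ℝ} (h : PhiEta φ η Λ₀) :
    ∀ᶠ x in atTop, deriv (fun x => logEta φ x ^ 2) x ≤ 1 := by
  have h2 := (h.cond_P2.comp Real.tendsto_exp_atTop).eventually
    (gt_mem_nhds (show (0 : ℝ) < 1 / 2 by norm_num))
  filter_upwards [h2] with x hx
  by_cases hd : DifferentiableAt ℝ (fun x => logEta φ x ^ 2) x
  swap
  · rw [deriv_zero_of_not_differentiableAt hd]; norm_num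
  rcases (h.logEta_nonneg x).eq_or_lt with h0 | h0
  · have : IsLocalMin (fun x => logEta φ x ^ 2) x := by
      filter_upwards with y
      rw [← h0, zero_pow two_ne_zero]
      positivity
    rw [this.deriv_eq_zero]
    norm_num
  · have hx0 := Real.exp_pos x
    have e1 : η =ᶠ[nhds (Real.exp x)]
        fun t => Real.exp (Real.sqrt (logEta φ (Real.log t) ^ 2)) := by
      filter_upwards [lt_mem_nhds hx0] with t ht
      rw [Real.sqrt_sq (h.logEta_nonneg _), ← h.eta_eq_exp, Real.exp_log ht]
    have hη : DifferentiableAt ℝ η (Real.exp x) := by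
      refine DifferentiableAt.congr_of_eventuallyEq ?_ e1
      have hlog : DifferentiableAt ℝ Real.log (Real.exp x) := Real.differentiableAt_log hx0.ne'
      have hd' : DifferentiableAt ℝ (fun x => logEta φ x ^ 2) (Real.log (Real.exp x)) := by
        rwa [Real.log_exp]
      refine ((hd'.comp (Real.exp x) hlog).sqrt ?_).exp
      simp only [Function.comp, Real.log_exp]
      positivity
    have e2 : (fun x => logEta φ x ^ 2) = fun x => Real.log (η (Real.exp x)) ^ 2 := by
      ext y; rw [h.logEta_eq]
    have hη0 : η (Real.exp x) ≠ 0 := by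
      have := h.eta_ge_one _ hx0
      linarith
    have hder := ((hη.hasDerivAt.comp x (Real.hasDerivAt_exp x)).log hη0).pow 2
    have hder' := hder.deriv
    simp only [Function.comp] at hx hder'
    rw [e2]
    have e3 : deriv (fun x => Real.log (η (Real.exp x)) ^ 2) x =
      2 * (Real.exp x * deriv η (Real.exp x) / η (Real.exp x) * Real.log (η (Real.exp x))) := by
      refine Eq.trans hder' ?_
      push_cast
      ring
    rw [e3]
    linarith

lemma PhiEta.exists_logEta_sq_le {φ η : ℝ → ℝ} {Λ₀ : ℝ} (h : PhiEta φ η Λ₀) :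
    ∃ X ≥ 0, ∀ x y : ℝ, X ≤ x → x ≤ y → logEta φ y ^ 2 ≤ logEta φ x ^ 2 + (y - x) := by
  obtain ⟨X, hX⟩ := eventually_atTop.1 h.deriv_logEta_sq_le
  refine ⟨max X 0, le_max_right _ _, fun x y hx hxy => ?_⟩
  have hac := h.absolutelyContinuousOnInterval hxy
  have h1 := hac.integral_deriv_eq_sub
  have h2 : ∫ t in x..y, deriv (fun x => logEta φ x ^ 2) t ≤ ∫ _ in x..y, (1 : ℝ) :=
    intervalIntegral.integral_mono_on hxy hac.intervalIntegrable_deriv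
      intervalIntegrable_const fun t ht => hX t (((le_max_left _ _).trans hx).trans ht.1)
  rw [h1, intervalIntegral.integral_const, smul_eq_mul, mul_one] at h2
  linarith

lemma PhiEta.exists_eta_pow_le {φ η : ℝ → ℝ} {Λ₀ : ℝ} (h : PhiEta φ η Λ₀) (q : ℕ) :
    ∃ C > 0, ∀ t ≥ 1, η t ^ q ≤ C * t := by
  obtain ⟨X, hX, hg⟩ := h.exists_logEta_sq_le
  obtain ⟨A, hA⟩ : ∃ A : ℝ, A = logEta φ X ^ 2 := ⟨_, rfl⟩
  have hA0 : 0 ≤ A := by rw [hA]; positivity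
  have key : ∀ x ≥ 0, q * logEta φ x ≤ (q ^ 2 + A) + x := by
    intro x hx
    have h1 : ∀ y ≥ X, q * logEta φ y ≤ (q ^ 2 + A) + (y - X) := by
      intro y hy
      have h2 := hg X y le_rfl hy
      rw [← hA] at h2
      have h3 := sq_nonneg (logEta φ y - q)
      have h4 : (0 : ℝ) ≤ (q : ℝ) ^ 2 + logEta φ y ^ 2 := by positivity
      have h5 : (logEta φ y - q) ^ 2 = logEta φ y ^ 2 - 2 * (q * logEta φ y) + q ^ 2 := by ring
      linarith
    rcases le_total X x with h2 | h2
    · linarith [h1 x h2]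
    · have h3 := h1 X le_rfl
      have h4 : logEta φ x ≤ logEta φ X := by
        rw [h.logEta_eq, h.logEta_eq]
        have hx1 : 1 ≤ Real.exp x := Real.one_le_exp hx
        have hx2 := Real.exp_le_exp.2 h2
        exact Real.log_le_log (by linarith [h.eta_ge_one _ (Real.exp_pos x)])
          (h.eta_mono hx1 (hx1.trans hx2) hx2)
      have h5 := mul_le_mul_of_nonneg_left h4 (q.cast_nonneg : (0 : ℝ) ≤ q)
      linarith
  refine ⟨Real.exp (q ^ 2 + A), Real.exp_pos _, fun t ht => ?_⟩
  have ht0 : 0 < t := by linarith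
  have h1 := Real.exp_le_exp.2 (key (Real.log t) (Real.log_nonneg ht))
  rw [Real.exp_add, Real.exp_log ht0, Real.exp_nat_mul, ← h.eta_eq_exp, Real.exp_log ht0] at h1
  exact h1

lemma PhiEta.exists_eta_mul_eta_le {φ η : ℝ → ℝ} {Λ₀ : ℝ} (h : PhiEta φ η Λ₀) :
    ∃ C ≥ 1, ∀ t ≥ 1, η (t * η t) ≤ C * η t := by
  obtain ⟨X, hX, hg⟩ := h.exists_logEta_sq_le
  obtain ⟨T, hT⟩ : ∃ T, T = Real.exp X := ⟨_, rfl⟩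
  have hT1 : 1 ≤ T := by rw [hT]; exact Real.one_le_exp hX
  have hηT := h.eta_ge_one T (by linarith)
  have hTT : 1 ≤ T * η T := one_le_mul_of_one_le_of_one_le hT1 hηT
  refine ⟨max (Real.exp 1) (η (T * η T)), le_max_of_le_right (h.eta_ge_one _ (by linarith)),
    fun t ht => ?_⟩
  have hηt := h.eta_ge_one t (by linarith)
  have htt : 1 ≤ t * η t := one_le_mul_of_one_le_of_one_le ht hηt
  rcases le_total T t with hle | hle
  · obtain ⟨x, rfl⟩ : ∃ x, t = Real.exp x := ⟨Real.log t, (Real.exp_log (by linarith)).symm⟩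
    have hXx : X ≤ x := by rw [hT] at hle; exact Real.exp_le_exp.1 hle
    have h0 := h.logEta_nonneg x
    have h1 := hg x (x + logEta φ x) hXx (by linarith)
    have h2 : logEta φ (x + logEta φ x) ≤ 1 + logEta φ x := by
      refine le_of_sq_le_sq ?_ (by linarith)
      have : (1 + logEta φ x) ^ 2 = 1 + 2 * logEta φ x + logEta φ x ^ 2 := by ring
      linarith
    have h3 := Real.exp_le_exp.2 h2
    rw [Real.exp_add, ← h.eta_eq_exp, ← h.eta_eq_exp, Real.exp_add, ← h.eta_eq_exp] at h3
    exact h3.trans (mul_le_mul_of_nonneg_right (le_max_left _ _) (by linarith))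
  · have h1 : η t ≤ η T := h.eta_mono ht (ht.trans hle) hle
    have h2 : t * η t ≤ T * η T := mul_le_mul hle h1 (by linarith) (by linarith)
    have h3 := h.eta_mono htt hTT h2
    have h4 : 0 ≤ max (Real.exp 1) (η (T * η T)) := le_max_of_le_left (Real.exp_pos _).le
    have h5 := le_mul_of_one_le_right h4 hηt
    exact (h3.trans (le_max_right _ _)).trans h5

/-- Smallness of the rescaled nonlinearity below the intrinsic scale. -/
lemma PhiEta.exists_scale_le {φ η : ℝ → ℝ} {Λ₀ : ℝ} (h : PhiEta φ η Λ₀) {G κ C₁ C₂ : ℝ}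
    (hG : 0 < G) (hκ : 0 < κ) (hC₁ : 0 < C₁) (hC₂ : 0 < C₂) (P : ℕ) :
    ∃ C > 0, ∀ M ρ s r L : ℝ, 0 < M → 0 < r → r ≤ s → s ≤ ρ → ρ ≤ M / (C * (φ M + M)) →
      M / C₂ ≤ L → L * r ^ P ≤ C₁ * M * s ^ P → φ (G * L / r) ≤ κ * L / r ^ 2 := by
  obtain ⟨A, hA, hηη⟩ := h.exists_eta_mul_eta_le
  obtain ⟨B, hB, hηpow⟩ := h.exists_eta_pow_le (2 * (P + 1))
  have hΛ := h.lam0_ge_one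
  obtain ⟨D, hD⟩ : ∃ D : ℝ, D = max 1 (B * (G * C₁)) := ⟨_, rfl⟩
  have hD1 : 1 ≤ D := by rw [hD]; exact le_max_left _ _
  obtain ⟨E, hE⟩ : ∃ E : ℝ, E = κ / (G * (Λ₀ * A)) := ⟨_, rfl⟩
  have hE0 : 0 < E := by rw [hE]; positivity
  obtain ⟨C, hC⟩ : ∃ C : ℝ, C = 1 + C₂ / G + 1 / E + D / E ^ 2 := ⟨_, rfl⟩
  have hC₂G : 0 < C₂ / G := by positivity
  have h1E : 0 < 1 / E := by positivity
  have hDE : 0 < D / E ^ 2 := by positivity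
  have hC0 : 0 < C := by rw [hC]; positivity
  have hC_1 : 1 ≤ C := by linarith
  have hC_2 : C₂ / G ≤ C := by linarith
  have hC_3 : 1 ≤ C * E := by
    have : 1 / E ≤ C := by linarith
    rwa [div_le_iff₀ hE0] at this
  have hC_4 : D ≤ C * E ^ 2 := by
    have : D / E ^ 2 ≤ C := by linarith
    rwa [div_le_iff₀ (by positivity)] at this
  refine ⟨C, hC0, fun M ρ s r L hM hr hrs hsρ hρ hL hLr => ?_⟩
  have hs0 : 0 < s := hr.trans_le hrs
  have hηM := h.eta_ge_one M hM
  have hsC : s * (η M + 1) * C ≤ 1 := by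
    rw [h.phi_eq M hM, le_div_iff₀ (by positivity)] at hρ
    have h1 : s * (C * (η M * M + M)) ≤ M :=
      (mul_le_mul_of_nonneg_right hsρ (by positivity)).trans hρ
    have h2 : s * (η M + 1) * C * M ≤ 1 * M := by linarith
    exact le_of_mul_le_mul_right h2 hM
  have hsη : s * η M * C ≤ 1 := by
    have : 0 ≤ s * C := by positivity
    linarith
  have hs1 : s * C ≤ 1 := by
    have : 0 ≤ s * η M * C := by positivity
    linarith
  have hsle : s ≤ 1 := by
    have := mul_le_mul_of_nonneg_left hC_1 hs0.le
    linarith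
  have hL0 : 0 < L := lt_of_lt_of_le (by positivity) hL
  obtain ⟨y, hy⟩ : ∃ y : ℝ, y = G * L / r := ⟨_, rfl⟩
  have hy0 : 0 < y := by rw [hy]; positivity
  have hMy : M ≤ y := by
    rw [hy, le_div_iff₀ hr]
    have h1 : M * r * C ≤ M := by
      have h1 := mul_le_mul_of_nonneg_right hrs hC0.le
      have h2 := mul_le_mul_of_nonneg_left (h1.trans hs1) hM.le
      linarith
    rw [div_le_iff₀ hC₂] at hL
    rw [div_le_iff₀ hG] at hC_2
    have h3 : M * r * C₂ ≤ M * r * (C * G) := mul_le_mul_of_nonneg_left hC_2 (by positivity)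
    have h4 := mul_le_mul_of_nonneg_right h1 hG.le
    have h5 := mul_le_mul_of_nonneg_left hL hG.le
    have h6 : M * r * C₂ ≤ G * L * C₂ := by linarith
    exact le_of_mul_le_mul_right h6 hC₂
  -- it suffices to bound `η y * r`
  suffices hmain : η y * r ≤ Λ₀ * A * E by
    rw [← hy, h.phi_eq y hy0]
    have h1 : Λ₀ * A * E = κ / G := by rw [hE]; field_simp
    rw [h1, le_div_iff₀ hG] at hmain
    rw [le_div_iff₀ (by positivity)]
    have hyr : y * r = G * L := by rw [hy]; field_simp
    have h2 : η y * y * r ^ 2 = η y * r * G * L := by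
      rw [mul_assoc, mul_assoc, ← hyr]; ring
    rw [h2]
    exact mul_le_mul_of_nonneg_right hmain hL0.le
  have hΛA : 1 ≤ Λ₀ * A := one_le_mul_of_one_le_of_one_le hΛ hA
  have hbase : η M * r ≤ E := by
    have h1 : η M * r ≤ s * η M := by
      rw [mul_comm]; exact mul_le_mul_of_nonneg_right hrs (by linarith)
    have h2 : s * η M * 1 ≤ s * η M * (C * E) :=
      mul_le_mul_of_nonneg_left hC_3 (by positivity)
    have h3 := mul_le_mul_of_nonneg_right hsη hE0.le
    linarith
  have hE1 : E ≤ Λ₀ * A * E := le_mul_of_one_le_left hE0.le hΛA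
  have hpow : ∀ w Y : ℝ, 1 ≤ w → 0 < Y → Y * C ≤ 1 → w * Y ^ (P + 1) ≤ G * C₁ → η w * Y ≤ E := by
    intro w Y hw hY hYC hwY
    have hηw := h.eta_ge_one w (by linarith)
    have h1 : (η w ^ 2 * Y) ^ (P + 1) ≤ D ^ (P + 1) := by
      rw [mul_pow, ← pow_mul]
      have h2 := mul_le_mul_of_nonneg_right (hηpow w hw) (by positivity : 0 ≤ Y ^ (P + 1))
      have h3 := mul_le_mul_of_nonneg_left hwY hB.le
      have h4 : B * (G * C₁) ≤ D := by rw [hD]; exact le_max_right _ _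
      have h5 : D ≤ D ^ (P + 1) := le_self_pow₀ hD1 (by omega)
      linarith
    have h2 : η w ^ 2 * Y ≤ D := le_of_pow_le_pow_left₀ (by omega) (by linarith) h1
    refine le_of_sq_le_sq ?_ hE0.le
    have h3 := mul_le_mul_of_nonneg_right (h2.trans hC_4) hY.le
    have h4 := mul_le_mul_of_nonneg_left hYC (by positivity : 0 ≤ E ^ 2)
    have h5 : (η w * Y) ^ 2 = η w ^ 2 * Y * Y := by ring
    linarith
  rcases lt_or_ge y 1 with hy1 | hy1
  · have h1 := h.eta_anti ⟨hM, hMy.trans_lt hy1⟩ ⟨hy0, hy1⟩ hMy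
    exact ((mul_le_mul_of_nonneg_right h1 hr.le).trans hbase).trans hE1
  have hyr : y * r ^ (P + 1) ≤ G * C₁ * M * s ^ P := by
    have h1 : y * r ^ (P + 1) = G * (L * r ^ P) := by rw [hy, pow_succ]; field_simp
    rw [h1]
    have := mul_le_mul_of_nonneg_left hLr hG.le
    linarith
  rcases le_total M 1 with hM1 | hM1
  · refine (hpow y r hy1 hr ?_ ?_).trans hE1
    · exact (mul_le_mul_of_nonneg_right hrs hC0.le).trans hs1
    · have h1 : s ^ P ≤ 1 := pow_le_one₀ hs0.le hsle
      have h2 : M * s ^ P ≤ 1 := mul_le_one₀ hM1 (by positivity) h1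
      have h3 := mul_le_mul_of_nonneg_left h2 (by positivity : 0 ≤ G * C₁)
      linarith
  have hMM : 0 < M * η M := by positivity
  have hMM1 : 1 ≤ M * η M := one_le_mul_of_one_le_of_one_le hM1 hηM
  have hAM := hηη M hM1
  rcases le_total y (M * η M) with hw | hw
  · have h1 : η y ≤ A * η M := (h.eta_mono hy1 hMM1 hw).trans hAM
    have h2 := mul_le_mul_of_nonneg_right h1 hr.le
    have h3 := mul_le_mul_of_nonneg_left hbase (by linarith : 0 ≤ A)
    have h4 : 0 ≤ A * E := by positivity
    have h5 := mul_le_mul_of_nonneg_right hΛ h4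
    linarith
  · obtain ⟨w, hwdef⟩ : ∃ w : ℝ, w = y / (M * η M) := ⟨_, rfl⟩
    have hw1 : 1 ≤ w := by rw [hwdef, one_le_div hMM]; exact hw
    have hyw : y = M * η M * w := by rw [hwdef]; field_simp
    have h1 : η y ≤ Λ₀ * (A * η M) * η w := by
      rw [hyw]
      refine (h.cond_P3 _ hMM _ (by linarith)).trans ?_
      have := h.eta_ge_one w (by linarith)
      gcongr
    have h2 : η w * (η M * r) ≤ E := by
      refine hpow w (η M * r) hw1 (by positivity) ?_ ?_
      · refine le_trans ?_ hsη
        rw [mul_comm s]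
        gcongr
      · have h3 : w * (η M * r) ^ (P + 1) * M = y * r ^ (P + 1) * η M ^ P := by
          rw [hyw]; ring
        have h4 : (s * η M) ^ P ≤ 1 := by
          refine pow_le_one₀ (by positivity) ?_
          have : s * η M * 1 ≤ s * η M * C := mul_le_mul_of_nonneg_left hC_1 (by positivity)
          linarith
        have h5 := mul_le_mul_of_nonneg_right hyr (by positivity : 0 ≤ η M ^ P)
        have h6 := mul_le_mul_of_nonneg_left h4 (by positivity : 0 ≤ G * C₁ * M)
        rw [mul_pow] at h6
        have h7 : w * (η M * r) ^ (P + 1) * M ≤ G * C₁ * M := by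
          rw [h3]; linarith
        exact le_of_mul_le_mul_right h7 hM
    have h3 := mul_le_mul_of_nonneg_right h1 hr.le
    have h4 := mul_le_mul_of_nonneg_left h2 (by positivity : 0 ≤ Λ₀ * A)
    linarith

lemma SuperC.rescale_of_le {n : ℕ} {lam Lam G κ m s t₀ : ℝ} {x₀ : Sp n} {D D' : Set (Sp n × ℝ)}
    {u : Sp n × ℝ → ℝ} (hm : 0 < m) (hs : 0 < s) (hD : MapsTo (pscale x₀ t₀ s) D' D) {K : ℝ}
    (h : SuperC lam Lam (G * m / s) K D u) (hK : K ≤ κ * m / s ^ 2) :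
    SuperC lam Lam G κ D' (fun z => u (pscale x₀ t₀ s z) / m) := by
  refine (h.rescale x₀ t₀ hm hs).mono ?_ ?_ hD
  · field_simp; rfl
  · rw [le_div_iff₀ (by positivity)] at hK
    rw [div_le_iff₀ hm]
    exact hK

lemma Normalized.of_pscale {n : ℕ} {lam Lam G κ N m s t₀ T : ℝ} {x₀ : Sp n} {φ : ℝ → ℝ}
    {Q : Set (Sp n × ℝ)} {u : Sp n × ℝ → ℝ} (hm : 0 < m) (hs : 0 < s)
    (hmaps : MapsTo (pscale x₀ t₀ s) (dom n T) Q) (huc : ContinuousOn u Q)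
    (hu : ∀ z ∈ Q, 0 ≤ u z) (hT : ∀ G : ℝ, TouchC lam Lam G (φ G) Q u)
    (hscale : ∀ k i : ℕ, k ≤ i →
      φ (G * (m * N ^ k) / (s / 2 ^ i)) ≤ κ * (m * N ^ k) / (s / 2 ^ i) ^ 2) :
    Normalized n lam Lam G κ N T (fun z => u (pscale x₀ t₀ s z) / m) := by
  refine ⟨(huc.comp (continuous_pscale _ _ _).continuousOn hmaps).div_const _,
    fun z hz => div_nonneg (hu _ (hmaps hz)) hm.le, fun k i hki => ?_⟩
  refine SuperC.rescale_of_le hm hs hmaps ((hT _).superC huc) ?_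
  refine le_trans (le_of_eq ?_) ((hscale k i hki).trans (le_of_eq ?_))
  · congr 1; field_simp
  · field_simp

lemma Reflected.of_pscale {n : ℕ} {lam Lam G C m s t₀ T : ℝ} {γ : ℕ} {x₀ : Sp n} {φ : ℝ → ℝ}
    {Q : Set (Sp n × ℝ)} {u : Sp n × ℝ → ℝ} (hm : 0 < m) (hs : 0 < s)
    (hmaps : MapsTo (pscale x₀ t₀ s) (dom n T) Q) (huc : ContinuousOn u Q)
    (hT : ∀ L G : ℝ, TouchC lam Lam G (φ G) Q (fun z => L - u z))
    (hscale : ∀ r L : ℝ, 0 < r → r ≤ 1 → 1 ≤ L → L * r ^ γ ≤ C →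
      φ (G / 8 * (m * L) / (s * r)) ≤ 1 / 8 * (m * L) / (s * r) ^ 2) :
    Reflected n lam Lam G C T γ (fun z => u (pscale x₀ t₀ s z) / m) := by
  intro r L hr hr1 hL hC
  have h1 : (fun z => 9 / 8 * L - u (pscale x₀ t₀ s z) / m) =
      fun z => (fun w => 9 / 8 * L * m - u w) (pscale x₀ t₀ s z) / m := by
    ext z; field_simp
  rw [h1]
  refine SuperC.rescale_of_le hm hs hmaps
    ((hT _ _).superC (continuousOn_const.sub huc)) ?_
  refine le_trans (le_of_eq ?_) ((hscale r L hr hr1 hL hC).trans (le_of_eq ?_))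
  · congr 1; field_simp
  · field_simp

/-- **Theorem 1.2, forward-in-time intrinsic Harnack.**
There are a dimensional constant `c_n ∈ (0,1]` and a universal constant `C > 0` such that
for every non-negative continuous viscosity supersolution/subsolution pair condition on
`u` in `Q₂`, if `u(x₀,t₀) > 0` and `0 < ρ ≤ u(x₀,t₀)/(C(φ(u(x₀,t₀))+u(x₀,t₀)))` with
`Q_{2ρ}(x₀,t₀) ∪ A⁺_ρ(x₀,t₀) ⊆ Q₂`, then `u(x₀,t₀) ≤ C · inf_{A⁺_ρ(x₀,t₀)} u`. -/
theorem forward_intrinsic_harnack (n : ℕ) :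
    ∃ c ∈ Set.Ioc (0 : ℝ) 1,
      ∀ lam Lam : ℝ, 0 < lam → lam ≤ Lam →
      ∀ φ η : ℝ → ℝ, ∀ Λ₀ : ℝ, PhiEta φ η Λ₀ →
      ∃ C : ℝ, 0 < C ∧
        ∀ u : EuclideanSpace ℝ (Fin n) × ℝ → ℝ,
          ContinuousOn u (pcube (0 : EuclideanSpace ℝ (Fin n)) 0 2) →
          (∀ p ∈ pcube (0 : EuclideanSpace ℝ (Fin n)) 0 2, 0 ≤ u p) →
          IsViscositySupersol lam Lam φ (pcube (0 : EuclideanSpace ℝ (Fin n)) 0 2) u →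
          IsViscositySubsol lam Lam φ (pcube (0 : EuclideanSpace ℝ (Fin n)) 0 2) u →
          ∀ (x₀ : EuclideanSpace ℝ (Fin n)) (t₀ ρ : ℝ),
            0 < u (x₀, t₀) → 0 < ρ →
            ρ ≤ u (x₀, t₀) / (C * (φ (u (x₀, t₀)) + u (x₀, t₀))) →
            pcube x₀ t₀ (2 * ρ) ∪ aPlus c x₀ t₀ ρ ⊆
              pcube (0 : EuclideanSpace ℝ (Fin n)) 0 2 →
            ∀ p ∈ aPlus c x₀ t₀ ρ, u (x₀, t₀) ≤ C * u p := by
  have hn : (0 : ℝ) ≤ n := n.cast_nonneg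
  obtain ⟨k, hk⟩ : ∃ k : ℝ, k = 3 * n + 6 := ⟨_, rfl⟩
  have hk6 : 6 ≤ k := by linarith
  have hk0 : 0 < k := by linarith
  refine ⟨1 / k, ⟨by positivity, by rw [div_le_one hk0]; linarith⟩, ?_⟩
  intro lam Lam hlam hLam φ η Λ₀ hφ
  obtain ⟨N, hN, G, hG, κ, hκ, G₁, hG₁, C, hC, γ, M₀, hM₀, hmain⟩ := exists_center_le n hlam hLam
  obtain ⟨a, ha⟩ := pow_unbounded_of_one_lt N one_lt_two
  obtain ⟨C₂, hC₂⟩ : ∃ C : ℝ, C = M₀ + 1 := ⟨_, rfl⟩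
  have hC₂1 : 1 ≤ C₂ := by linarith
  have hC₂0 : 0 < C₂ := by linarith
  obtain ⟨Ca, hCa, hSa⟩ := hφ.exists_scale_le hG hκ one_pos hC₂0 a
  obtain ⟨Cb, hCb, hSb⟩ := hφ.exists_scale_le (show 0 < G₁ / 8 by positivity)
    (show (0 : ℝ) < 1 / 8 by norm_num) (show 0 < C / C₂ by positivity) hC₂0 γ
  obtain ⟨Cf, hCf⟩ : ∃ D : ℝ, D = max C₂ (max Ca Cb) := ⟨_, rfl⟩
  have hCf1 : C₂ ≤ Cf := by rw [hCf]; exact le_max_left _ _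
  have hCf2 : Ca ≤ Cf := by rw [hCf]; exact (le_max_left _ _).trans (le_max_right _ _)
  have hCf3 : Cb ≤ Cf := by rw [hCf]; exact (le_max_right _ _).trans (le_max_right _ _)
  refine ⟨Cf, by linarith, ?_⟩
  intro u huc hu hsup hsubs x₀ t₀ ρ hM hρ hρM hsubset p hp
  obtain ⟨M, hMu⟩ : ∃ M, M = u (x₀, t₀) := ⟨_, rfl⟩
  rw [← hMu] at hM hρM ⊢
  by_contra hcon
  push Not at hcon
  have hpQ := hsubset (Or.inr hp)
  have hcube : pcube x₀ t₀ (2 * ρ) ⊆ pcube (0 : Sp n) 0 2 := fun z hz => hsubset (Or.inl hz)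
  have hup := hu p hpQ
  have hφM := hφ.phi_pos hM
  have hρle : ∀ C' > 0, C' ≤ Cf → ρ ≤ M / (C' * (φ M + M)) := fun C' h0 h1 =>
    hρM.trans (by gcongr)
  obtain ⟨s, hs⟩ : ∃ s : ℝ, s = ρ / k := ⟨_, rfl⟩
  have hs0 : 0 < s := by rw [hs]; positivity
  have hsk : ρ = s * k := by rw [hs]; field_simp
  have hsρ : s ≤ ρ := by
    rw [hsk]; exact le_mul_of_one_le_right hs0.le (by linarith)
  obtain ⟨m, hm⟩ : ∃ m : ℝ, m = M / C₂ := ⟨_, rfl⟩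
  have hm0 : 0 < m := by rw [hm]; positivity
  have hmM : M = m * C₂ := by rw [hm]; field_simp
  obtain ⟨y, hy⟩ : ∃ y : Sp n, y = x₀ - s • cubeCenter n := ⟨_, rfl⟩
  obtain ⟨τ, hτ⟩ : ∃ τ : ℝ, τ = t₀ - s ^ 2 / 2 := ⟨_, rfl⟩
  obtain ⟨q, hq⟩ : ∃ q : Sp n × ℝ,
    q = (s⁻¹ • (p.1 - x₀) + cubeCenter n, (p.2 - t₀) / s ^ 2 + 1 / 2) := ⟨_, rfl⟩
  have hpsq : pscale y τ s q = p := by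
    rw [hq, hy, hτ]
    refine Prod.ext ?_ ?_
    · simp only [pscale, smul_add, smul_smul, mul_inv_cancel₀ hs0.ne', one_smul]
      abel
    · simp only [pscale]
      field_simp
      ring
  have hpsc : pscale y τ s (cubeCenter n, 1 / 2) = (x₀, t₀) := by
    rw [hy, hτ]
    refine Prod.ext ?_ ?_
    · simp only [pscale]; abel
    · simp only [pscale]; ring
  have hq1 : q.1 ∈ unitCube n := by
    intro j
    have h1 := hp.1 j
    rw [mul_one_div, ← hs] at h1
    have h2 : q.1 j = s⁻¹ * (p.1 j - x₀ j) + 1 / 2 := by rw [hq]; rfl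
    have h3 : |s⁻¹ * (p.1 j - x₀ j)| < 1 / 2 := by
      rw [abs_mul, abs_of_pos (inv_pos.2 hs0), inv_mul_lt_iff₀ hs0]
      linarith
    rw [abs_lt] at h3
    rw [h2]
    constructor <;> linarith [h3.1, h3.2]
  have hs2 : 0 < s ^ 2 := by positivity
  have hq2 : k ^ 2 ≤ q.2 ∧ q.2 ≤ k ^ 2 + 1 := by
    have h1 := hp.2
    rw [mul_one_div, ← hs, hsk, mul_pow] at h1
    have h2 : q.2 = (p.2 - t₀) / s ^ 2 + 1 / 2 := by rw [hq]
    have h3 : (p.2 - t₀) / s ^ 2 * s ^ 2 = p.2 - t₀ := by field_simp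
    rw [h2]
    constructor
    · refine le_of_mul_le_mul_right ?_ hs2
      linarith [h1.1]
    · refine le_of_mul_le_mul_right ?_ hs2
      linarith [h1.2]
  have hk2 : 5 ≤ k ^ 2 := by nlinarith
  have hmaps : MapsTo (pscale y τ s) (dom n q.2) (pcube (0 : Sp n) 0 2) := by
    rintro z ⟨hz1, hz2, hz3⟩
    have hz1' := mem_closedBall_iff_norm.1 hz1
    rw [← hk] at hz1'
    have hcen : (x₀, t₀ - s ^ 2 / 2) ∈ pcube x₀ t₀ (2 * ρ) := by
      refine ⟨fun i => by simpa using hρ, ?_, by linarith⟩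
      have : s ^ 2 ≤ ρ ^ 2 := pow_le_pow_left₀ hs0.le hsρ 2
      simp only
      linarith
    have hx : (pscale y τ s z).1 = x₀ + s • (z.1 - cubeCenter n) := by
      rw [hy]; simp only [pscale, smul_sub]; abel
    have hsp : ((pscale y τ s z).1, t₀) ∈ pcube x₀ t₀ (2 * ρ) := by
      refine ⟨fun i => ?_, sub_lt_self t₀ (by positivity), le_rfl⟩
      rw [hx]
      have e : (x₀ + s • (z.1 - cubeCenter n)) i - x₀ i = (s • (z.1 - cubeCenter n)) i :=
        add_sub_cancel_left (x₀ i) _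
      simp only [e]
      have h1 := PiLp.norm_apply_le (s • (z.1 - cubeCenter n)) i
      rw [norm_smul, Real.norm_of_nonneg hs0.le, Real.norm_eq_abs] at h1
      have h2 := mul_le_mul_of_nonneg_left hz1' hs0.le
      linarith
    refine ⟨(hcube hsp).1, ?_, ?_⟩
    · have h1 := (hcube hcen).2.1
      have h2 : 0 ≤ s ^ 2 * z.2 := by positivity
      rw [hτ]
      simp only [pscale] at h1 ⊢
      linarith
    · have h1 := hpQ.2.2
      rw [← hpsq] at h1
      have h2 := mul_le_mul_of_nonneg_left hz3 hs2.le
      simp only [pscale] at h1 ⊢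
      linarith
  obtain ⟨F, hF, huF⟩ := exists_smooth_majorant huc
  have hNorm : Normalized n lam Lam G κ N q.2 (fun z => u (pscale y τ s z) / m) := by
    refine Normalized.of_pscale hm0 hs0 hmaps huc hu
      (fun G => hsup.touchC hLam hφ.phi_mono hu G) fun j i hji => ?_
    have h2i : (1 : ℝ) ≤ 2 ^ i := one_le_pow₀ (by norm_num)
    have hNj : 1 ≤ N ^ j := one_le_pow₀ hN.le
    refine hSa M ρ s (s / 2 ^ i) (m * N ^ j) hM (by positivity) (div_le_self hs0.le h2i) hsρ
      (hρle Ca hCa hCf2) ?_ ?_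
    · rw [← hm]; exact le_mul_of_one_le_right hm0.le hNj
    · have h1 : N ^ j ≤ ((2 : ℝ) ^ i) ^ a := by
        rw [← pow_mul, mul_comm, pow_mul]
        exact (pow_le_pow_left₀ (by linarith) ha.le j).trans
          (pow_le_pow_right₀ (one_le_pow₀ (by norm_num)) hji)
      have h2 : m ≤ M := by rw [hmM]; exact le_mul_of_one_le_right hm0.le hC₂1
      rw [div_pow, mul_div_assoc', div_le_iff₀ (by positivity), one_mul]
      calc m * N ^ j * s ^ a ≤ M * ((2 : ℝ) ^ i) ^ a * s ^ a := by gcongr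
        _ = M * s ^ a * (2 ^ i) ^ a := by ring
  have hRefl : Reflected n lam Lam G₁ C q.2 γ (fun z => u (pscale y τ s z) / m) := by
    refine Reflected.of_pscale hm0 hs0 hmaps huc
      (fun L G => hsubs.touchC hLam hφ.phi_mono hF huF L G) fun r L hr hr1 hL hLC => ?_
    refine hSb M ρ s (s * r) (m * L) hM (by positivity) (mul_le_of_le_one_right hs0.le hr1) hsρ
      (hρle Cb hCb hCf3) ?_ ?_
    · rw [← hm]; exact le_mul_of_one_le_right hm0.le hL
    · have h1 : C / C₂ * M = C * m := by rw [hmM]; field_simp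
      rw [h1, mul_pow]
      calc m * L * (s ^ γ * r ^ γ) = m * s ^ γ * (L * r ^ γ) := by ring
        _ ≤ m * s ^ γ * C := by gcongr
        _ = C * m * s ^ γ := by ring
  have hfin := hmain _ q hNorm hRefl hq1 (hk2.trans hq2.1) (by rw [← hk]; exact hq2.2) (by
    simp only [hpsq]
    rw [div_le_one hm0, hm, le_div_iff₀ hC₂0]
    have := mul_le_mul_of_nonneg_right hCf1 hup
    linarith)
  simp only [hpsc] at hfin
  rw [← hMu, hmM, mul_div_cancel_left₀ _ hm0.ne'] at hfin
  linarith
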